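/- With the construction described in the context, one has 0 ≤ a_n ≤ 2 for every n ∈ I, and there is a constant C, depending only on ν, M, δ, such that for every integer d with 1 ≤ d ≤ x^{1−ϖ}, |∑_{n ∈ I, d|n} a_n − K/d| ≤ C·(K/d)·e^{−c_1·√(log x)}. -/

import Mathlib

open Finset MeasureTheory
open scoped Classical

noncomputable section

/-- The interval `J_i = [i(1/M−δ), i(1/M+δ)]`. -/
def Jset (M : ℕ) (δ : ℝ) (i : ℕ) : Set ℝ :=
  Set.Icc ((i : ℝ) * (1 / M - δ)) ((i : ℝ) * (1 / M + δ))

/-- The class of a prime `p`: the index `i ∈ [1,M]` with `p ∈ 𝒫_i`, i.e.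
`x^{i(1/M−δ)} ≤ p ≤ x^{i(1/M+δ)}` (and `0` if there is no such index). -/
def cls (M : ℕ) (δ x : ℝ) (p : ℕ) : ℕ :=
  if h : ∃ i : ℕ, i ∈ Finset.Icc 1 M ∧
      x ^ ((i : ℝ) * (1 / M - δ)) ≤ (p : ℝ) ∧ (p : ℝ) ≤ x ^ ((i : ℝ) * (1 / M + δ))
  then h.choose else 0

/-- Given `ρ : Fin r → ℕ`, `v : Fin r → ℝ` and free variables
`t = (w_{ij} : 1 ≤ j ≤ r, 1 ≤ i ≤ ρ_j − 1)`, produce the full family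
`(w_{ij} : 1 ≤ j ≤ r, 1 ≤ i ≤ ρ_j)` in which the last variable of each block is
determined by the constraint `∑_{i=1}^{ρ_j} w_{ij} = v_j`. -/
def assemble {r : ℕ} (ρ : Fin r → ℕ) (v : Fin r → ℝ)
    (t : ((j : Fin r) × Fin (ρ j - 1)) → ℝ) : ((j : Fin r) × Fin (ρ j)) → ℝ :=
  fun ji => if h : (ji.2 : ℕ) < ρ ji.1 - 1 then t ⟨ji.1, ⟨(ji.2 : ℕ), h⟩⟩
    else v ji.1 - ∑ i : Fin (ρ ji.1 - 1), t ⟨ji.1, i⟩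

/-- `e_α = (−1)^{Σ(α)+|α|}/(α_1⋯α_r)`. -/
def econst {r : ℕ} (ρ : Fin r → ℕ) : ℝ :=
  (-1 : ℝ) ^ (∑ j, ρ j + r) / ∏ j, (ρ j : ℝ)

/-- The function `f_α` of the paper (formula (3.2)), evaluated using the arrangement
`ρ = (ρ_1,…,ρ_r)` of `α` matching the argument `v`:
`f_α(v) = e_α v_1⋯v_r ∫ f_{1_M}(w)/∏ w_{ij} dw`, the `(M−r)`-dimensional integral being
over all `w = (w_{ij} : 1 ≤ j ≤ r, 1 ≤ i ≤ ρ_j)` with `w_{ij} ∈ J_1` and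
`∑_{i=1}^{ρ_j} w_{ij} = v_j` for each `j` (`f_{1_M}` is symmetric, so the identification
of the index set with `Fin M` is immaterial). -/
def Falpha (M : ℕ) (δ : ℝ) (f1 : (Fin M → ℝ) → ℝ) {r : ℕ}
    (ρ : Fin r → ℕ) (v : Fin r → ℝ) : ℝ :=
  if h : ∑ j, ρ j = M then
    econst ρ * (∏ j, v j) *
      ∫ t in {t : ((j : Fin r) × Fin (ρ j - 1)) → ℝ |
          ∀ ji : (j : Fin r) × Fin (ρ j), assemble ρ v t ji ∈ Jset M δ 1},
        f1 (fun m => assemble ρ v t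
            ((Fintype.equivFinOfCardEq
              (by simpa using h : Fintype.card ((j : Fin r) × Fin (ρ j)) = M)).symm m)) /
          ∏ ji : (j : Fin r) × Fin (ρ j), assemble ρ v t ji
  else 0

/-- The numbers `b_n`: if `n = p_1⋯p_r` with each `p_i` lying in some class `𝒫_{α_i}`,
then `b_n = f_α(log p_1/log n, …, log p_r/log n)`; otherwise `b_n = 0`. -/
def bseq (M : ℕ) (δ x : ℝ) (f1 : (Fin M → ℝ) → ℝ) (n : ℕ) : ℝ :=
  if ∀ p ∈ n.primeFactorsList, ∃ i : ℕ, i ∈ Finset.Icc 1 M ∧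
      x ^ ((i : ℝ) * (1 / M - δ)) ≤ (p : ℝ) ∧ (p : ℝ) ≤ x ^ ((i : ℝ) * (1 / M + δ))
  then
    Falpha M δ f1
      (fun j : Fin n.primeFactorsList.length => cls M δ x (n.primeFactorsList.get j))
      (fun j : Fin n.primeFactorsList.length =>
        Real.log ((n.primeFactorsList.get j : ℝ)) / Real.log (n : ℝ))
  else 0

/-- The interval `I = ℤ ∩ (x, x(1+e^{−c_1 √(log x)})]`. -/
def Ifin (c1 x : ℝ) : Finset ℕ :=
  Finset.Ioc ⌊x⌋₊ ⌊x * (1 + Real.exp (-c1 * Real.sqrt (Real.log x)))⌋₊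

/-- The hypotheses on `f_{1_M}`: symmetric in all variables, vanishing whenever some
coordinate is `≤ 1/(2M)`, supported on `{u : u_i ∈ J_1 for all i}`, `|f_{1_M}| ≤ 1`, and
all first-order partial derivatives at most `B` in absolute value. -/
def F1Props (M : ℕ) (δ B : ℝ) (f1 : (Fin M → ℝ) → ℝ) : Prop :=
  (∀ (σ : Equiv.Perm (Fin M)) (u : Fin M → ℝ), f1 (u ∘ σ) = f1 u) ∧
  (∀ u : Fin M → ℝ, (∃ i, u i ≤ 1 / (2 * M)) → f1 u = 0) ∧
  (∀ u : Fin M → ℝ, (∃ i, u i ∉ Jset M δ 1) → f1 u = 0) ∧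
  (∀ u : Fin M → ℝ, |f1 u| ≤ 1) ∧
  Differentiable ℝ f1 ∧
  (∀ (u : Fin M → ℝ) (i : Fin M), |fderiv ℝ f1 u (Pi.single i 1)| ≤ B)

end


open Finset MeasureTheory
open scoped Classical

noncomputable section

/-- generic-index version of assemble -/
def asm {ι : Type} (ρ : ι → ℕ) (v : ι → ℝ)
    (t : ((j : ι) × Fin (ρ j - 1)) → ℝ) : ((j : ι) × Fin (ρ j)) → ℝ :=
  fun ji => if h : (ji.2 : ℕ) < ρ ji.1 - 1 then t ⟨ji.1, ⟨(ji.2 : ℕ), h⟩⟩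
    else v ji.1 - ∑ i : Fin (ρ ji.1 - 1), t ⟨ji.1, i⟩

/-- the integrand -/
def phiK (M : ℕ) (f1 : (Fin M → ℝ) → ℝ) {κ : Type} [Fintype κ] (w : κ → ℝ) : ℝ :=
  if h : Fintype.card κ = M then
    f1 (fun m => w ((Fintype.equivFinOfCardEq h).symm m)) * ∏ i, (max (w i) (1 / (2 * M)))⁻¹
  else 0

/-- the block integral -/
def Phi (M : ℕ) (f1 : (Fin M → ℝ) → ℝ) {ι : Type} [Fintype ι] (ρ : ι → ℕ) (v : ι → ℝ) : ℝ :=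
  ∫ t : ((j : ι) × Fin (ρ j - 1)) → ℝ, phiK M f1 (asm ρ v t)

end

theorem phiK_reindex {M : ℕ} {δ B : ℝ} {f1 : (Fin M → ℝ) → ℝ} (hf : F1Props M δ B f1)
    {κ κ' : Type} [Fintype κ] [Fintype κ'] (e : κ ≃ κ') (w : κ' → ℝ) :
    phiK M f1 (fun i => w (e i)) = phiK M f1 w := by
  unfold phiK
  have hc : Fintype.card κ = Fintype.card κ' := Fintype.card_congr e
  by_cases h : Fintype.card κ' = M
  · have h' : Fintype.card κ = M := hc.trans h
    rw [dif_pos h, dif_pos h']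
    congr 1
    · rw [← hf.1 ((Fintype.equivFinOfCardEq h').symm.trans (e.trans (Fintype.equivFinOfCardEq h)))
        (fun m => w ((Fintype.equivFinOfCardEq h).symm m))]
      congr 1
      ext m
      simp
    · exact Fintype.prod_equiv e _ _ (fun _ => rfl)
  · have h' : ¬ Fintype.card κ = M := fun h1 => h (hc.symm.trans h1)
    rw [dif_neg h, dif_neg h']

theorem phiK_eq_zero {M : ℕ} {δ B : ℝ} {f1 : (Fin M → ℝ) → ℝ} (hf : F1Props M δ B f1)
    {κ : Type} [Fintype κ] (w : κ → ℝ) (i : κ) (hi : w i ∉ Jset M δ 1) :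
    phiK M f1 w = 0 := by
  unfold phiK
  split_ifs with h
  · rw [hf.2.2.1 _ ⟨Fintype.equivFinOfCardEq h i, by simpa using hi⟩, zero_mul]
  · rfl

theorem asm_sum {ι : Type} (ρ : ι → ℕ) (v : ι → ℝ)
    (t : ((j : ι) × Fin (ρ j - 1)) → ℝ) (j : ι) (hj : 1 ≤ ρ j) :
    ∑ i : Fin (ρ j), asm ρ v t ⟨j, i⟩ = v j := by
  obtain ⟨m, hm⟩ : ∃ m, ρ j = m + 1 := ⟨ρ j - 1, by omega⟩
  have key : ∀ (n : ℕ) (g : ℕ → ℝ), ∑ i : Fin n, g i = ∑ i ∈ Finset.range n, g i :=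
    fun n g => Fin.sum_univ_eq_sum_range g n
  let g : ℕ → ℝ := fun i => if h : i < ρ j - 1 then t ⟨j, ⟨i, h⟩⟩ else
    v j - ∑ i : Fin (ρ j - 1), t ⟨j, i⟩
  have h1 : ∑ i : Fin (ρ j), asm ρ v t ⟨j, i⟩ = ∑ i : Fin (ρ j), g i := rfl
  have h2 : ∑ i : Fin (ρ j - 1), t ⟨j, i⟩ = ∑ i : Fin (ρ j - 1), g i := by
    refine Finset.sum_congr rfl (fun i _ => ?_)
    simp [g, i.2]
  rw [h1, key]
  have h3 : Finset.range (ρ j) = Finset.range ((ρ j - 1) + 1) := by congr 1; omega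
  rw [h3, Finset.sum_range_succ, ← key, ← h2]
  simp [g]

theorem asm_t {ι : Type} (ρ : ι → ℕ) (v : ι → ℝ)
    (t : ((j : ι) × Fin (ρ j - 1)) → ℝ) (s : (j : ι) × Fin (ρ j - 1)) :
    asm ρ v t ⟨s.1, ⟨s.2, by have := s.2.2; omega⟩⟩ = t s := by
  unfold asm
  simp [s.2.2]

theorem Phi_eq_zero_of_notMem {M : ℕ} {δ B : ℝ} {f1 : (Fin M → ℝ) → ℝ} (hf : F1Props M δ B f1)
    {ι : Type} [Fintype ι] (ρ : ι → ℕ) (v : ι → ℝ) (j : ι) (hj : 1 ≤ ρ j)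
    (hv : v j ∉ Jset M δ (ρ j)) : Phi M f1 ρ v = 0 := by
  unfold Phi
  rw [show (fun t => phiK M f1 (asm ρ v t)) = fun _ => 0 from ?_]
  · simp
  ext t
  by_contra hne
  apply hv
  have hall : ∀ i : Fin (ρ j), asm ρ v t ⟨j, i⟩ ∈ Jset M δ 1 := by
    intro i
    by_contra hi
    exact hne (phiK_eq_zero hf _ ⟨j, i⟩ hi)
  rw [← asm_sum ρ v t j hj]
  unfold Jset at hall ⊢
  simp only [Set.mem_Icc, Nat.cast_one, one_mul] at hall ⊢
  constructor
  · have := Finset.card_nsmul_le_sum (Finset.univ : Finset (Fin (ρ j)))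
      (fun i => asm ρ v t ⟨j, i⟩) (1 / M - δ) (fun i _ => (hall i).1)
    simpa using this
  · have := Finset.sum_le_card_nsmul (Finset.univ : Finset (Fin (ρ j)))
      (fun i => asm ρ v t ⟨j, i⟩) (1 / M + δ) (fun i _ => (hall i).2)
    simpa [mul_add] using this

theorem Phi_eq_zero_of_sum {M : ℕ} {f1 : (Fin M → ℝ) → ℝ}
    {ι : Type} [Fintype ι] (ρ : ι → ℕ) (v : ι → ℝ) (h : ∑ j, ρ j ≠ M) : Phi M f1 ρ v = 0 := by
  unfold Phi phiK
  have : ¬ Fintype.card ((j : ι) × Fin (ρ j)) = M := by simpa using h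
  simp only [dif_neg this, integral_zero]

theorem Phi_reindex {M : ℕ} {δ B : ℝ} {f1 : (Fin M → ℝ) → ℝ} (hf : F1Props M δ B f1)
    {ι ι' : Type} [Fintype ι] [Fintype ι'] (e : ι ≃ ι') (ρ : ι' → ℕ) (v : ι' → ℝ) :
    Phi M f1 (fun j => ρ (e j)) (fun j => v (e j)) = Phi M f1 ρ v := by
  unfold Phi
  let e1 : ((j : ι) × Fin (ρ (e j) - 1)) ≃ ((j : ι') × Fin (ρ j - 1)) :=
    Equiv.sigmaCongrLeft (β := fun j => Fin (ρ j - 1)) e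
  let e2 : ((j : ι) × Fin (ρ (e j))) ≃ ((j : ι') × Fin (ρ j)) :=
    Equiv.sigmaCongrLeft (β := fun j => Fin (ρ j)) e
  have mp := volume_measurePreserving_piCongrLeft (fun _ : ((j : ι') × Fin (ρ j - 1)) => ℝ) e1
  rw [← mp.integral_comp']
  congr 1
  ext t
  rw [← phiK_reindex hf e2]
  congr 1
  ext ⟨j, i⟩
  have ht : ∀ s, (MeasurableEquiv.piCongrLeft (fun _ : ((j : ι') × Fin (ρ j - 1)) => ℝ) e1) t (e1 s)
      = t s := fun s => Equiv.piCongrLeft_apply_apply (fun _ => ℝ) e1 t s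
  have ht' : ∀ (j : ι) (s : Fin (ρ (e j) - 1)),
    (MeasurableEquiv.piCongrLeft (fun _ : ((j : ι') × Fin (ρ j - 1)) => ℝ) e1) t ⟨e j, s⟩
      = t ⟨j, s⟩ := fun j s => ht ⟨j, s⟩
  change _ = asm ρ v _ ⟨e j, i⟩
  unfold asm
  simp only [ht']

open Finset MeasureTheory
open scoped Classical

theorem prod_diff_le {κ : Type} (s : Finset κ) (a b : κ → ℝ) (K ε : ℝ) (hK : 1 ≤ K) (hε : 0 ≤ ε)
    (ha : ∀ i ∈ s, |a i| ≤ K) (hb : ∀ i ∈ s, |b i| ≤ K) (hab : ∀ i ∈ s, |a i - b i| ≤ ε) :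
    |∏ i ∈ s, a i - ∏ i ∈ s, b i| ≤ s.card * K ^ s.card * ε ∧ |∏ i ∈ s, a i| ≤ K ^ s.card ∧
      |∏ i ∈ s, b i| ≤ K ^ s.card := by
  induction s using Finset.induction_on with
  | empty => simp
  | insert i s hi ih =>
    obtain ⟨h1, h2, h3⟩ := ih (fun i h => ha i (mem_insert_of_mem h))
      (fun i h => hb i (mem_insert_of_mem h)) (fun i h => hab i (mem_insert_of_mem h))
    have ai := ha i (mem_insert_self _ _)
    have bi := hb i (mem_insert_self _ _)
    have abi := hab i (mem_insert_self _ _)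
    rw [prod_insert hi, prod_insert hi, card_insert_of_notMem hi]
    set X := ∏ i ∈ s, a i
    set Y := ∏ i ∈ s, b i
    have hKp : 0 ≤ K ^ s.card := by positivity
    refine ⟨?_, ?_, ?_⟩
    · have : a i * X - b i * Y = a i * (X - Y) + (a i - b i) * Y := by ring
      rw [this]
      calc |a i * (X - Y) + (a i - b i) * Y| ≤ |a i| * |X - Y| + |a i - b i| * |Y| := by
            rw [← abs_mul, ← abs_mul]; exact abs_add_le _ _
        _ ≤ K * (s.card * K ^ s.card * ε) + ε * K ^ s.card := by gcongr
        _ ≤ K * (s.card * K ^ s.card * ε) + ε * K ^ (s.card + 1) := by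
            gcongr
            omega
        _ = _ := by push_cast; ring
    · rw [abs_mul, pow_succ']; gcongr
    · rw [abs_mul, pow_succ']; gcongr

theorem f1_lip {M : ℕ} {δ B : ℝ} {f1 : (Fin M → ℝ) → ℝ} (hf : F1Props M δ B f1) (hB : 0 ≤ B)
    (u u' : Fin M → ℝ) (ε : ℝ) (hε : 0 ≤ ε) (h : ∀ i, |u i - u' i| ≤ ε) :
    |f1 u - f1 u'| ≤ M * B * ε := by
  obtain ⟨-, -, -, -, hd, hB'⟩ := hf
  have hn : ∀ z, ‖fderiv ℝ f1 z‖ ≤ M * B := by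
    intro z
    refine ContinuousLinearMap.opNorm_le_bound _ (by positivity) (fun w => ?_)
    have hw : w = ∑ i, w i • (Pi.single i (1 : ℝ) : Fin M → ℝ) := by
      ext j; simp [Finset.sum_apply, Pi.single_apply]
    conv_lhs => rw [hw]
    rw [map_sum]
    calc ‖∑ i, fderiv ℝ f1 z (w i • (Pi.single i (1 : ℝ) : Fin M → ℝ))‖
        ≤ ∑ i : Fin M, ‖w‖ * B := by
          refine norm_sum_le_of_le _ (fun i _ => ?_)
          rw [map_smul, norm_smul]
          have := hB' z i
          have h2 := norm_le_pi_norm w i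
          rw [← Real.norm_eq_abs] at this
          gcongr
      _ = M * B * ‖w‖ := by simp; ring
  have := Convex.norm_image_sub_le_of_norm_fderiv_le (𝕜 := ℝ) (s := Set.univ) (f := f1)
    (fun z _ => hd z) (fun z _ => hn z) convex_univ (Set.mem_univ u') (Set.mem_univ u)
  rw [Real.norm_eq_abs] at this
  refine this.trans ?_
  gcongr
  rw [pi_norm_le_iff_of_nonneg hε]
  intro i
  exact h i

theorem inv_max_bound {M : ℕ} (hM : 2 ≤ M) (z : ℝ) :
    0 ≤ (max z (1 / (2 * (M : ℝ))))⁻¹ ∧ (max z (1 / (2 * (M : ℝ))))⁻¹ ≤ 2 * M := by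
  have hM' : (2 : ℝ) ≤ M := by exact_mod_cast hM
  have h0 : 0 < 1 / (2 * (M : ℝ)) := by positivity
  refine ⟨by positivity, ?_⟩
  have := inv_anti₀ h0 (le_max_right z (1 / (2 * (M : ℝ))))
  simpa using this

theorem inv_max_lip {M : ℕ} (hM : 2 ≤ M) (z z' ε : ℝ) (h : |z - z'| ≤ ε) :
    |(max z (1 / (2 * (M : ℝ))))⁻¹ - (max z' (1 / (2 * (M : ℝ))))⁻¹| ≤ (2 * M) * (2 * M) * ε := by
  have hM' : (2 : ℝ) ≤ M := by exact_mod_cast hM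
  have h0 : 0 < 1 / (2 * (M : ℝ)) := by positivity
  obtain ⟨h1, h2⟩ := inv_max_bound hM z
  obtain ⟨h3, h4⟩ := inv_max_bound hM z'
  set a := max z (1 / (2 * (M : ℝ))) with ha
  set b := max z' (1 / (2 * (M : ℝ))) with hb
  have ha0 : 0 < a := lt_of_lt_of_le h0 (le_max_right _ _)
  have hb0 : 0 < b := lt_of_lt_of_le h0 (le_max_right _ _)
  have e : a⁻¹ - b⁻¹ = a⁻¹ * b⁻¹ * (b - a) := by field_simp
  have hba : |b - a| ≤ ε := by
    rw [abs_sub_comm]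
    exact (abs_max_sub_max_le_abs _ _ _).trans h
  rw [e, abs_mul, abs_of_nonneg (mul_nonneg h1 h3)]
  gcongr

/-- the constant -/
noncomputable def Acon (M : ℕ) (B : ℝ) : ℝ :=
  (M * B) * (2 * M) ^ M + M * (2 * M) ^ M * ((2 * M) * (2 * M)) + (2 * M) ^ M

theorem Acon_ge {M : ℕ} (hM : 2 ≤ M) {B : ℝ} (hB : 0 ≤ B) : (2 * M : ℝ) ^ M ≤ Acon M B ∧ 1 ≤ Acon M B := by
  have hM' : (2 : ℝ) ≤ M := by exact_mod_cast hM
  have : (1 : ℝ) ≤ (2 * M : ℝ) ^ M := one_le_pow₀ (by linarith)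
  have h2 : 0 ≤ (M * B) * (2 * M : ℝ) ^ M + M * (2 * M) ^ M * ((2 * M) * (2 * M)) := by positivity
  unfold Acon
  constructor <;> linarith

theorem phiK_bound {M : ℕ} (hM : 2 ≤ M) {δ B : ℝ} {f1 : (Fin M → ℝ) → ℝ} (hf : F1Props M δ B f1)
    {κ : Type} [Fintype κ] (w : κ → ℝ) : |phiK M f1 w| ≤ (2 * M) ^ M := by
  unfold phiK
  split_ifs with h
  · rw [abs_mul, Finset.abs_prod]
    have h1 := hf.2.2.2.1 (fun m => w ((Fintype.equivFinOfCardEq h).symm m))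
    have h2 : ∏ i, |(max (w i) (1 / (2 * (M : ℝ))))⁻¹| ≤ ∏ i : κ, (2 * M : ℝ) := by
      refine Finset.prod_le_prod (fun i _ => abs_nonneg _) (fun i _ => ?_)
      rw [abs_of_nonneg (inv_max_bound hM _).1]
      exact (inv_max_bound hM _).2
    rw [Finset.prod_const, Finset.card_univ, h] at h2
    calc _ ≤ 1 * (2 * M : ℝ) ^ M := by gcongr
      _ = _ := one_mul _
  · simp

theorem phiK_lip {M : ℕ} (hM : 2 ≤ M) {δ B : ℝ} {f1 : (Fin M → ℝ) → ℝ} (hf : F1Props M δ B f1)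
    (hB : 0 ≤ B)
    {κ : Type} [Fintype κ] (w w' : κ → ℝ) (ε : ℝ) (hε : 0 ≤ ε) (h : ∀ i, |w i - w' i| ≤ ε) :
    |phiK M f1 w - phiK M f1 w'| ≤ Acon M B * ε := by
  have hM' : (2 : ℝ) ≤ M := by exact_mod_cast hM
  unfold phiK
  split_ifs with hc
  · have h1 := hf.2.2.2.1 (fun m => w ((Fintype.equivFinOfCardEq hc).symm m))
    have h1' := hf.2.2.2.1 (fun m => w' ((Fintype.equivFinOfCardEq hc).symm m))
    have h2 := f1_lip hf hB (fun m => w ((Fintype.equivFinOfCardEq hc).symm m))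
      (fun m => w' ((Fintype.equivFinOfCardEq hc).symm m)) ε hε (fun i => h _)
    obtain ⟨h3, h4, h5⟩ := prod_diff_le (Finset.univ : Finset κ) (fun i => (max (w i) (1 / (2 * (M : ℝ))))⁻¹)
      (fun i => (max (w' i) (1 / (2 * (M : ℝ))))⁻¹) (2 * M) ((2 * M) * (2 * M) * ε) (by linarith)
      (by positivity)
      (fun i _ => by rw [abs_of_nonneg (inv_max_bound hM _).1]; exact (inv_max_bound hM _).2)
      (fun i _ => by rw [abs_of_nonneg (inv_max_bound hM _).1]; exact (inv_max_bound hM _).2)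
      (fun i _ => inv_max_lip hM _ _ _ (h i))
    rw [Finset.card_univ, hc] at h3 h4 h5
    set X := ∏ i, (max (w i) (1 / (2 * (M : ℝ))))⁻¹
    set Y := ∏ i, (max (w' i) (1 / (2 * (M : ℝ))))⁻¹
    set F := f1 (fun m => w ((Fintype.equivFinOfCardEq hc).symm m))
    set G := f1 (fun m => w' ((Fintype.equivFinOfCardEq hc).symm m))
    have : F * X - G * Y = (F - G) * X + G * (X - Y) := by ring
    rw [this]
    calc _ ≤ |F - G| * |X| + |G| * |X - Y| := by
          rw [← abs_mul, ← abs_mul]; exact abs_add_le _ _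
      _ ≤ (M * B * ε) * (2 * M) ^ M + 1 * (M * (2 * M) ^ M * ((2 * M) * (2 * M) * ε)) := by gcongr
      _ = (Acon M B - (2 * M) ^ M) * ε := by unfold Acon; ring
      _ ≤ _ := by
        gcongr
        have : (0 : ℝ) ≤ (2 * M : ℝ) ^ M := by positivity
        linarith
  · have := (Acon_ge hM hB).2
    simp; positivity

theorem phiK_cont {M : ℕ} {δ B : ℝ} {f1 : (Fin M → ℝ) → ℝ} (hM : 2 ≤ M) (hf : F1Props M δ B f1)
    {κ : Type} [Fintype κ] : Continuous (fun w : κ → ℝ => phiK M f1 w) := by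
  have hM' : (2 : ℝ) ≤ M := by exact_mod_cast hM
  have h0 : 0 < 1 / (2 * (M : ℝ)) := by positivity
  unfold phiK
  split_ifs with hc
  · have := hf.2.2.2.2.1.continuous
    refine Continuous.mul (this.comp (by fun_prop)) ?_
    refine continuous_finsetProd _ (fun i _ => ?_)
    refine Continuous.inv₀ (by fun_prop) (fun w => ?_)
    exact ne_of_gt (lt_of_lt_of_le h0 (le_max_right _ _))
  · exact continuous_const

theorem asm_cont {ι : Type} [Fintype ι] (ρ : ι → ℕ) :
    Continuous (fun p : (ι → ℝ) × (((j : ι) × Fin (ρ j - 1)) → ℝ) => asm ρ p.1 p.2) := by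
  refine continuous_pi (fun ji => ?_)
  unfold asm
  split_ifs <;> fun_prop

theorem integ_of_box {T : Type} [Fintype T] (g : (T → ℝ) → ℝ) (hg : Continuous g) (a b : ℝ)
    (hz : ∀ t, (∃ i, t i ∉ Set.Icc a b) → g t = 0) : Integrable g := by
  refine hg.integrable_of_hasCompactSupport ?_
  refine HasCompactSupport.intro (K := Set.pi Set.univ (fun _ => Set.Icc a b))
    (isCompact_univ_pi (fun _ => isCompact_Icc)) (fun t ht => hz t ?_)
  simp only [Set.mem_pi, Set.mem_univ, true_imp_iff, not_forall] at ht
  exact ht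

theorem box_bound {T : Type} [Fintype T] (g : (T → ℝ) → ℝ) (a b C : ℝ) (hab : a ≤ b)
    (hz : ∀ t, (∃ i, t i ∉ Set.Icc a b) → g t = 0) (hC : ∀ t, |g t| ≤ C) :
    |∫ t, g t| ≤ C * (b - a) ^ Fintype.card T := by
  rw [← setIntegral_eq_integral_of_forall_compl_eq_zero
    (s := Set.pi Set.univ (fun _ : T => Set.Icc a b))]
  · have hv : (volume : Measure (T → ℝ)) (Set.pi Set.univ (fun _ : T => Set.Icc a b)) =
      ENNReal.ofReal (b - a) ^ Fintype.card T := by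
      rw [volume_pi_pi]; simp [Finset.card_univ]
    have := norm_setIntegral_le_of_norm_le_const (μ := (volume : Measure (T → ℝ)))
      (s := Set.pi Set.univ (fun _ : T => Set.Icc a b)) (f := g) (C := C)
      (by rw [hv]; exact ENNReal.pow_lt_top ENNReal.ofReal_lt_top) (fun t _ => hC t)
    rw [Real.norm_eq_abs] at this
    refine this.trans_eq ?_
    rw [Measure.real, hv, ENNReal.toReal_pow, ENNReal.toReal_ofReal (by linarith)]
  · intro t ht
    apply hz
    simpa only [Set.mem_pi, Set.mem_univ, true_imp_iff, not_forall] using ht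

theorem phi_asm_zero {M : ℕ} {δ B : ℝ} {f1 : (Fin M → ℝ) → ℝ} (hf : F1Props M δ B f1)
    {ι : Type} [Fintype ι] (ρ : ι → ℕ) (v : ι → ℝ) (t : ((j : ι) × Fin (ρ j - 1)) → ℝ)
    (h : ∃ i, t i ∉ Set.Icc (1 / (M : ℝ) - δ) (1 / M + δ)) : phiK M f1 (asm ρ v t) = 0 := by
  obtain ⟨i, hi⟩ := h
  refine phiK_eq_zero hf _ ⟨i.1, ⟨i.2, by have := i.2.2; omega⟩⟩ ?_
  rw [asm_t]
  simpa [Jset] using hi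

theorem phi_asm_cont {M : ℕ} (hM : 2 ≤ M) {δ B : ℝ} {f1 : (Fin M → ℝ) → ℝ} (hf : F1Props M δ B f1)
    {ι : Type} [Fintype ι] (ρ : ι → ℕ) (v : ι → ℝ) :
    Continuous (fun t : ((j : ι) × Fin (ρ j - 1)) → ℝ => phiK M f1 (asm ρ v t)) :=
  (phiK_cont hM hf).comp ((asm_cont ρ).comp (by fun_prop : Continuous (fun t => (v, t))))

theorem Phi_bound {M : ℕ} (hM : 2 ≤ M) {δ B : ℝ} (hδ : 0 < δ) (hδ1 : 2 * δ ≤ 1)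
    {f1 : (Fin M → ℝ) → ℝ} (hf : F1Props M δ B f1) (hB : 0 ≤ B)
    {ι : Type} [Fintype ι] (ρ : ι → ℕ) (v : ι → ℝ) : |Phi M f1 ρ v| ≤ Acon M B := by
  unfold Phi
  have := box_bound _ (1 / (M : ℝ) - δ) (1 / M + δ) ((2 * M) ^ M) (by linarith)
    (phi_asm_zero hf ρ v) (fun t => phiK_bound hM hf _)
  refine this.trans ?_
  have h1 : (1 / (M : ℝ) + δ - (1 / M - δ)) ^ Fintype.card ((j : ι) × Fin (ρ j - 1)) ≤ 1 :=
    pow_le_one₀ (by linarith) (by linarith)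
  calc _ ≤ (2 * M : ℝ) ^ M * 1 := by gcongr
    _ ≤ _ := by rw [mul_one]; exact (Acon_ge hM hB).1

theorem Phi_lip {M : ℕ} (hM : 2 ≤ M) {δ B : ℝ} (hδ : 0 < δ) (hδ1 : 2 * δ ≤ 1)
    {f1 : (Fin M → ℝ) → ℝ} (hf : F1Props M δ B f1) (hB : 0 ≤ B)
    {ι : Type} [Fintype ι] (ρ : ι → ℕ) (v v' : ι → ℝ) (ε : ℝ) (hε : 0 ≤ ε)
    (h : ∀ i, |v i - v' i| ≤ ε) : |Phi M f1 ρ v - Phi M f1 ρ v'| ≤ Acon M B * ε := by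
  unfold Phi
  rw [← integral_sub (integ_of_box _ (phi_asm_cont hM hf ρ v) _ _ (phi_asm_zero hf ρ v))
    (integ_of_box _ (phi_asm_cont hM hf ρ v') _ _ (phi_asm_zero hf ρ v'))]
  have := box_bound (fun t => phiK M f1 (asm ρ v t) - phiK M f1 (asm ρ v' t))
    (1 / (M : ℝ) - δ) (1 / M + δ) (Acon M B * ε) (by linarith)
    (fun t ht => by rw [phi_asm_zero hf ρ v t ht, phi_asm_zero hf ρ v' t ht, sub_zero])
    (fun t => phiK_lip hM hf hB _ _ ε hε (fun ji => by
      unfold asm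
      split_ifs
      · simpa using hε
      · simpa using h ji.1))
  refine this.trans ?_
  have h1 : (1 / (M : ℝ) + δ - (1 / M - δ)) ^ Fintype.card ((j : ι) × Fin (ρ j - 1)) ≤ 1 :=
    pow_le_one₀ (by linarith) (by linarith)
  have := (Acon_ge hM hB).2
  calc _ ≤ (Acon M B * ε) * 1 := by gcongr
    _ = _ := mul_one _

open Finset MeasureTheory
open scoped Classical

theorem Falpha_eq {M : ℕ} (hM : 2 ≤ M) {δ B : ℝ} (hδ1 : δ ≤ 1 / (3 * (M : ℝ) ^ 2))
    {f1 : (Fin M → ℝ) → ℝ} (hf : F1Props M δ B f1) {r : ℕ} (ρ : Fin r → ℕ) (v : Fin r → ℝ) :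
    Falpha M δ f1 ρ v = econst ρ * (∏ j, v j) * Phi M f1 ρ v := by
  have hM' : (2 : ℝ) ≤ M := by exact_mod_cast hM
  unfold Falpha
  split_ifs with h
  · congr 1
    rw [setIntegral_eq_integral_of_forall_compl_eq_zero]
    · unfold Phi
      congr 1
      ext t
      by_cases hJ : ∀ ji : (j : Fin r) × Fin (ρ j), asm ρ v t ji ∈ Jset M δ 1
      · have hc : Fintype.card ((j : Fin r) × Fin (ρ j)) = M := by simpa using h
        unfold phiK
        rw [dif_pos hc, div_eq_mul_inv]
        congr 1
        rw [← Finset.prod_inv_distrib]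
        refine Finset.prod_congr rfl (fun ji _ => ?_)
        congr 1
        change asm ρ v t ji = _
        symm
        apply max_eq_left
        refine le_trans ?_ (by simpa [Jset] using (hJ ji).1 : 1 / (M : ℝ) - δ ≤ asm ρ v t ji)
        have : δ ≤ 1 / (2 * (M : ℝ)) := hδ1.trans (by
          apply one_div_le_one_div_of_le (by positivity)
          nlinarith)
        have h2 : 1 / (M : ℝ) = 1 / (2 * M) + 1 / (2 * M) := by field_simp; norm_num
        linarith
      · push Not at hJ
        obtain ⟨ji, hji⟩ := hJ
        rw [phiK_eq_zero hf _ ji hji]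
        rw [hf.2.2.1, zero_div]
        refine ⟨Fintype.equivFinOfCardEq (by simpa using h : Fintype.card ((j : Fin r) × Fin (ρ j)) = M) ji, ?_⟩
        rw [Equiv.symm_apply_apply]
        exact hji
    · intro t ht
      simp only [Set.mem_ofPred_eq, not_forall] at ht
      obtain ⟨ji, hji⟩ := ht
      rw [hf.2.2.1, zero_div]
      refine ⟨Fintype.equivFinOfCardEq (by simpa using h : Fintype.card ((j : Fin r) × Fin (ρ j)) = M) ji, ?_⟩
      rw [Equiv.symm_apply_apply]
      exact hji
  · rw [Phi_eq_zero_of_sum ρ v h, mul_zero]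

theorem phiK_bound' {M : ℕ} (hM : 2 ≤ M) {δ B : ℝ} {f1 : (Fin M → ℝ) → ℝ} (hf : F1Props M δ B f1)
    (ha : 0 < 1 / (M : ℝ) - δ)
    {κ : Type} [Fintype κ] (w : κ → ℝ) : |phiK M f1 w| ≤ ((1 / (M : ℝ) - δ)⁻¹) ^ M := by
  have hM' : (2 : ℝ) ≤ M := by exact_mod_cast hM
  by_cases hJ : ∀ i, w i ∈ Jset M δ 1
  · unfold phiK
    split_ifs with h
    · rw [abs_mul, Finset.abs_prod]
      have h1 := hf.2.2.2.1 (fun m => w ((Fintype.equivFinOfCardEq h).symm m))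
      have h2 : ∏ i, |(max (w i) (1 / (2 * (M : ℝ))))⁻¹| ≤ ∏ i : κ, (1 / (M : ℝ) - δ)⁻¹ := by
        refine Finset.prod_le_prod (fun i _ => abs_nonneg _) (fun i _ => ?_)
        rw [abs_of_nonneg (inv_max_bound hM _).1]
        apply inv_anti₀ ha
        refine le_trans ?_ (le_max_left _ _)
        simpa [Jset] using (hJ i).1
      rw [Finset.prod_const, Finset.card_univ, h] at h2
      calc _ ≤ 1 * ((1 / (M : ℝ) - δ)⁻¹) ^ M := by gcongr
        _ = _ := one_mul _
    · rw [abs_zero]; positivity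
  · push Not at hJ
    obtain ⟨i, hi⟩ := hJ
    rw [phiK_eq_zero hf _ i hi, abs_zero]
    positivity

theorem real_ineq {M r : ℕ} (hM : 2 ≤ M) (hr : r < M) (δ : ℝ) (hδ : 0 < δ)
    (hδ1 : δ ≤ 1 / (3 * (M : ℝ) ^ 2)) :
    (1 / (M : ℝ) + δ) ^ r * (((1 / (M : ℝ) - δ)⁻¹) ^ M * (2 * δ) ^ (M - r)) ≤ 1 := by
  have hM' : (2 : ℝ) ≤ M := by exact_mod_cast hM
  obtain ⟨s, hs⟩ : ∃ s, M = r + (s + 1) := ⟨M - r - 1, by omega⟩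
  have hs' : M - r = s + 1 := by omega
  set ε := M * δ with hε
  have hε0 : 0 < ε := by positivity
  have hε1 : M * ε ≤ 1 / 3 := by
    rw [hε]
    calc (M : ℝ) * (M * δ) ≤ M * (M * (1 / (3 * (M : ℝ) ^ 2))) := by gcongr
      _ = 1 / 3 := by field_simp
  have hε2 : ε ≤ 1 / 6 := by nlinarith
  have e1 : 1 / (M : ℝ) + δ = (1 + ε) / M := by rw [hε]; field_simp
  have e2 : 1 / (M : ℝ) - δ = (1 - ε) / M := by rw [hε]; field_simp
  have e3 : 2 * δ = 2 * ε / M := by rw [hε]; field_simp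
  have hMM : (M : ℝ) ^ M = (M : ℝ) ^ r * (M : ℝ) ^ (s + 1) := by rw [← pow_add, ← hs]
  have e4 : (1 / (M : ℝ) + δ) ^ r * (((1 / (M : ℝ) - δ)⁻¹) ^ M * (2 * δ) ^ (M - r))
      = (1 + ε) ^ r * (2 * ε) ^ (s + 1) / (1 - ε) ^ M := by
    rw [e1, e2, e3, hs', inv_div, div_pow, div_pow, div_pow, hMM]
    have : (1 - ε) ^ M ≠ 0 := by
      have : 0 < 1 - ε := by linarith
      positivity
    field_simp
  rw [e4]
  have h1 : (2 / 3 : ℝ) ≤ (1 - ε) ^ M := by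
    have := one_add_mul_le_pow (a := -ε) (by linarith) M
    have h2 : (1 + -ε) ^ M = (1 - ε) ^ M := by ring
    linarith
  have h2 : (1 + ε) ^ M ≤ 3 / 2 := by
    have h3 : (1 + ε) ^ M * (1 - ε) ^ M ≤ 1 := by
      rw [← mul_pow]
      exact pow_le_one₀ (by nlinarith) (by nlinarith)
    have : 0 < (1 + ε) ^ M := by positivity
    nlinarith
  have h3 : (1 + ε) ^ r ≤ (1 + ε) ^ M := pow_le_pow_right₀ (by linarith) hr.le
  have h4 : (2 * ε) ^ (s + 1) ≤ 2 * ε := by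
    rw [pow_succ]
    have : (2 * ε) ^ s ≤ 1 := pow_le_one₀ (by linarith) (by linarith)
    nlinarith
  rw [div_le_one (by linarith)]
  calc (1 + ε) ^ r * (2 * ε) ^ (s + 1) ≤ (3 / 2) * (2 * ε) := by
        apply mul_le_mul (h3.trans h2) h4 (by positivity) (by norm_num)
    _ ≤ _ := by linarith

theorem Falpha_le_one {M : ℕ} (hM : 2 ≤ M) {δ B : ℝ} (hδ : 0 < δ)
    (hδ1 : δ ≤ 1 / (3 * (M : ℝ) ^ 2))
    {f1 : (Fin M → ℝ) → ℝ} (hf : F1Props M δ B f1) {r : ℕ} (ρ : Fin r → ℕ) (v : Fin r → ℝ)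
    (hρ : ∀ j, 1 ≤ ρ j) (hv : ∀ j, 0 ≤ v j) :
    |Falpha M δ f1 ρ v| ≤ 1 := by
  have hM' : (2 : ℝ) ≤ M := by exact_mod_cast hM
  rw [Falpha_eq hM hδ1 hf]
  have ha : 0 < 1 / (M : ℝ) - δ := by
    have : 1 / (3 * (M : ℝ) ^ 2) < 1 / M := by
      apply one_div_lt_one_div_of_lt (by positivity)
      nlinarith
    linarith
  by_cases hsum : ∑ j, ρ j = M
  swap
  · rw [Phi_eq_zero_of_sum ρ v hsum]; simp
  by_cases hJ : ∀ j, v j ∈ Jset M δ (ρ j)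
  swap
  · push Not at hJ
    obtain ⟨j, hj⟩ := hJ
    rw [Phi_eq_zero_of_notMem hf ρ v j (hρ j) hj]; simp
  have hrM : r ≤ M := by
    rw [← hsum]
    calc r = ∑ j : Fin r, 1 := by simp
      _ ≤ _ := Finset.sum_le_sum (fun j _ => hρ j)
  have hcard : Fintype.card ((j : Fin r) × Fin (ρ j - 1)) = M - r := by
    simp only [Fintype.card_sigma, Fintype.card_fin]
    have : ∑ j, (ρ j - 1) + r = M := by
      rw [← hsum]
      calc ∑ j, (ρ j - 1) + r = ∑ j, (ρ j - 1) + ∑ j : Fin r, 1 := by simp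
        _ = ∑ j, ((ρ j - 1) + 1) := by rw [Finset.sum_add_distrib]
        _ = _ := Finset.sum_congr rfl (fun j _ => by have := hρ j; omega)
    omega
  have hec : |econst ρ| = 1 / ∏ j, (ρ j : ℝ) := by
    unfold econst
    rw [abs_div, abs_pow, abs_neg, abs_one, one_pow, abs_of_nonneg (by positivity)]
  rcases hrM.lt_or_eq with hlt | heq
  · have h1 : |econst ρ * ∏ j, v j| ≤ (1 / (M : ℝ) + δ) ^ r := by
      rw [abs_mul, hec, Finset.abs_prod, one_div, ← Finset.prod_inv_distrib,
        ← Finset.prod_mul_distrib]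
      calc ∏ j, ((ρ j : ℝ)⁻¹ * |v j|) ≤ ∏ j : Fin r, (1 / (M : ℝ) + δ) := by
            refine Finset.prod_le_prod (fun j _ => by positivity) (fun j _ => ?_)
            rw [abs_of_nonneg (hv j)]
            have hp : (0 : ℝ) < ρ j := by exact_mod_cast hρ j
            rw [inv_mul_le_iff₀ hp]
            exact (hJ j).2
        _ = _ := by simp
    have h2 := box_bound _ (1 / (M : ℝ) - δ) (1 / M + δ) _ (by linarith)
      (phi_asm_zero hf ρ v) (fun t => phiK_bound' hM hf ha _)
    rw [hcard, show (1 / (M : ℝ) + δ - (1 / M - δ)) = 2 * δ by ring] at h2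
    rw [abs_mul]
    calc _ ≤ (1 / (M : ℝ) + δ) ^ r * (((1 / (M : ℝ) - δ)⁻¹) ^ M * (2 * δ) ^ (M - r)) := by
          unfold Phi
          gcongr
      _ ≤ 1 := real_ineq hM hlt δ hδ hδ1
  · have hone : ρ = fun _ => 1 := by
      have hs : ∑ j, (ρ j - 1) = 0 := by
        have : Fintype.card ((j : Fin r) × Fin (ρ j - 1)) = ∑ j, (ρ j - 1) := by simp
        omega
      funext j
      have := (Finset.sum_eq_zero_iff.1 hs) j (Finset.mem_univ j)
      have := hρ j
      omega
    subst hone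
    have h2 := box_bound (fun t => econst (fun _ : Fin r => 1) * (∏ j, v j) *
        phiK M f1 (asm (fun _ : Fin r => 1) v t)) (1 / (M : ℝ) - δ) (1 / M + δ) 1 (by linarith)
      (fun t ht => by rw [phi_asm_zero hf _ v t ht, mul_zero]) (fun t => ?_)
    · rw [integral_const_mul] at h2
      simpa [hcard, heq, Phi] using h2
    · rw [abs_mul, abs_mul, hec]
      unfold phiK
      split_ifs with hc
      · rw [abs_mul, ← mul_assoc, mul_right_comm]
        have h1 := hf.2.2.2.1 (fun m => asm (fun _ : Fin r => 1) v t ((Fintype.equivFinOfCardEq hc).symm m))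
        refine mul_le_one₀ ?_ (abs_nonneg _) h1
        rw [Fintype.prod_sigma]
        simp only [Nat.cast_one, prod_const_one, div_one, one_mul, Fin.prod_univ_one]
        rw [← abs_mul, ← Finset.prod_mul_distrib, Finset.abs_prod]
        apply Finset.prod_le_one (fun _ _ => abs_nonneg _) (fun j _ => ?_)
        have : asm (fun _ : Fin r => 1) v t ⟨j, 0⟩ = v j := by simp [asm]
        rw [this, abs_mul, abs_of_nonneg (hv j), abs_of_nonneg (inv_max_bound hM _).1]
        have hp : 0 < max (v j) (1 / (2 * (M : ℝ))) := lt_of_lt_of_le (by positivity) (le_max_right _ _)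
        rw [← div_eq_mul_inv, div_le_one hp]
        exact le_max_left _ _
      · simp

open Finset MeasureTheory
open scoped Classical

theorem sig_val {ι : Type} {n : ι → ℕ} {a : ι} {i i' : Fin (n a)}
    (h : (⟨a, i⟩ : (j : ι) × Fin (n j)) = ⟨a, i'⟩) : i.1 = i'.1 := by
  cases h; rfl

theorem asm_lt {ι : Type} (ρ : ι → ℕ) (v : ι → ℝ) (t : ((j : ι) × Fin (ρ j - 1)) → ℝ) (j : ι)
    (i : Fin (ρ j)) (h : i.1 < ρ j - 1) : asm ρ v t ⟨j, i⟩ = t ⟨j, ⟨i.1, h⟩⟩ := dif_pos h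

theorem asm_nlt {ι : Type} (ρ : ι → ℕ) (v : ι → ℝ) (t : ((j : ι) × Fin (ρ j - 1)) → ℝ) (j : ι)
    (i : Fin (ρ j)) (h : ¬ i.1 < ρ j - 1) :
    asm ρ v t ⟨j, i⟩ = v j - ∑ i : Fin (ρ j - 1), t ⟨j, i⟩ := dif_neg h

section split
variable {κ : Type} [Fintype κ] (m : ℕ) (ρ : κ → ℕ)

/-- first shape -/
abbrev rho1 : Option κ → ℕ := fun o => o.elim (m + 2) ρ
/-- second shape -/
abbrev rho2 : Option (Option κ) → ℕ := fun o => o.elim (m + 1) (fun o => o.elim 1 ρ)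

/-- index map -/
def eTfun : Option ((j : Option (Option κ)) × Fin (rho2 m ρ j - 1)) →
    ((j : Option κ) × Fin (rho1 m ρ j - 1))
  | none => ⟨none, ⟨m, Nat.lt_succ_self m⟩⟩
  | some ⟨none, i⟩ => ⟨none, ⟨i.1, Nat.lt_succ_of_lt i.2⟩⟩
  | some ⟨some none, i⟩ => absurd i.2 (Nat.not_lt_zero _)
  | some ⟨some (some j), i⟩ => ⟨some j, i⟩

theorem eTfun_bij : Function.Bijective (eTfun m ρ) := by
  constructor
  · rintro (_ | ⟨_ | _ | j, i⟩) (_ | ⟨_ | _ | j', i'⟩) h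
    · rfl
    · replace h := sig_val (n := fun j => rho1 m ρ j - 1) h
      exact absurd h.symm (ne_of_lt i'.2)
    · exact absurd i'.2 (Nat.not_lt_zero _)
    · have h0 := congrArg (fun s => s.1) h
      exact absurd h0 (by simp [eTfun])
    · replace h := sig_val (n := fun j => rho1 m ρ j - 1) h
      exact absurd h (ne_of_lt i.2)
    · replace h := sig_val (n := fun j => rho1 m ρ j - 1) h
      have : i = i' := Fin.ext h
      rw [this]
    · exact absurd i'.2 (Nat.not_lt_zero _)
    · have h0 := congrArg (fun s => s.1) h
      exact absurd h0 (by simp [eTfun])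
    · exact absurd i.2 (Nat.not_lt_zero _)
    · exact absurd i.2 (Nat.not_lt_zero _)
    · exact absurd i.2 (Nat.not_lt_zero _)
    · exact absurd i.2 (Nat.not_lt_zero _)
    · have h0 := congrArg (fun s => s.1) h
      exact absurd h0 (by simp [eTfun])
    · have h0 := congrArg (fun s => s.1) h
      exact absurd h0 (by simp [eTfun])
    · exact absurd i'.2 (Nat.not_lt_zero _)
    · have h1 : j = j' := Option.some.inj (congrArg Sigma.fst h)
      subst h1
      have : i = i' := Fin.ext (sig_val (n := fun j => rho1 m ρ j - 1) (a := some j) h)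
      rw [this]
  · rintro ⟨_ | j, i⟩
    · rcases Nat.lt_succ_iff_lt_or_eq.1 (show i.1 < m + 1 from i.2) with h | h
      · exact ⟨some ⟨none, ⟨i.1, h⟩⟩, rfl⟩
      · refine ⟨none, ?_⟩
        refine congrArg (Sigma.mk (β := fun j => Fin (rho1 m ρ j - 1)) none) ?_
        exact Fin.ext h.symm
    · exact ⟨some ⟨some (some j), i⟩, rfl⟩

/-- index map -/
def eWfun : ((j : Option (Option κ)) × Fin (rho2 m ρ j)) → ((j : Option κ) × Fin (rho1 m ρ j))
  | ⟨none, i⟩ => ⟨none, ⟨i.1, Nat.lt_succ_of_lt i.2⟩⟩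
  | ⟨some none, _⟩ => ⟨none, ⟨m + 1, Nat.lt_succ_self _⟩⟩
  | ⟨some (some j), i⟩ => ⟨some j, i⟩

theorem eWfun_bij : Function.Bijective (eWfun m ρ) := by
  constructor
  · rintro ⟨_ | _ | j, i⟩ ⟨_ | _ | j', i'⟩ h
    · replace h := sig_val (n := rho1 m ρ) h
      have : i = i' := Fin.ext h
      rw [this]
    · replace h := sig_val (n := rho1 m ρ) h
      exact absurd h (ne_of_lt i.2)
    · have h0 := congrArg (fun s => s.1) h
      exact absurd h0 (by simp [eWfun])
    · replace h := sig_val (n := rho1 m ρ) h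
      exact absurd h.symm (ne_of_lt i'.2)
    · have : i = i' := Subsingleton.elim (α := Fin 1) i i'
      rw [this]
    · have h0 := congrArg (fun s => s.1) h
      exact absurd h0 (by simp [eWfun])
    · have h0 := congrArg (fun s => s.1) h
      exact absurd h0 (by simp [eWfun])
    · have h0 := congrArg (fun s => s.1) h
      exact absurd h0 (by simp [eWfun])
    · have h1 : j = j' := Option.some.inj (congrArg Sigma.fst h)
      subst h1
      have : i = i' := Fin.ext (sig_val (n := rho1 m ρ) (a := some j) h)
      rw [this]
  · rintro ⟨_ | j, i⟩
    · rcases Nat.lt_succ_iff_lt_or_eq.1 (show i.1 < (m + 1) + 1 from i.2) with h | h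
      · exact ⟨⟨none, ⟨i.1, h⟩⟩, rfl⟩
      · refine ⟨⟨some none, (0 : Fin 1)⟩, ?_⟩
        refine congrArg (Sigma.mk (β := fun j => Fin (rho1 m ρ j)) none) ?_
        exact Fin.ext h.symm
    · exact ⟨⟨some (some j), i⟩, rfl⟩

theorem Phi_split {M : ℕ} (hM : 2 ≤ M) {δ B : ℝ} {f1 : (Fin M → ℝ) → ℝ} (hf : F1Props M δ B f1)
    (v : κ → ℝ) (U : ℝ) :
    Phi M f1 (rho1 m ρ) (fun o => o.elim U v) =
      ∫ u : ℝ, Phi M f1 (rho2 m ρ) (fun o => o.elim u (fun o => o.elim (U - u) v)) := by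
  let eT := Equiv.ofBijective _ (eTfun_bij m ρ)
  let eW := Equiv.ofBijective _ (eWfun_bij m ρ)
  let v1 : Option κ → ℝ := fun o => o.elim U v
  let v2 : ℝ → Option (Option κ) → ℝ := fun u o => o.elim u (fun o => o.elim (U - u) v)
  let T1 := ((j : Option κ) × Fin (rho1 m ρ j - 1))
  let T2 := ((j : Option (Option κ)) × Fin (rho2 m ρ j - 1))
  let E1 : ((T2 → ℝ) × ℝ) ≃ᵐ (Option T2 → ℝ) := (MeasurableEquiv.piOptionEquivProd (fun _ => ℝ)).symm
  let E2 : (Option T2 → ℝ) ≃ᵐ (T1 → ℝ) := MeasurableEquiv.piCongrLeft (fun _ => ℝ) eT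
  let E := E1.trans E2
  have hE1 : MeasurePreserving E1 := ⟨E1.measurable, Measure.pi_map_piOptionEquivProd (fun _ => volume)⟩
  have hE2 : MeasurePreserving E2 := volume_measurePreserving_piCongrLeft (fun _ : T1 => ℝ) eT
  have hE : MeasurePreserving E := hE1.trans hE2
  have hEn : ∀ p, E p (eTfun m ρ none) = p.2 := fun p =>
    Equiv.piCongrLeft_apply_apply (fun _ : T1 => ℝ) eT (E1 p) none
  have hEs : ∀ p s, E p (eTfun m ρ (some s)) = p.1 s := fun p s =>
    Equiv.piCongrLeft_apply_apply (fun _ : T1 => ℝ) eT (E1 p) (some s)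
  -- pointwise identity
  have key : ∀ (t : T2 → ℝ) (u : ℝ),
      phiK M f1 (asm (rho1 m ρ) v1 (E (t, u - ∑ i : Fin m, t ⟨none, i⟩))) =
        phiK M f1 (asm (rho2 m ρ) (v2 u) t) := by
    intro t u
    rw [← phiK_reindex hf eW]
    congr 1
    set τ := u - ∑ i : Fin m, t ⟨none, i⟩ with hτ
    have hn : E (t, τ) ⟨none, ⟨m, Nat.lt_succ_self m⟩⟩ = τ := hEn (t, τ)
    have hs0 : ∀ i : Fin m, E (t, τ) ⟨none, ⟨i.1, Nat.lt_succ_of_lt i.2⟩⟩ = t ⟨none, i⟩ :=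
      fun i => hEs (t, τ) ⟨none, i⟩
    have hs : ∀ (j : κ) (i : Fin (ρ j - 1)), E (t, τ) ⟨some j, i⟩ = t ⟨some (some j), i⟩ :=
      fun j i => hEs (t, τ) ⟨some (some j), i⟩
    ext ⟨_ | _ | j, i⟩
    · change asm (rho1 m ρ) v1 (E (t, τ)) ⟨none, ⟨i.1, Nat.lt_succ_of_lt i.2⟩⟩ = _
      refine (asm_lt (rho1 m ρ) _ _ none ⟨i.1, Nat.lt_succ_of_lt i.2⟩ i.2).trans ?_
      by_cases h : i.1 < m
      · refine Eq.trans ?_ (asm_lt (rho2 m ρ) _ _ none i h).symm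
        exact hs0 ⟨i.1, h⟩
      · refine Eq.trans ?_ (asm_nlt (rho2 m ρ) _ _ none i h).symm
        have hi : i.1 = m := le_antisymm (Nat.lt_succ_iff.1 i.2) (not_lt.1 h)
        have : (⟨none, ⟨i.1, i.2⟩⟩ : T1) = ⟨none, ⟨m, Nat.lt_succ_self m⟩⟩ := by
          exact congrArg (Sigma.mk (β := fun j => Fin (rho1 m ρ j - 1)) none) (Fin.ext hi)
        exact (congrArg (E (t, τ)) this).trans hn
    · change asm (rho1 m ρ) v1 (E (t, τ)) ⟨none, ⟨m + 1, Nat.lt_succ_self _⟩⟩ = _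
      refine (asm_nlt (rho1 m ρ) _ _ none ⟨m + 1, Nat.lt_succ_self _⟩ (lt_irrefl _)).trans ?_
      refine Eq.trans ?_ (asm_nlt (rho2 m ρ) _ _ (some none) i (Nat.not_lt_zero _)).symm
      change U - ∑ i : Fin (m + 1), E (t, τ) ⟨none, i⟩ = (U - u) - ∑ i : Fin 0, t ⟨some none, i⟩
      rw [Fin.sum_univ_castSucc]
      have h1 : ∑ i : Fin m, E (t, τ) ⟨none, i.castSucc⟩ = ∑ i : Fin m, t ⟨none, i⟩ :=
        Finset.sum_congr rfl (fun i _ => hs0 i)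
      have h2 : E (t, τ) ⟨none, Fin.last m⟩ = τ := hn
      rw [h1, h2, hτ]
      simp
    · change asm (rho1 m ρ) v1 (E (t, τ)) ⟨some j, i⟩ = _
      by_cases h : i.1 < ρ j - 1
      · refine (asm_lt (rho1 m ρ) _ _ (some j) i h).trans ?_
        refine Eq.trans ?_ (asm_lt (rho2 m ρ) _ _ (some (some j)) i h).symm
        exact hs j ⟨i.1, h⟩
      · refine (asm_nlt (rho1 m ρ) _ _ (some j) i h).trans ?_
        refine Eq.trans ?_ (asm_nlt (rho2 m ρ) _ _ (some (some j)) i h).symm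
        change v j - ∑ i : Fin (ρ j - 1), E (t, τ) ⟨some j, i⟩ =
          v j - ∑ i : Fin (ρ j - 1), t ⟨some (some j), i⟩
        simp only [hs]
  have hint1 : Integrable (fun t : T1 → ℝ => phiK M f1 (asm (rho1 m ρ) v1 t)) :=
    integ_of_box _ (phi_asm_cont hM hf _ _) _ _ (phi_asm_zero hf _ _)
  have hint1' : Integrable (fun p : (T2 → ℝ) × ℝ => phiK M f1 (asm (rho1 m ρ) v1 (E p))) :=
    (hE.integrable_comp_emb E.measurableEmbedding).2 hint1
  have hint2 : Integrable (Function.uncurry (fun (t : T2 → ℝ) (u : ℝ) =>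
      phiK M f1 (asm (rho2 m ρ) (v2 u) t))) (volume.prod volume) := by
    have hc : Continuous (Function.uncurry (fun (t : T2 → ℝ) (u : ℝ) =>
      phiK M f1 (asm (rho2 m ρ) (v2 u) t))) := by
      refine (phiK_cont hM hf).comp ((asm_cont (rho2 m ρ)).comp
        (Continuous.prodMk ?_ continuous_fst : Continuous (fun p : (T2 → ℝ) × ℝ => (v2 p.2, p.1))))
      refine continuous_pi (fun o => ?_)
      rcases o with _ | _ | j
      · exact continuous_snd
      · exact continuous_const.sub continuous_snd
      · exact continuous_const
    refine hc.integrable_of_hasCompactSupport ?_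
    refine HasCompactSupport.intro
      (K := (Set.pi Set.univ (fun _ => Set.Icc (1 / (M : ℝ) - δ) (1 / M + δ))) ×ˢ
        Set.Icc (U - (1 / (M : ℝ) + δ)) (U - (1 / M - δ)))
      ((isCompact_univ_pi (fun _ => isCompact_Icc)).prod isCompact_Icc) ?_
    rintro ⟨t, u⟩ htu
    change phiK M f1 (asm (rho2 m ρ) (v2 u) t) = 0
    by_contra hne
    apply htu
    refine ⟨?_, ?_⟩
    · by_contra h
      simp only [Set.mem_pi, Set.mem_univ, true_imp_iff, not_forall] at h
      exact hne (phi_asm_zero hf _ _ t h)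
    · by_contra h
      apply hne
      refine phiK_eq_zero hf _ ⟨some none, (0 : Fin 1)⟩ (fun hJ => h ?_)
      have : asm (rho2 m ρ) (v2 u) t ⟨some none, (0 : Fin 1)⟩ = U - u := by
        refine (asm_nlt (rho2 m ρ) _ _ (some none) (0 : Fin 1) (lt_irrefl _)).trans ?_
        change (U - u) - ∑ i : Fin 0, t ⟨some none, i⟩ = _
        simp
      rw [this] at hJ
      simp only [Jset, Nat.cast_one, one_mul, Set.mem_Icc] at hJ
      constructor <;> linarith [hJ.1, hJ.2]
  unfold Phi
  change ∫ t : T1 → ℝ, phiK M f1 (asm (rho1 m ρ) v1 t) =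
    ∫ u : ℝ, ∫ t : T2 → ℝ, phiK M f1 (asm (rho2 m ρ) (v2 u) t)
  rw [← hE.integral_comp' (g := fun t : T1 → ℝ => phiK M f1 (asm (rho1 m ρ) v1 t))]
  rw [← integral_integral_swap hint2]
  rw [Measure.volume_eq_prod, integral_prod _ hint1']
  congr 1
  ext t
  rw [← integral_sub_right_eq_self _ (∑ i : Fin m, t ⟨none, i⟩)]
  congr 1
  ext u
  exact key t u
end split

/-- list version -/
noncomputable def PhiL (M : ℕ) (f1 : (Fin M → ℝ) → ℝ) (l : List (ℕ × ℝ)) : ℝ :=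
  Phi M f1 (fun j : Fin l.length => (l.get j).1) (fun j : Fin l.length => (l.get j).2)

theorem perm_equiv {α : Type} {l l' : List α} (h : l.Perm l') :
    ∃ e : Fin l.length ≃ Fin l'.length, ∀ j, l'.get (e j) = l.get j := by
  induction h with
  | nil => exact ⟨Equiv.refl _, fun _ => rfl⟩
  | @cons a l l' _ ih =>
    obtain ⟨e, he⟩ := ih
    refine ⟨(finSuccEquiv l.length).trans ((Equiv.optionCongr e).trans
      (finSuccEquiv l'.length).symm), fun j => ?_⟩
    refine Fin.cases ?_ (fun i => ?_) j
    · simp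
    · have := he i
      simpa using this
  | swap a b l =>
    refine ⟨Equiv.swap 0 1, fun j => ?_⟩
    refine Fin.cases ?_ (fun i => Fin.cases ?_ (fun i => ?_) i) j
    · simp
    · simp
    · rw [Equiv.swap_apply_of_ne_of_ne]
      · rfl
      · exact Fin.succ_ne_zero _
      · intro h
        have := congrArg Fin.val h
        simp at this
  | trans _ _ ih1 ih2 =>
    obtain ⟨e1, h1⟩ := ih1
    obtain ⟨e2, h2⟩ := ih2
    exact ⟨e1.trans e2, fun j => by rw [Equiv.trans_apply, h2, h1]⟩

theorem PhiL_perm {M : ℕ} {δ B : ℝ} {f1 : (Fin M → ℝ) → ℝ} (hf : F1Props M δ B f1)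
    {l l' : List (ℕ × ℝ)} (h : l.Perm l') : PhiL M f1 l = PhiL M f1 l' := by
  obtain ⟨e, he⟩ := perm_equiv h
  unfold PhiL
  rw [← Phi_reindex hf e]
  simp only [he]

theorem PhiL_cons {M : ℕ} {δ B : ℝ} {f1 : (Fin M → ℝ) → ℝ} (hf : F1Props M δ B f1)
    (i : ℕ) (u : ℝ) (l : List (ℕ × ℝ)) : PhiL M f1 ((i, u) :: l) =
      Phi M f1 (fun o : Option (Fin l.length) => o.elim i (fun j => (l.get j).1))
        (fun o => o.elim u (fun j => (l.get j).2)) := by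
  unfold PhiL
  rw [← Phi_reindex hf (finSuccEquiv l.length).symm]
  congr 1
  · ext o; cases o <;> simp
  · ext o; cases o <;> simp

theorem PhiL_cons2 {M : ℕ} {δ B : ℝ} {f1 : (Fin M → ℝ) → ℝ} (hf : F1Props M δ B f1)
    (i i' : ℕ) (u u' : ℝ) (l : List (ℕ × ℝ)) : PhiL M f1 ((i, u) :: (i', u') :: l) =
      Phi M f1 (fun o : Option (Option (Fin l.length)) => o.elim i (fun o => o.elim i' (fun j => (l.get j).1)))
        (fun o => o.elim u (fun o => o.elim u' (fun j => (l.get j).2))) := by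
  rw [PhiL_cons hf]
  let e : Option (Option (Fin l.length)) ≃ Option (Fin ((i', u') :: l).length) :=
    Equiv.optionCongr (finSuccEquiv l.length).symm
  rw [← Phi_reindex hf e]
  congr 1
  · ext o; rcases o with _ | _ | o <;> rfl
  · ext o; rcases o with _ | _ | o <;> rfl

theorem PhiL_split {M : ℕ} (hM : 2 ≤ M) {δ B : ℝ} {f1 : (Fin M → ℝ) → ℝ} (hf : F1Props M δ B f1)
    (k : ℕ) (hk : 2 ≤ k) (U : ℝ) (l : List (ℕ × ℝ)) : PhiL M f1 ((k, U) :: l) =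
      ∫ u : ℝ, PhiL M f1 ((k - 1, u) :: (1, U - u) :: l) := by
  obtain ⟨m, rfl⟩ : ∃ m, k = m + 2 := ⟨k - 2, by omega⟩
  rw [PhiL_cons hf]
  simp only [PhiL_cons2 hf]
  exact Phi_split m _ hM hf _ U

open Finset MeasureTheory
open scoped Classical

/-- analytic environment -/
structure Env (M : ℕ) (x η : ℝ) (N0 : ℕ) : Prop where
  hM : 2 ≤ M
  hx : 1 < x
  hL : 1 ≤ Real.log x
  eta0 : 0 < η
  eta1 : η ≤ 1 / 2
  etaL : Real.log x * η ≤ 1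
  hN0 : 2 ≤ N0
  hN0eta : 1 ≤ N0 * η ^ 4
  hN0x : (N0 : ℝ) < x ^ (2 / (3 * (M : ℝ)))
  hN0log : Real.log x / (2 * M) ≤ Real.log N0
  theta : ∀ t : ℝ, (N0 : ℝ) ≤ t → t ≤ 2 * x → |Chebyshev.theta t - t| ≤ η ^ 4 * t

theorem log_succ_sub (n : ℕ) (hn : 1 ≤ n) :
    1 / ((n : ℝ) + 1) ≤ Real.log ((n : ℝ) + 1) - Real.log n ∧
      Real.log ((n : ℝ) + 1) - Real.log n ≤ 1 / n := by
  have hn' : (0 : ℝ) < n := by exact_mod_cast hn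
  have e : Real.log ((n : ℝ) + 1) - Real.log n = Real.log (((n : ℝ) + 1) / n) := by
    rw [Real.log_div (by positivity) (by positivity)]
  rw [e]
  constructor
  · have := Real.one_sub_inv_le_log_of_pos (x := ((n : ℝ) + 1) / n) (by positivity)
    refine le_trans (le_of_eq ?_) this
    field_simp
    ring
  · have := Real.log_le_sub_one_of_pos (x := ((n : ℝ) + 1) / n) (by positivity)
    refine le_trans this (le_of_eq ?_)
    field_simp
    ring

theorem abel_bound {N0 : ℕ} (hN0 : 2 ≤ N0) (D g : ℕ → ℝ) (A E : ℝ) (hA : 0 ≤ A) (hE : 0 ≤ E) (N1 : ℕ)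
    (hD : ∀ n, N0 ≤ n → n ≤ N1 → |D n| ≤ E * n)
    (hg : ∀ n, N0 ≤ n → |g n| ≤ A / n)
    (hg' : ∀ n, N0 ≤ n → |g (n + 1) - g n| ≤ 2 * A / (n * (n + 1)))
    (N : ℕ) (h0 : N0 ≤ N) (h1 : N ≤ N1) :
    |∑ n ∈ Finset.Ioc N0 N, (D n - D (n - 1)) * g n - D N * g N| ≤
      A * E + 2 * A * E * (Real.log N - Real.log N0) := by
  induction N, h0 using Nat.le_induction with
  | base =>
    have hp : (0 : ℝ) < N0 := by exact_mod_cast (by omega : 0 < N0)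
    simp only [Finset.Ioc_self, Finset.sum_empty, zero_sub, abs_neg, sub_self, mul_zero, add_zero, abs_mul]
    calc |D N0| * |g N0| ≤ (E * N0) * (A / N0) :=
          mul_le_mul (hD _ le_rfl h1) (hg _ le_rfl) (abs_nonneg _) (by positivity)
      _ = A * E := by field_simp
  | succ n hn ih =>
    have ih := ih (by omega)
    have hp : (0 : ℝ) < n := by exact_mod_cast (by omega : 0 < n)
    rw [← Finset.insert_Ioc_right_eq_Ioc_add_one (by omega), Finset.sum_insert (by simp)]
    have e : (D (n + 1) - D (n + 1 - 1)) * g (n + 1) + ∑ x ∈ Finset.Ioc N0 n, (D x - D (x - 1)) * g x -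
        D (n + 1) * g (n + 1) = (∑ x ∈ Finset.Ioc N0 n, (D x - D (x - 1)) * g x - D n * g n) +
          (- (D n * (g (n + 1) - g n))) := by
      simp only [Nat.add_sub_cancel]; ring
    rw [e]
    refine (abs_add_le _ _).trans ?_
    have h3 : |-(D n * (g (n + 1) - g n))| ≤ 2 * A * E * (1 / ((n : ℝ) + 1)) := by
      rw [abs_neg, abs_mul]
      calc |D n| * |g (n + 1) - g n| ≤ (E * n) * (2 * A / (n * (n + 1))) :=
            mul_le_mul (hD _ hn (by omega)) (hg' _ hn) (abs_nonneg _) (by positivity)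
        _ = _ := by field_simp
    have h4 := (log_succ_sub n (by omega)).1
    have h5 : 2 * A * E * (1 / ((n : ℝ) + 1)) ≤ 2 * A * E * (Real.log ((n : ℝ) + 1) - Real.log n) :=
      mul_le_mul_of_nonneg_left h4 (by positivity)
    push_cast
    linarith

theorem sum_int_bound {N0 : ℕ} (hN0 : 2 ≤ N0) (h : ℝ → ℝ) (A L : ℝ) (hA : 0 ≤ A) (hL : 1 ≤ L)
    (hb : ∀ u, |h u| ≤ A) (hl : ∀ u u', |h u - h u'| ≤ A * |u - u'|) (hc : Continuous h)
    (N : ℕ) (h0 : N0 ≤ N) :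
    |∑ n ∈ Finset.Ioc N0 N, h (Real.log n / L) / n -
      L * ∫ u in (Real.log N0 / L)..(Real.log N / L), h u| ≤
      2 * A * (1 / ((N0 : ℝ) - 1) - 1 / ((N : ℝ) - 1)) := by
  have hL0 : 0 < L := by linarith
  induction N, h0 using Nat.le_induction with
  | base => simp
  | succ n hn ih =>
    have hn2 : (2 : ℝ) ≤ n := by exact_mod_cast (by omega : 2 ≤ n)
    have hp : (0 : ℝ) < n := by linarith
    rw [← Finset.insert_Ioc_right_eq_Ioc_add_one (by omega), Finset.sum_insert (by simp)]
    have hI : ∀ a b, IntervalIntegrable h volume a b := fun a b => hc.intervalIntegrable a b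
    rw [← intervalIntegral.integral_add_adjacent_intervals (hI _ (Real.log n / L)) (hI _ _)]
    obtain ⟨l1, l2⟩ := log_succ_sub n (by omega)
    set a := Real.log n with ha
    have hcast : ((n + 1 : ℕ) : ℝ) = (n : ℝ) + 1 := by push_cast; ring
    rw [hcast]
    set b := Real.log ((n : ℝ) + 1) with hb'
    have hab : a ≤ b := by
      have : (0 : ℝ) ≤ 1 / ((n : ℝ) + 1) := by positivity
      linarith
    -- integral comparison
    have hint : |(∫ u in (a / L)..(b / L), h u) - h (b / L) * (b / L - a / L)| ≤
        A * (b / L - a / L) * (b / L - a / L) := by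
      have e1 : (∫ u in (a / L)..(b / L), h u) - h (b / L) * (b / L - a / L) =
          ∫ u in (a / L)..(b / L), (h u - h (b / L)) := by
        rw [intervalIntegral.integral_sub (hI _ _) intervalIntegrable_const, intervalIntegral.integral_const,
          smul_eq_mul]
        ring
      have hle : a / L ≤ b / L := by gcongr
      rw [e1]
      have := intervalIntegral.norm_integral_le_of_norm_le_const (a := a / L) (b := b / L)
        (f := fun u => h u - h (b / L)) (C := A * (b / L - a / L)) (fun u hu => by
          rw [Set.uIoc_of_le hle] at hu
          refine (hl _ _).trans (mul_le_mul_of_nonneg_left ?_ hA)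
          rw [abs_le]; constructor <;> linarith [hu.1, hu.2])
      rwa [abs_of_nonneg (by linarith : 0 ≤ b / L - a / L)] at this
    have hint2 : |L * (∫ u in (a / L)..(b / L), h u) - h (b / L) * (b - a)| ≤ A * (1 / (n : ℝ)) * (1 / n) := by
      have e2 : L * (∫ u in (a / L)..(b / L), h u) - h (b / L) * (b - a) =
          L * ((∫ u in (a / L)..(b / L), h u) - h (b / L) * (b / L - a / L)) := by
        field_simp
      rw [e2, abs_mul, abs_of_pos hL0]
      calc L * _ ≤ L * (A * (b / L - a / L) * (b / L - a / L)) := mul_le_mul_of_nonneg_left hint hL0.le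
        _ = (A * (b - a) * (b - a)) / L := by field_simp
        _ ≤ A * (b - a) * (b - a) := div_le_self (by
            have : 0 ≤ b - a := by linarith
            positivity) hL
        _ ≤ A * (1 / (n : ℝ)) * (1 / n) := by
            have : 0 ≤ b - a := by linarith
            gcongr
    have h3 : |h (b / L) / ((n : ℝ) + 1) - h (b / L) * (b - a)| ≤ A * (1 / n - 1 / ((n : ℝ) + 1)) := by
      have : h (b / L) / ((n : ℝ) + 1) - h (b / L) * (b - a) = h (b / L) * (1 / ((n : ℝ) + 1) - (b - a)) := by
        ring
      rw [this, abs_mul]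
      refine mul_le_mul (hb _) ?_ (abs_nonneg _) hA
      rw [abs_le]; constructor <;> linarith
    have h4 : A * (1 / (n : ℝ)) * (1 / n) + A * (1 / n - 1 / ((n : ℝ) + 1)) ≤
        2 * A * (1 / ((n : ℝ) - 1) - 1 / n) := by
      have h41 : (1 / (n : ℝ)) * (1 / n) ≤ 1 / ((n : ℝ) - 1) - 1 / n := by
        have : (0 : ℝ) < n - 1 := by linarith
        rw [div_sub_div _ _ this.ne' hp.ne', div_mul_div_comm, div_le_div_iff₀ (by positivity) (by positivity)]
        nlinarith
      have h42 : (1 / (n : ℝ)) - 1 / ((n : ℝ) + 1) ≤ (1 / (n : ℝ)) * (1 / n) := by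
        rw [div_sub_div _ _ hp.ne' (by positivity), div_mul_div_comm, div_le_div_iff₀ (by positivity) (by positivity)]
        nlinarith
      have := mul_le_mul_of_nonneg_left h41 hA
      have := mul_le_mul_of_nonneg_left h42 hA
      nlinarith
    have hfin : (n : ℝ) + 1 - 1 = n := by ring
    rw [hfin]
    have e5 : h (b / L) / ((n : ℝ) + 1) + ∑ x ∈ Finset.Ioc N0 n, h (Real.log x / L) / x -
        L * ((∫ u in (Real.log N0 / L)..(a / L), h u) + ∫ u in (a / L)..(b / L), h u) =
        (∑ x ∈ Finset.Ioc N0 n, h (Real.log x / L) / x - L * (∫ u in (Real.log N0 / L)..(a / L), h u)) +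
        ((h (b / L) / ((n : ℝ) + 1) - h (b / L) * (b - a)) -
        (L * (∫ u in (a / L)..(b / L), h u) - h (b / L) * (b - a))) := by ring
    rw [e5]
    refine (abs_add_le _ _).trans ?_
    have h6 := abs_sub (h (b / L) / ((n : ℝ) + 1) - h (b / L) * (b - a))
      (L * (∫ u in (a / L)..(b / L), h u) - h (b / L) * (b - a))
    linarith

open Finset MeasureTheory
open scoped Classical

/-- the primes used -/
noncomputable def Qset (x : ℝ) (N0 : ℕ) : Finset ℕ := (Finset.Ioc N0 ⌊2 * x⌋₊).filter Nat.Prime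

theorem theta_nat_step (n : ℕ) (hn : 1 ≤ n) :
    Chebyshev.theta (n : ℝ) - Chebyshev.theta ((n - 1 : ℕ) : ℝ) = if n.Prime then Real.log n else 0 := by
  unfold Chebyshev.theta
  simp only [Nat.floor_natCast]
  obtain ⟨m, rfl⟩ : ∃ m, n = m + 1 := ⟨n - 1, by omega⟩
  rw [Nat.add_sub_cancel, ← Finset.insert_Ioc_right_eq_Ioc_add_one (by omega), Finset.filter_insert]
  split_ifs with h
  · rw [Finset.sum_insert (by simp)]; ring
  · ring

theorem theta_diff (a b : ℝ) (hab : a ≤ b) :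
    Chebyshev.theta b - Chebyshev.theta a =
      ∑ q ∈ (Finset.Ioc ⌊a⌋₊ ⌊b⌋₊).filter Nat.Prime, Real.log q := by
  unfold Chebyshev.theta
  have : Finset.Ioc 0 ⌊b⌋₊ = Finset.Ioc 0 ⌊a⌋₊ ∪ Finset.Ioc ⌊a⌋₊ ⌊b⌋₊ :=
    (Finset.Ioc_union_Ioc_eq_Ioc (Nat.zero_le _) (Nat.floor_mono hab)).symm
  rw [this, Finset.filter_union, Finset.sum_union]
  · ring
  · refine Finset.disjoint_filter_filter ?_
    rw [Finset.disjoint_left]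
    intro n hn hn'
    rw [Finset.mem_Ioc] at hn hn'
    omega

theorem N0_le_x {M : ℕ} {x η : ℝ} {N0 : ℕ} (E : Env M x η N0) : (N0 : ℝ) ≤ x := by
  have hM : (2 : ℝ) ≤ M := by exact_mod_cast E.hM
  refine E.hN0x.le.trans ?_
  calc x ^ (2 / (3 * (M : ℝ))) ≤ x ^ (1 : ℝ) := by
        refine Real.rpow_le_rpow_of_exponent_le E.hx.le ?_
        rw [div_le_one (by positivity)]; linarith
    _ = x := Real.rpow_one x

theorem N1_facts {M : ℕ} {x η : ℝ} {N0 : ℕ} (E : Env M x η N0) :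
    N0 ≤ ⌊2 * x⌋₊ ∧ x ≤ (⌊2 * x⌋₊ : ℝ) ∧ (⌊2 * x⌋₊ : ℝ) ≤ 2 * x ∧
      Real.log x ≤ Real.log ⌊2 * x⌋₊ ∧ Real.log ⌊2 * x⌋₊ ≤ 2 * Real.log x := by
  have hx := E.hx
  have h1 : x ≤ (⌊2 * x⌋₊ : ℝ) := by
    have := Nat.lt_floor_add_one (2 * x)
    linarith
  have h2 : (⌊2 * x⌋₊ : ℝ) ≤ 2 * x := Nat.floor_le (by linarith)
  refine ⟨?_, h1, h2, Real.log_le_log (by linarith) h1, ?_⟩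
  · exact_mod_cast (N0_le_x E).trans h1
  · calc Real.log ⌊2 * x⌋₊ ≤ Real.log (2 * x) := Real.log_le_log (by linarith) h2
      _ = Real.log 2 + Real.log x := Real.log_mul (by norm_num) (by linarith)
      _ ≤ 2 * Real.log x := by linarith [Real.log_two_lt_d9, E.hL]

theorem lemB {M : ℕ} {x η : ℝ} {N0 : ℕ} (E : Env M x η N0) (h : ℝ → ℝ) (A : ℝ) (hA : 0 ≤ A)
    (hb : ∀ u, |h u| ≤ A) (hl : ∀ u u', |h u - h u'| ≤ A * |u - u'|) :
    |∑ q ∈ Qset x N0, (Real.log q / (q * Real.log x)) * h (Real.log q / Real.log x) -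
      ∫ u in (Real.log N0 / Real.log x)..(Real.log ⌊2 * x⌋₊ / Real.log x), h u| ≤ 10 * A * η := by
  obtain ⟨n1, n2, n3, n4, n5⟩ := N1_facts E
  set N1 := ⌊2 * x⌋₊ with hN1
  set L := Real.log x with hLdef
  have hL := E.hL
  have hL0 : 0 < L := by linarith
  have hη := E.eta0
  have hη1 := E.eta1
  have hc : Continuous h := by
    have : LipschitzWith A.toNNReal h := LipschitzWith.of_dist_le_mul (fun u u' => by
      rw [Real.dist_eq, Real.dist_eq, Real.coe_toNNReal _ hA]; exact hl u u')
    exact this.continuous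
  let D : ℕ → ℝ := fun n => Chebyshev.theta n - n
  let g : ℕ → ℝ := fun n => h (Real.log n / L) / n
  have hN02 : (2 : ℝ) ≤ N0 := by exact_mod_cast E.hN0
  have hpos : ∀ n, N0 ≤ n → (0 : ℝ) < n := fun n hn => by
    have : (N0 : ℝ) ≤ n := by exact_mod_cast hn
    linarith
  have hab := abel_bound E.hN0 D g A (η ^ 4) hA (by positivity) N1
    (fun n h1 h2 => E.theta n (by exact_mod_cast h1) (le_trans (by exact_mod_cast h2) n3))
    (fun n hn => by
      have := hpos n hn
      simp only [g]
      rw [abs_div, abs_of_pos this]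
      gcongr
      exact hb _)
    (fun n hn => by
      have hp := hpos n hn
      have hn1 : 1 ≤ n := by have := E.hN0; omega
      obtain ⟨l1, l2⟩ := log_succ_sub n hn1
      simp only [g]
      push_cast
      have e : h (Real.log ((n : ℝ) + 1) / L) / ((n : ℝ) + 1) - h (Real.log n / L) / n =
          (h (Real.log ((n : ℝ) + 1) / L) - h (Real.log n / L)) / ((n : ℝ) + 1) +
            (-(h (Real.log n / L) / (n * ((n : ℝ) + 1)))) := by field_simp; ring
      rw [e]
      refine (abs_add_le _ _).trans ?_
      have h0 : 0 ≤ Real.log ((n : ℝ) + 1) - Real.log n := le_trans (by positivity) l1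
      have b1 : |(h (Real.log ((n : ℝ) + 1) / L) - h (Real.log n / L)) / ((n : ℝ) + 1)| ≤
          A / (n * ((n : ℝ) + 1)) := by
        rw [abs_div, abs_of_pos (by positivity : (0 : ℝ) < n + 1)]
        have : |h (Real.log ((n : ℝ) + 1) / L) - h (Real.log n / L)| ≤ A * (1 / n) := by
          refine (hl _ _).trans (mul_le_mul_of_nonneg_left ?_ hA)
          rw [← sub_div, abs_of_nonneg (by positivity)]
          exact (div_le_self h0 hL).trans l2
        calc _ ≤ A * (1 / n) / ((n : ℝ) + 1) := by gcongr
          _ = _ := by field_simp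
      have b2 : |-(h (Real.log n / L) / (n * ((n : ℝ) + 1)))| ≤ A / (n * ((n : ℝ) + 1)) := by
        rw [abs_neg, abs_div, abs_of_pos (by positivity : (0 : ℝ) < n * (n + 1))]
        gcongr
        exact hb _
      calc _ ≤ A / (n * ((n : ℝ) + 1)) + A / (n * ((n : ℝ) + 1)) := add_le_add b1 b2
        _ = _ := by ring)
    N1 n1 le_rfl
  have hsi := sum_int_bound E.hN0 h A L hA hL hb hl hc N1 n1
  -- combine
  have hD1 : |D N1 * g N1| ≤ A * η ^ 4 := by
    have hp := hpos N1 n1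
    rw [abs_mul]
    calc |D N1| * |g N1| ≤ (η ^ 4 * N1) * (A / N1) := by
          refine mul_le_mul (E.theta N1 (by exact_mod_cast n1) n3) ?_ (abs_nonneg _) (by positivity)
          simp only [g]
          rw [abs_div, abs_of_pos hp]
          gcongr
          exact hb _
      _ = _ := by field_simp
  have hsum : ∑ n ∈ Finset.Ioc N0 N1, (D n - D (n - 1)) * g n =
      L * ∑ q ∈ Qset x N0, (Real.log q / (q * L)) * h (Real.log q / L) -
        ∑ n ∈ Finset.Ioc N0 N1, h (Real.log n / L) / n := by
    rw [Qset, Finset.sum_filter, Finset.mul_sum, ← Finset.sum_sub_distrib]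
    refine Finset.sum_congr rfl (fun n hn => ?_)
    rw [Finset.mem_Ioc] at hn
    have hp := hpos n hn.1.le
    have := theta_nat_step n (by omega)
    have hc : (((n - 1 : ℕ) : ℝ)) = n - 1 := by rw [Nat.cast_sub (by omega)]; simp
    have e : D n - D (n - 1) = (if n.Prime then Real.log n else 0) - 1 := by
      rw [← this]; simp only [D]; rw [hc]; ring
    rw [e]
    simp only [g]
    split_ifs
    · field_simp
    · ring
  rw [hsum] at hab
  have hinv : 1 / ((N0 : ℝ) - 1) ≤ 2 * η := by
    have h1 : 1 / ((N0 : ℝ) - 1) ≤ 2 / N0 := by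
      rw [div_le_div_iff₀ (by linarith) (by linarith)]; linarith
    have h2 : 2 / (N0 : ℝ) ≤ 2 * η ^ 4 := by
      rw [div_le_iff₀ (by linarith)]; nlinarith [E.hN0eta]
    have h3 : η ^ 4 ≤ η := by
      calc η ^ 4 ≤ η ^ 1 := pow_le_pow_of_le_one hη.le (by linarith) (by norm_num)
        _ = η := pow_one _
    linarith
  have hinv2 : 0 ≤ 1 / ((N1 : ℝ) - 1) := by
    have : (N0 : ℝ) ≤ N1 := by exact_mod_cast n1
    have : 0 < (N1 : ℝ) - 1 := by linarith
    positivity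
  have hlogN0 : 0 ≤ Real.log N0 := Real.log_nonneg (by linarith)
  have h4 : η ^ 4 ≤ η := by
    calc η ^ 4 ≤ η ^ 1 := pow_le_pow_of_le_one hη.le (by linarith) (by norm_num)
      _ = η := pow_one _
  have h4L : η ^ 4 * L ≤ η := by
    have h2 : η ^ 3 ≤ η := by
      calc η ^ 3 ≤ η ^ 1 := pow_le_pow_of_le_one hη.le (by linarith) (by norm_num)
        _ = η := pow_one _
    calc η ^ 4 * L = η ^ 3 * (L * η) := by ring
      _ ≤ η ^ 3 * 1 := by
          have := E.etaL
          gcongr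
      _ ≤ η := by linarith
  set S := ∑ q ∈ Qset x N0, (Real.log q / (q * L)) * h (Real.log q / L)
  set T := ∑ n ∈ Finset.Ioc N0 N1, h (Real.log n / L) / n
  set I := ∫ u in (Real.log N0 / L)..(Real.log N1 / L), h u
  have htot : |L * (S - I)| ≤ 10 * A * η := by
    have e : L * (S - I) = ((L * S - T) - D N1 * g N1) + (D N1 * g N1) + (T - L * I) := by ring
    rw [e]
    have t1 := abs_add_le (((L * S - T) - D N1 * g N1) + (D N1 * g N1)) (T - L * I)
    have t2 := abs_add_le ((L * S - T) - D N1 * g N1) (D N1 * g N1)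
    have t3 : 2 * A * η ^ 4 * (Real.log N1 - Real.log N0) ≤ 4 * A * η := by
      calc _ ≤ 2 * A * η ^ 4 * (2 * L) := by gcongr; linarith
        _ = 4 * A * (η ^ 4 * L) := by ring
        _ ≤ _ := by gcongr
    have t4 : A * η ^ 4 ≤ A * η := by gcongr
    have t5 : 2 * A * (1 / ((N0 : ℝ) - 1) - 1 / ((N1 : ℝ) - 1)) ≤ 4 * A * η := by
      calc _ ≤ 2 * A * (2 * η) := by gcongr; linarith
        _ = _ := by ring
    linarith
  rw [abs_mul, abs_of_pos hL0] at htot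
  exact (le_mul_of_one_le_left (abs_nonneg _) hL).trans htot

theorem mertens {M : ℕ} {x η : ℝ} {N0 : ℕ} (E : Env M x η N0) :
    ∑ q ∈ Qset x N0, (1 : ℝ) / q ≤ 14 * M := by
  have hB := lemB E (fun _ => 1) 1 zero_le_one (by simp) (by simp)
  obtain ⟨n1, n2, n3, n4, n5⟩ := N1_facts E
  have hL0 : 0 < Real.log x := by linarith [E.hL]
  have hM : (2 : ℝ) ≤ M := by exact_mod_cast E.hM
  simp only [intervalIntegral.integral_const, smul_eq_mul, mul_one] at hB
  have h1 := (abs_le.1 hB).2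
  have hlogN0 : 0 ≤ Real.log N0 / Real.log x := by
    have : (2 : ℝ) ≤ N0 := by exact_mod_cast E.hN0
    exact div_nonneg (Real.log_nonneg (by linarith)) hL0.le
  have h2 : Real.log ⌊2 * x⌋₊ / Real.log x ≤ 2 := by rw [div_le_iff₀ hL0]; exact n5
  have h3 : ∑ q ∈ Qset x N0, (1 : ℝ) / q ≤ ∑ q ∈ Qset x N0, (2 * M) * (Real.log q / (q * Real.log x)) := by
    refine Finset.sum_le_sum (fun q hq => ?_)
    simp only [Qset, Finset.mem_filter, Finset.mem_Ioc] at hq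
    have hq0 : (0 : ℝ) < q := by exact_mod_cast hq.2.pos
    have hlq : Real.log x / (2 * M) ≤ Real.log q := E.hN0log.trans
      (Real.log_le_log (by exact_mod_cast (by have := E.hN0; omega)) (by exact_mod_cast hq.1.1.le))
    rw [div_le_iff₀ (by positivity)] at hlq
    have : (2 * (M : ℝ)) * (Real.log q / (q * Real.log x)) = (Real.log q * (2 * M) / Real.log x) / q := by
      field_simp
    rw [this]
    gcongr
    rw [le_div_iff₀ hL0]; linarith
  rw [← Finset.mul_sum] at h3
  refine h3.trans ?_
  have : ∑ q ∈ Qset x N0, Real.log q / (q * Real.log x) ≤ 7 := by linarith [E.eta1]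
  nlinarith

theorem lemA {M : ℕ} {x η : ℝ} {N0 : ℕ} (E : Env M x η N0) (h : ℝ → ℝ) (A : ℝ) (hA : 0 ≤ A)
    (hb : ∀ u, |h u| ≤ A) (hl : ∀ u u', |h u - h u'| ≤ A * |u - u'|) (y : ℝ) (hy0 : (N0 : ℝ) ≤ y) (hy1 : y ≤ x) :
    |∑ q ∈ (Finset.Ioc ⌊y⌋₊ ⌊y * (1 + η)⌋₊).filter Nat.Prime, Real.log q * h (Real.log q / Real.log x) -
      η * y * h (Real.log y / Real.log x)| ≤ 7 * A * η ^ 2 * y := by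
  have hη := E.eta0
  have hη1 := E.eta1
  have hL := E.hL
  have hN02 : (2 : ℝ) ≤ N0 := by exact_mod_cast E.hN0
  have hyp : 0 < y := by linarith
  have hyz : y ≤ y * (1 + η) := by nlinarith
  have hz : y * (1 + η) ≤ 2 * x := by nlinarith
  set s := (Finset.Ioc ⌊y⌋₊ ⌊y * (1 + η)⌋₊).filter Nat.Prime
  set H := h (Real.log y / Real.log x)
  have ht := theta_diff y (y * (1 + η)) hyz
  have t1 := E.theta y hy0 (by linarith)
  have t2 := E.theta (y * (1 + η)) (by linarith) hz
  have hS : |∑ q ∈ s, Real.log q - η * y| ≤ 3 * η ^ 4 * y := by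
    rw [← ht]
    rw [abs_le] at t1 t2 ⊢
    have : η ^ 4 * (y * (1 + η)) ≤ 2 * η ^ 4 * y := by
      have : 0 ≤ η ^ 4 * y := by positivity
      nlinarith
    constructor <;> linarith [t1.1, t1.2, t2.1, t2.2]
  have hq : ∀ q ∈ s, |h (Real.log q / Real.log x) - H| ≤ A * η := by
    intro q hq
    simp only [s, Finset.mem_filter, Finset.mem_Ioc] at hq
    have q1 : y < q := (Nat.floor_lt hyp.le).1 hq.1.1
    have q2 : (q : ℝ) ≤ y * (1 + η) := (Nat.le_floor_iff (by positivity)).1 hq.1.2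
    refine (hl _ _).trans (mul_le_mul_of_nonneg_left ?_ hA)
    have l1 : Real.log y ≤ Real.log q := Real.log_le_log hyp q1.le
    rw [← sub_div, abs_of_nonneg (div_nonneg (by linarith) (by linarith))]
    refine (div_le_self (by linarith) hL).trans ?_
    have l2 : Real.log q ≤ Real.log y + Real.log (1 + η) := by
      rw [← Real.log_mul (by positivity) (by positivity)]
      exact Real.log_le_log (by linarith) q2
    have l3 := Real.log_le_sub_one_of_pos (x := 1 + η) (by linarith)
    linarith
  have hlogq : ∀ q ∈ s, 0 ≤ Real.log (q : ℝ) := fun q _ => Real.log_natCast_nonneg q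
  have e : ∑ q ∈ s, Real.log q * h (Real.log q / Real.log x) - η * y * H =
      ∑ q ∈ s, Real.log q * (h (Real.log q / Real.log x) - H) + (∑ q ∈ s, Real.log q - η * y) * H := by
    simp only [mul_sub, Finset.sum_sub_distrib, ← Finset.sum_mul]; ring
  rw [e]
  refine (abs_add_le _ _).trans ?_
  have b1 : |∑ q ∈ s, Real.log q * (h (Real.log q / Real.log x) - H)| ≤ (∑ q ∈ s, Real.log q) * (A * η) := by
    rw [Finset.sum_mul]
    refine (Finset.abs_sum_le_sum_abs _ _).trans (Finset.sum_le_sum (fun q hqs => ?_))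
    rw [abs_mul, abs_of_nonneg (hlogq q hqs)]
    exact mul_le_mul_of_nonneg_left (hq q hqs) (hlogq q hqs)
  have b2 : |(∑ q ∈ s, Real.log q - η * y) * H| ≤ 3 * η ^ 4 * y * A := by
    rw [abs_mul]
    exact mul_le_mul hS (hb _) (abs_nonneg _) (by positivity)
  have b3 : (∑ q ∈ s, Real.log q) ≤ 4 * η * y := by
    have := (abs_le.1 hS).2
    have h4 : η ^ 4 ≤ η := by
      calc η ^ 4 ≤ η ^ 1 := pow_le_pow_of_le_one hη.le (by linarith) (by norm_num)
        _ = η := pow_one _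
    nlinarith
  have b4 : (∑ q ∈ s, Real.log q) * (A * η) ≤ 4 * η * y * (A * η) := by gcongr
  have b5 : 3 * η ^ 4 * y * A ≤ 3 * η ^ 2 * y * A := by
    have : η ^ 4 ≤ η ^ 2 := pow_le_pow_of_le_one hη.le (by linarith) (by norm_num)
    gcongr
  linarith

open Finset MeasureTheory
open scoped Classical

/-- properties of the weight -/
structure PP (M : ℕ) (δ A : ℝ) (P : List (ℕ × ℝ) → ℝ) : Prop where
  A0 : 0 ≤ A
  perm : ∀ {l l' : List (ℕ × ℝ)}, l.Perm l' → P l = P l'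
  bd : ∀ l, |P l| ≤ A
  sum0 : ∀ l : List (ℕ × ℝ), (l.map Prod.fst).sum ≠ M → P l = 0
  out0 : ∀ (l : List (ℕ × ℝ)) (a : ℕ × ℝ), a ∈ l → 1 ≤ a.1 → a.2 ∉ Jset M δ a.1 → P l = 0
  lip : ∀ (l l' : List (ℕ × ℝ)) (ε : ℝ), 0 ≤ ε →
    List.Forall₂ (fun a b : ℕ × ℝ => a.1 = b.1 ∧ |a.2 - b.2| ≤ ε) l l' → |P l - P l'| ≤ A * ε
  split : ∀ (k : ℕ), 2 ≤ k → ∀ (U : ℝ) (l : List (ℕ × ℝ)), P ((k, U) :: l) =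
      ∫ u : ℝ, P ((k - 1, u) :: (1, U - u) :: l)

theorem PhiL_PP {M : ℕ} (hM : 2 ≤ M) {δ B : ℝ} (hδ : 0 < δ) (hδ1 : 2 * δ ≤ 1)
    {f1 : (Fin M → ℝ) → ℝ} (hf : F1Props M δ B f1) (hB : 0 ≤ B) : PP M δ (Acon M B) (PhiL M f1) where
  A0 := zero_le_one.trans (Acon_ge hM hB).2
  perm := fun h => PhiL_perm hf h
  bd := fun l => Phi_bound hM hδ hδ1 hf hB _ _
  sum0 := fun l h => by
    refine Phi_eq_zero_of_sum _ _ (fun h' => h ?_)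
    rw [← h', ← Fin.sum_univ_getElem]
    simp only [List.getElem_map]
    exact Fintype.sum_equiv (finCongr (by simp)) _ _ (fun i => rfl)
  out0 := fun l a ha h1 h2 => by
    obtain ⟨j, hj⟩ := List.get_of_mem ha
    exact Phi_eq_zero_of_notMem hf _ _ j (by simp only [hj]; exact h1) (by simp only [hj]; exact h2)
  lip := fun l l' ε hε h => by
    have hlen := h.length_eq
    unfold PhiL
    rw [← Phi_reindex hf (finCongr hlen)]
    have hg : ∀ j : Fin l.length, (l.get j).1 = (l'.get (finCongr hlen j)).1 ∧
        |(l.get j).2 - (l'.get (finCongr hlen j)).2| ≤ ε := fun j =>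
      h.get j.2 (by rw [← hlen]; exact j.2)
    have e : (fun j : Fin l.length => (l'.get (finCongr hlen j)).1) = fun j => (l.get j).1 :=
      funext (fun j => (hg j).1.symm)
    rw [e]
    exact Phi_lip hM hδ hδ1 hf hB _ _ _ ε hε (fun j => (hg j).2)
  split := fun k hk U l => PhiL_split hM hf k hk U l

section defs
noncomputable section
variable (M : ℕ) (δ x : ℝ)
/-- list of a number -/
def lst (n : ℕ) : List (ℕ × ℝ) :=
  n.primeFactorsList.map (fun p => (cls M δ x p, Real.log p / Real.log x))
/-- weight of a pair -/
def Wt (a : ℕ × ℝ) : ℝ := (-1 : ℝ) ^ (a.1 + 1) / a.1 * a.2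
/-- weight of a list -/
def WL (l : List (ℕ × ℝ)) : ℝ := (l.map Wt).prod
/-- class sum -/
def cs (n : ℕ) : ℕ := ((lst M δ x n).map Prod.fst).sum
/-- normalised b -/
def bt (P : List (ℕ × ℝ) → ℝ) (n : ℕ) : ℝ := WL (lst M δ x n) * P (lst M δ x n)
/-- the interval -/
def Iset (η : ℝ) : Finset ℕ := Finset.Ioc ⌊x⌋₊ ⌊x * (1 + η)⌋₊
/-- divisor sum -/
def St (η : ℝ) (P : List (ℕ × ℝ) → ℝ) (d : ℕ) : ℝ :=
  ∑ n ∈ (Iset x η).filter (fun n => d ∣ n), bt M δ x P n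
end
end defs

theorem lst_mul (M : ℕ) (δ x : ℝ) {a b : ℕ} (ha : a ≠ 0) (hb : b ≠ 0) :
    (lst M δ x (a * b)).Perm (lst M δ x a ++ lst M δ x b) := by
  unfold lst
  rw [← List.map_append]
  exact (Nat.perm_primeFactorsList_mul ha hb).map _

theorem lst_prime (M : ℕ) (δ x : ℝ) {q : ℕ} (hq : q.Prime) :
    lst M δ x q = [(cls M δ x q, Real.log q / Real.log x)] := by
  unfold lst
  rw [Nat.primeFactorsList_prime hq]; rfl

theorem lst_mul_prime (M : ℕ) (δ x : ℝ) {d q : ℕ} (hd : d ≠ 0) (hq : q.Prime) :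
    (lst M δ x (d * q)).Perm ((cls M δ x q, Real.log q / Real.log x) :: lst M δ x d) := by
  refine (lst_mul M δ x hd hq.ne_zero).trans ?_
  rw [lst_prime M δ x hq]
  exact List.perm_append_comm

theorem WL_perm {l l' : List (ℕ × ℝ)} (h : l.Perm l') : WL l = WL l' := (h.map _).prod_eq

theorem WL_mul (M : ℕ) (δ x : ℝ) {a b : ℕ} (ha : a ≠ 0) (hb : b ≠ 0) :
    WL (lst M δ x (a * b)) = WL (lst M δ x a) * WL (lst M δ x b) := by
  rw [WL_perm (lst_mul M δ x ha hb)]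
  unfold WL; rw [List.map_append, List.prod_append]

theorem cs_mul (M : ℕ) (δ x : ℝ) {a b : ℕ} (ha : a ≠ 0) (hb : b ≠ 0) :
    cs M δ x (a * b) = cs M δ x a + cs M δ x b := by
  unfold cs
  rw [((lst_mul M δ x ha hb).map Prod.fst).sum_eq, List.map_append, List.sum_append]

theorem cs_prime (M : ℕ) (δ x : ℝ) {q : ℕ} (hq : q.Prime) : cs M δ x q = cls M δ x q := by
  unfold cs; rw [lst_prime M δ x hq]; simp

theorem cls_spec {M : ℕ} {δ x : ℝ} {q : ℕ} (h : cls M δ x q ≠ 0) :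
    1 ≤ cls M δ x q ∧ cls M δ x q ≤ M ∧
      x ^ ((cls M δ x q : ℝ) * (1 / M - δ)) ≤ (q : ℝ) ∧ (q : ℝ) ≤ x ^ ((cls M δ x q : ℝ) * (1 / M + δ)) := by
  by_cases h' : ∃ i : ℕ, i ∈ Finset.Icc 1 M ∧
      x ^ ((i : ℝ) * (1 / M - δ)) ≤ (q : ℝ) ∧ (q : ℝ) ≤ x ^ ((i : ℝ) * (1 / M + δ))
  · have e : cls M δ x q = h'.choose := by unfold cls; rw [dif_pos h']
    have hs := h'.choose_spec
    rw [← e, Finset.mem_Icc] at hs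
    exact ⟨hs.1.1, hs.1.2, hs.2.1, hs.2.2⟩
  · exact absurd (by unfold cls; rw [dif_neg h']) h

theorem mem_J_iff {M : ℕ} {δ x : ℝ} (hx : 1 < x) {q : ℕ} (hq : 0 < q) (i : ℕ) :
    Real.log q / Real.log x ∈ Jset M δ i ↔
      x ^ ((i : ℝ) * (1 / M - δ)) ≤ (q : ℝ) ∧ (q : ℝ) ≤ x ^ ((i : ℝ) * (1 / M + δ)) := by
  have hL : 0 < Real.log x := Real.log_pos hx
  have hx0 : 0 < x := by linarith
  have hq' : (0 : ℝ) < q := by exact_mod_cast hq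
  unfold Jset
  rw [Set.mem_Icc, le_div_iff₀ hL, div_le_iff₀ hL, Real.rpow_def_of_pos hx0, Real.rpow_def_of_pos hx0,
    ← Real.le_log_iff_exp_le hq', ← Real.log_le_iff_le_exp hq', mul_comm (Real.log x),
    mul_comm (Real.log x)]

theorem J_disj {M : ℕ} (hM : 2 ≤ M) {δ : ℝ} (hδ : 0 < δ) (hδ1 : δ ≤ 1 / (3 * (M : ℝ) ^ 2)) {i j : ℕ}
    (hi : i ≤ M) (hj : j ≤ M) {u : ℝ} (h1 : u ∈ Jset M δ i) (h2 : u ∈ Jset M δ j) : i = j := by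
  have key : ∀ i j : ℕ, i ≤ M → j ≤ M → i < j → u ∈ Jset M δ i → u ∈ Jset M δ j → False := by
    intro i j hi hj hij h1 h2
    have hM' : (2 : ℝ) ≤ M := by exact_mod_cast hM
    unfold Jset at h1 h2
    rw [Set.mem_Icc] at h1 h2
    have h3 := h2.1.trans h1.2
    have hij' : (i : ℝ) + 1 ≤ j := by exact_mod_cast hij
    have hi' : (i : ℝ) ≤ M := by exact_mod_cast hi
    have hj' : (j : ℝ) ≤ M := by exact_mod_cast hj
    rw [le_div_iff₀ (by positivity)] at hδ1
    have h4 : ((j : ℝ) - i) * (1 / M) ≤ ((i : ℝ) + j) * δ := by linarith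
    have h5 : ((i : ℝ) + j) * δ ≤ 2 * M * δ := by
      apply mul_le_mul_of_nonneg_right _ hδ.le; linarith
    have h6 : 1 / (M : ℝ) ≤ ((j : ℝ) - i) * (1 / M) := by
      have : 0 < 1 / (M : ℝ) := by positivity
      nlinarith
    have h7 : 1 / (M : ℝ) ≤ 2 * M * δ := by linarith
    rw [div_le_iff₀ (by linarith)] at h7
    nlinarith
  rcases lt_trichotomy i j with h | h | h
  · exact (key i j hi hj h h1 h2).elim
  · exact h
  · exact (key j i hj hi h h2 h1).elim

theorem cls_mem {M : ℕ} {δ x : ℝ} (hx : 1 < x) {q : ℕ} (hq : 0 < q) (h : cls M δ x q ≠ 0) :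
    Real.log q / Real.log x ∈ Jset M δ (cls M δ x q) :=
  (mem_J_iff hx hq _).2 (cls_spec h).2.2

theorem cls_eq {M : ℕ} (hM : 2 ≤ M) {δ x : ℝ} (hδ : 0 < δ) (hδ1 : δ ≤ 1 / (3 * (M : ℝ) ^ 2))
    (hx : 1 < x) {q : ℕ} (hq : 0 < q) {i : ℕ} (hi : 1 ≤ i) (hiM : i ≤ M)
    (h : Real.log q / Real.log x ∈ Jset M δ i) : cls M δ x q = i := by
  have h' : ∃ i : ℕ, i ∈ Finset.Icc 1 M ∧
      x ^ ((i : ℝ) * (1 / M - δ)) ≤ (q : ℝ) ∧ (q : ℝ) ≤ x ^ ((i : ℝ) * (1 / M + δ)) :=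
    ⟨i, Finset.mem_Icc.2 ⟨hi, hiM⟩, (mem_J_iff hx hq _).1 h⟩
  have e : cls M δ x q = h'.choose := by unfold cls; rw [dif_pos h']
  have hs := h'.choose_spec
  rw [← e, Finset.mem_Icc] at hs
  exact J_disj hM hδ hδ1 hs.1.2 hiM ((mem_J_iff hx hq _).2 hs.2) h

/-- all prime factors good -/
def Good (M : ℕ) (δ x : ℝ) (n : ℕ) : Prop := ∀ p ∈ n.primeFactorsList, cls M δ x p ≠ 0

theorem Wt_bound {M : ℕ} (hM : 2 ≤ M) {δ : ℝ} (hδ : 0 < δ) (hδ1 : δ ≤ 1 / (3 * (M : ℝ) ^ 2))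
    {a : ℕ × ℝ} (ha : 1 ≤ a.1) (h : a.2 ∈ Jset M δ a.1) : |Wt a| ≤ 1 := by
  have hM' : (2 : ℝ) ≤ M := by exact_mod_cast hM
  unfold Wt
  have ha' : (1 : ℝ) ≤ a.1 := by exact_mod_cast ha
  rw [abs_mul, abs_div, abs_pow, abs_neg, abs_one, one_pow, abs_of_pos (by linarith : (0 : ℝ) < a.1)]
  unfold Jset at h
  rw [Set.mem_Icc] at h
  rw [le_div_iff₀ (by positivity)] at hδ1
  have hMinv : 1 / (M : ℝ) ≤ 1 / 2 := by gcongr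
  have hMd : (M : ℝ) * δ * M ≤ 1 / 3 := by nlinarith
  have hd2 : δ ≤ 1 / 12 := by
    have : (4 : ℝ) ≤ (M : ℝ) ^ 2 := by nlinarith
    nlinarith
  have h0 : 0 ≤ a.2 := le_trans (mul_nonneg (by linarith) (by
    rw [sub_nonneg, le_div_iff₀ (by linarith)]; nlinarith)) h.1
  rw [abs_of_nonneg h0, one_div, inv_mul_le_iff₀ (by linarith)]
  nlinarith

theorem WL_bound {M : ℕ} (hM : 2 ≤ M) {δ : ℝ} (hδ : 0 < δ) (hδ1 : δ ≤ 1 / (3 * (M : ℝ) ^ 2))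
    {x : ℝ} (hx : 1 < x) (n : ℕ) : |WL (lst M δ x n)| ≤ 1 := by
  unfold WL lst
  rw [List.map_map]
  have : ∀ l : List ℕ, (∀ p ∈ l, 0 < p) →
      |(List.map (Wt ∘ fun p : ℕ => (cls M δ x p, Real.log p / Real.log x)) l).prod| ≤ 1 := by
    intro l
    induction l with
    | nil => simp
    | cons p l ih =>
      intro h
      rw [List.map_cons, List.prod_cons, abs_mul]
      have h1 := ih (fun p hp => h p (List.mem_cons_of_mem _ hp))
      refine mul_le_one₀ ?_ (abs_nonneg _) h1
      by_cases hc : cls M δ x p = 0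
      · simp [Wt, hc]
      · exact Wt_bound hM hδ hδ1 (a := (cls M δ x p, Real.log p / Real.log x)) (cls_spec hc).1
          (cls_mem hx (h p List.mem_cons_self) hc)
  exact this _ (fun p hp => (Nat.prime_of_mem_primeFactorsList hp).pos)

theorem WL_good {M : ℕ} {δ x : ℝ} {n : ℕ} (h : WL (lst M δ x n) ≠ 0) : Good M δ x n := by
  intro p hp hc
  apply h
  unfold WL lst
  rw [List.map_map, List.prod_eq_zero_iff, List.mem_map]
  exact ⟨p, hp, by simp [Wt, hc]⟩

theorem log_eq_sum {n : ℕ} (hn : n ≠ 0) : Real.log n = (n.primeFactorsList.map (fun p : ℕ => Real.log p)).sum := by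
  conv_lhs => rw [← Nat.prod_primeFactorsList hn]
  have : ∀ l : List ℕ, (∀ p ∈ l, p ≠ 0) → Real.log (l.prod : ℕ) = (l.map (fun p : ℕ => Real.log p)).sum := by
    intro l
    induction l with
    | nil => simp
    | cons p l ih =>
      intro h
      rw [List.prod_cons, List.map_cons, List.sum_cons, Nat.cast_mul, Real.log_mul,
        ih (fun p hp => h p (List.mem_cons_of_mem _ hp))]
      · exact_mod_cast h p List.mem_cons_self
      · exact_mod_cast List.prod_ne_zero (fun h0 => h 0 (List.mem_cons_of_mem _ h0) rfl)
  exact this _ (fun p hp => (Nat.prime_of_mem_primeFactorsList hp).ne_zero)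

theorem good_log {M : ℕ} {δ x : ℝ} (hx : 1 < x) {n : ℕ} (hn : n ≠ 0) (h : Good M δ x n) :
    (cs M δ x n : ℝ) * (1 / M - δ) * Real.log x ≤ Real.log n ∧
      Real.log n ≤ (cs M δ x n : ℝ) * (1 / M + δ) * Real.log x := by
  rw [log_eq_sum hn]
  unfold cs lst
  rw [List.map_map]
  have hL := Real.log_pos hx
  have : ∀ l : List ℕ, (∀ p ∈ l, 0 < p ∧ cls M δ x p ≠ 0) →
      ((((l.map (Prod.fst ∘ fun p : ℕ => (cls M δ x p, Real.log p / Real.log x))).sum : ℕ) : ℝ) *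
        (1 / M - δ) * Real.log x ≤ (l.map (fun p : ℕ => Real.log p)).sum ∧
      (l.map (fun p : ℕ => Real.log p)).sum ≤
      (((l.map (Prod.fst ∘ fun p : ℕ => (cls M δ x p, Real.log p / Real.log x))).sum : ℕ) : ℝ) *
        (1 / M + δ) * Real.log x) := by
    intro l
    induction l with
    | nil => simp
    | cons p l ih =>
      intro h
      obtain ⟨i1, i2⟩ := ih (fun p hp => h p (List.mem_cons_of_mem _ hp))
      obtain ⟨hp, hc⟩ := h p List.mem_cons_self
      have hJ := cls_mem hx hp hc
      unfold Jset at hJ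
      rw [Set.mem_Icc, le_div_iff₀ hL, div_le_iff₀ hL] at hJ
      simp only [List.map_cons, List.sum_cons, Function.comp_apply, Nat.cast_add] at i1 i2 ⊢
      constructor <;> nlinarith [hJ.1, hJ.2]
  exact this _ (fun p hp => ⟨(Nat.prime_of_mem_primeFactorsList hp).pos, h p hp⟩)

open Finset MeasureTheory
open scoped Classical

theorem delta_facts {M : ℕ} (hM : 2 ≤ M) {δ : ℝ} (hδ : 0 < δ) (hδ1 : δ ≤ 1 / (3 * (M : ℝ) ^ 2)) :
    2 / (3 * (M : ℝ)) ≤ 1 / M - δ ∧ (M - 1 : ℝ) * (1 / M + δ) ≤ 1 - 2 / (3 * (M : ℝ)) := by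
  have hM' : (2 : ℝ) ≤ M := by exact_mod_cast hM
  have h0 : (0 : ℝ) < M := by linarith
  have h1 : δ * M ≤ 1 / (3 * M) := by
    calc δ * M ≤ 1 / (3 * (M : ℝ) ^ 2) * M := by gcongr
      _ = 1 / (3 * M) := by field_simp
  have e1 : 1 / (M : ℝ) = 3 * (1 / (3 * M)) := by field_simp
  have e2 : 2 / (3 * (M : ℝ)) = 2 * (1 / (3 * M)) := by ring
  have e3 : (M : ℝ) * (1 / M) = 1 := by field_simp
  rw [e2]
  constructor
  · nlinarith
  · have : (M - 1 : ℝ) * (1 / M + δ) = 1 - 1 / M + δ * M - δ := by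
      linear_combination e3
    rw [this]
    linarith

theorem mem_I {x η : ℝ} (hx : 0 < x) (hη : 0 < η) {n : ℕ} :
    n ∈ Iset x η ↔ x < n ∧ (n : ℝ) ≤ x * (1 + η) := by
  unfold Iset
  rw [Finset.mem_Ioc, Nat.floor_lt hx.le, Nat.le_floor_iff (by positivity)]

section main
variable {M : ℕ} {x η δ A : ℝ} {N0 : ℕ} {P : List (ℕ × ℝ) → ℝ}

theorem bt_ne (hP : PP M δ A P) {n : ℕ} (h : bt M δ x P n ≠ 0) : Good M δ x n ∧ cs M δ x n = M := by
  unfold bt at h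
  refine ⟨WL_good (left_ne_zero_of_mul h), ?_⟩
  by_contra h'
  exact right_ne_zero_of_mul h (hP.sum0 _ h')

theorem bt_bound (E : Env M x η N0) (hδ : 0 < δ) (hδ1 : δ ≤ 1 / (3 * (M : ℝ) ^ 2)) (hP : PP M δ A P) (n : ℕ) :
    |bt M δ x P n| ≤ A := by
  unfold bt
  rw [abs_mul]
  calc _ ≤ 1 * A := mul_le_mul (WL_bound E.hM hδ hδ1 E.hx n) (hP.bd _) (abs_nonneg _) zero_le_one
    _ = A := one_mul A

theorem good_prime_Q (E : Env M x η N0) (hδ : 0 < δ) (hδ1 : δ ≤ 1 / (3 * (M : ℝ) ^ 2)) {q n : ℕ}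
    (hq : q.Prime) (hc : cls M δ x q ≠ 0) (hn : n ∈ Iset x η) (hqn : q ∣ n) : q ∈ Qset x N0 := by
  have hx := E.hx
  rw [mem_I (by linarith) E.eta0] at hn
  have hn0 : 0 < n := by
    have : (0 : ℝ) < n := by linarith [hn.1]
    exact_mod_cast this
  unfold Qset
  rw [Finset.mem_filter, Finset.mem_Ioc]
  refine ⟨⟨?_, ?_⟩, hq⟩
  · have h1 := (cls_spec hc).2.2.1
    have h2 : (N0 : ℝ) < q := by
      refine E.hN0x.trans_le (le_trans ?_ h1)
      refine Real.rpow_le_rpow_of_exponent_le hx.le ?_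
      have h3 := (delta_facts E.hM hδ hδ1).1
      have h4 : (1 : ℝ) ≤ cls M δ x q := by exact_mod_cast (cls_spec hc).1
      have : (0 : ℝ) ≤ 2 / (3 * (M : ℝ)) := by positivity
      nlinarith
    exact_mod_cast h2
  · refine Nat.le_floor ?_
    have h1 : (q : ℝ) ≤ n := by exact_mod_cast Nat.le_of_dvd hn0 hqn
    nlinarith [hn.2, E.eta1]

theorem card_dvd (E : Env M x η N0) (e : ℕ) :
    (((Iset x η).filter (fun n => e ∣ n)).card : ℝ) ≤ 2 * x / e := by
  have hx := E.hx
  have h1 : (Iset x η).filter (fun n => e ∣ n) ⊆ (Finset.Ioc 0 ⌊2 * x⌋₊).filter (fun n => e ∣ n) := by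
    refine Finset.filter_subset_filter _ ?_
    unfold Iset
    refine Finset.Ioc_subset_Ioc (Nat.zero_le _) (Nat.floor_mono ?_)
    nlinarith [E.eta1]
  have h2 := Finset.card_le_card h1
  rw [Nat.Ioc_filter_dvd_card_eq_div] at h2
  calc (((Iset x η).filter (fun n => e ∣ n)).card : ℝ) ≤ ((⌊2 * x⌋₊ / e : ℕ) : ℝ) := by exact_mod_cast h2
    _ ≤ (⌊2 * x⌋₊ : ℝ) / e := Nat.cast_div_le
    _ ≤ 2 * x / e := by
        gcongr
        exact Nat.floor_le (by linarith)

theorem cs_good_pos {n : ℕ} (hn : n ≠ 0) (hg : Good M δ x n) (h : cs M δ x n = 0) : n = 1 := by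
  by_contra h1
  obtain ⟨p, hp, hpn⟩ := Nat.exists_prime_and_dvd h1
  have hm : p ∈ n.primeFactorsList := (Nat.mem_primeFactorsList hn).2 ⟨hp, hpn⟩
  apply hg p hm
  unfold cs lst at h
  rw [List.map_map, List.sum_eq_zero_iff] at h
  exact h _ (List.mem_map.2 ⟨p, hm, rfl⟩)

theorem good_of_mul {a b : ℕ} (ha : a ≠ 0) (hb : b ≠ 0) (h : Good M δ x (a * b)) : Good M δ x b := by
  intro p hp
  apply h p
  rw [Nat.mem_primeFactorsList (mul_ne_zero ha hb)]
  rw [Nat.mem_primeFactorsList hb] at hp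
  exact ⟨hp.1, hp.2.mul_left a⟩

theorem good_mul_prime {d q : ℕ} (hd : d ≠ 0) (hq : q.Prime) (h : Good M δ x d) (hc : cls M δ x q ≠ 0) :
    Good M δ x (d * q) := by
  intro p hp
  rw [Nat.mem_primeFactorsList (mul_ne_zero hd hq.ne_zero)] at hp
  rcases (Nat.Prime.dvd_mul hp.1).1 hp.2 with h1 | h1
  · exact h p ((Nat.mem_primeFactorsList hd).2 ⟨hp.1, h1⟩)
  · rw [(Nat.prime_dvd_prime_iff_eq hp.1 hq).1 h1]; exact hc

theorem St_zero (E : Env M x η N0) (hP : PP M δ A P) {d : ℕ} (hd : d ≠ 0) (h : M < cs M δ x d) :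
    St M δ x η P d = 0 := by
  unfold St
  refine Finset.sum_eq_zero (fun n hn => ?_)
  rw [Finset.mem_filter, mem_I (by linarith [E.hx]) E.eta0] at hn
  obtain ⟨⟨h1, _⟩, m, rfl⟩ := hn
  by_contra hb
  have hm : m ≠ 0 := by
    rintro rfl
    simp at h1; linarith [E.hx]
  have := (bt_ne hP hb).2
  rw [cs_mul M δ x hd hm] at this
  omega

theorem St_bad (E : Env M x η N0) (hP : PP M δ A P) {d : ℕ} (hd : d ≠ 0) (h : ¬ Good M δ x d) :
    St M δ x η P d = 0 := by
  unfold St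
  refine Finset.sum_eq_zero (fun n hn => ?_)
  rw [Finset.mem_filter, mem_I (by linarith [E.hx]) E.eta0] at hn
  obtain ⟨⟨h1, _⟩, m, rfl⟩ := hn
  by_contra hb
  have hm : m ≠ 0 := by
    rintro rfl
    simp at h1; linarith [E.hx]
  have := (bt_ne hP hb).1
  rw [mul_comm] at this
  exact h (good_of_mul hm hd this)

theorem y_ge (E : Env M x η N0) (hδ : 0 < δ) (hδ1 : δ ≤ 1 / (3 * (M : ℝ) ^ 2)) {d : ℕ} (hd : d ≠ 0)
    (hg : Good M δ x d) (h : cs M δ x d + 1 ≤ M) : (N0 : ℝ) ≤ x / d := by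
  have hx := E.hx
  have hL : 0 < Real.log x := by linarith [E.hL]
  have hd0 : (0 : ℝ) < d := by exact_mod_cast Nat.pos_of_ne_zero hd
  have h1 := (good_log hx hd hg).2
  have h2 := (delta_facts E.hM hδ hδ1).2
  have h3 : (cs M δ x d : ℝ) ≤ M - 1 := by
    have : (cs M δ x d : ℝ) + 1 ≤ M := by exact_mod_cast h
    linarith
  have h4 : Real.log d ≤ (1 - 2 / (3 * (M : ℝ))) * Real.log x := by
    refine h1.trans (mul_le_mul_of_nonneg_right (le_trans ?_ h2) hL.le)
    gcongr
  have h5 : (d : ℝ) ≤ x ^ (1 - 2 / (3 * (M : ℝ))) := by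
    rw [Real.rpow_def_of_pos (by linarith), ← Real.log_le_iff_le_exp hd0, mul_comm]; exact h4
  rw [le_div_iff₀ hd0]
  calc (N0 : ℝ) * d ≤ x ^ (2 / (3 * (M : ℝ))) * x ^ (1 - 2 / (3 * (M : ℝ))) :=
        mul_le_mul E.hN0x.le h5 hd0.le (Real.rpow_nonneg (by linarith) _)
    _ = x := by
        rw [← Real.rpow_add (by linarith)]
        simp

theorem core (E : Env M x η N0) (hδ : 0 < δ) (hδ1 : δ ≤ 1 / (3 * (M : ℝ) ^ 2)) (hP : PP M δ A P)
    {d k : ℕ} (hd : d ≠ 0) (hk : cs M δ x d + k = M) :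
    |(k : ℝ) * St M δ x η P d - ∑ q ∈ Qset x N0, (cls M δ x q : ℝ) * St M δ x η P (d * q)| ≤
      2 * M * A * η ^ 4 * (x / d) := by
  have hx := E.hx
  have hA := hP.A0
  have hd0 : (0 : ℝ) < d := by exact_mod_cast Nat.pos_of_ne_zero hd
  set F := (Iset x η).filter (fun n => d ∣ n) with hF
  -- pointwise
  have hpt : ∀ n ∈ F, |(k : ℝ) * bt M δ x P n -
      ∑ q ∈ Qset x N0, (if d * q ∣ n then (cls M δ x q : ℝ) * bt M δ x P n else 0)| ≤
      M * A * ∑ q ∈ Qset x N0, (if d * q ^ 2 ∣ n then (1 : ℝ) else 0) := by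
    intro n hn
    have hRHS : 0 ≤ M * A * ∑ q ∈ Qset x N0, (if d * q ^ 2 ∣ n then (1 : ℝ) else 0) := by
      refine mul_nonneg (by positivity) (Finset.sum_nonneg (fun q _ => ?_))
      split_ifs <;> norm_num
    by_cases hb : bt M δ x P n = 0
    · simp only [hb, mul_zero, ite_self, Finset.sum_const_zero, sub_zero, abs_zero]
      exact hRHS
    obtain ⟨hg, hcs⟩ := bt_ne hP hb
    rw [hF, Finset.mem_filter] at hn
    obtain ⟨hI, m, rfl⟩ := hn
    have hm : m ≠ 0 := by
      rintro rfl
      rw [mem_I (by linarith) E.eta0] at hI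
      simp at hI; linarith [hI.1]
    have hgm := good_of_mul hd hm hg
    have hcm : cs M δ x m = k := by
      rw [cs_mul M δ x hd hm] at hcs; omega
    have hset : (Qset x N0).filter (fun q => d * q ∣ d * m) = m.primeFactorsList.toFinset := by
      ext q
      rw [Finset.mem_filter, List.mem_toFinset, Nat.mem_primeFactorsList hm,
        Nat.mul_dvd_mul_iff_left (Nat.pos_of_ne_zero hd)]
      constructor
      · rintro ⟨h1, h2⟩
        exact ⟨(Finset.mem_filter.1 h1).2, h2⟩
      · rintro ⟨h1, h2⟩
        exact ⟨good_prime_Q E hδ hδ1 h1 (hgm q ((Nat.mem_primeFactorsList hm).2 ⟨h1, h2⟩)) hI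
          (h2.mul_left d), h2⟩
    have hkS : (k : ℝ) = ∑ q ∈ m.primeFactorsList.toFinset, (m.primeFactorsList.count q : ℝ) * (cls M δ x q : ℝ) := by
      rw [← hcm]
      unfold cs lst
      rw [List.map_map, Finset.sum_list_map_count]
      push_cast
      simp
    rw [← Finset.sum_filter, hset, ← Finset.sum_mul, ← sub_mul, abs_mul, mul_right_comm]
    have hbb := bt_bound E hδ hδ1 hP (d * m)
    refine mul_le_mul ?_ hbb (abs_nonneg _) (mul_nonneg (by positivity) (Finset.sum_nonneg (fun q _ => by split_ifs <;> norm_num)))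
    have hcount : ∀ q ∈ m.primeFactorsList.toFinset, 1 ≤ m.primeFactorsList.count q := fun q hq =>
      List.count_pos_iff.2 (List.mem_toFinset.1 hq)
    have hle : ∑ q ∈ m.primeFactorsList.toFinset, (cls M δ x q : ℝ) ≤ k := by
      rw [hkS]
      refine Finset.sum_le_sum (fun q hq => ?_)
      exact le_mul_of_one_le_left (by positivity) (by exact_mod_cast hcount q hq)
    rw [abs_of_nonneg (by linarith)]
    by_cases hsq : ∃ q ∈ m.primeFactorsList.toFinset, 2 ≤ m.primeFactorsList.count q
    · obtain ⟨q, hq, hq2⟩ := hsq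
      have hqQ : q ∈ Qset x N0 := by
        rw [← hset] at hq; exact (Finset.mem_filter.1 hq).1
      have hqp : q.Prime := (Finset.mem_filter.1 hqQ).2
      have hdv : d * q ^ 2 ∣ d * m := by
        rw [Nat.mul_dvd_mul_iff_left (Nat.pos_of_ne_zero hd), hqp.pow_dvd_iff_le_factorization hm,
          ← Nat.primeFactorsList_count_eq]
        exact hq2
      have h1 : (1 : ℝ) ≤ ∑ q ∈ Qset x N0, (if d * q ^ 2 ∣ d * m then (1 : ℝ) else 0) := by
        refine le_trans ?_ (Finset.single_le_sum (f := fun q => if d * q ^ 2 ∣ d * m then (1 : ℝ) else 0)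
          (fun q _ => by split_ifs <;> norm_num) hqQ)
        simp only [hdv, if_true, le_refl]
      have h2 : (0 : ℝ) ≤ ∑ q ∈ m.primeFactorsList.toFinset, (cls M δ x q : ℝ) :=
        Finset.sum_nonneg (fun _ _ => by positivity)
      have h3 : (k : ℝ) ≤ M := by exact_mod_cast (by omega : k ≤ M)
      nlinarith [(Nat.cast_nonneg M : (0 : ℝ) ≤ M)]
    · have : ∑ q ∈ m.primeFactorsList.toFinset, (cls M δ x q : ℝ) = k := by
        rw [hkS]
        refine Finset.sum_congr rfl (fun q hq => ?_)
        have h1 := hcount q hq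
        have h2 : m.primeFactorsList.count q = 1 := by
          by_contra h3
          exact hsq ⟨q, hq, by omega⟩
        rw [h2]; simp
      rw [this, sub_self]
      exact mul_nonneg (by positivity) (Finset.sum_nonneg (fun q _ => by split_ifs <;> norm_num))
  -- sum
  have hsum : (k : ℝ) * St M δ x η P d - ∑ q ∈ Qset x N0, (cls M δ x q : ℝ) * St M δ x η P (d * q) =
      ∑ n ∈ F, ((k : ℝ) * bt M δ x P n -
      ∑ q ∈ Qset x N0, (if d * q ∣ n then (cls M δ x q : ℝ) * bt M δ x P n else 0)) := by
    rw [Finset.sum_sub_distrib, Finset.sum_comm, St, Finset.mul_sum]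
    congr 1
    refine Finset.sum_congr rfl (fun q _ => ?_)
    rw [St, Finset.mul_sum, ← Finset.sum_filter, hF, Finset.filter_filter]
    refine Finset.sum_congr ?_ (fun _ _ => rfl)
    ext n
    simp only [Finset.mem_filter]
    exact ⟨fun h => ⟨h.1, (Dvd.intro _ rfl).trans h.2, h.2⟩, fun h => ⟨h.1, h.2.2⟩⟩
  rw [hsum]
  refine (Finset.abs_sum_le_sum_abs _ _).trans ((Finset.sum_le_sum hpt).trans ?_)
  rw [← Finset.mul_sum, Finset.sum_comm]
  have hq : ∀ q ∈ Qset x N0, ∑ n ∈ F, (if d * q ^ 2 ∣ n then (1 : ℝ) else 0) ≤ 2 * (x / d) * ((q : ℝ) ^ 2)⁻¹ := by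
    intro q hq
    have hq0 : (0 : ℝ) < q := by exact_mod_cast (Finset.mem_filter.1 hq).2.pos
    calc ∑ n ∈ F, (if d * q ^ 2 ∣ n then (1 : ℝ) else 0)
        ≤ ∑ n ∈ Iset x η, (if d * q ^ 2 ∣ n then (1 : ℝ) else 0) :=
          Finset.sum_le_sum_of_subset_of_nonneg (Finset.filter_subset _ _)
            (fun _ _ _ => by split_ifs <;> norm_num)
      _ = (((Iset x η).filter (fun n => d * q ^ 2 ∣ n)).card : ℝ) := by
          rw [Finset.sum_boole]
      _ ≤ 2 * x / ((d * q ^ 2 : ℕ) : ℝ) := card_dvd E _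
      _ = _ := by push_cast; field_simp
  have hN1 := (N1_facts E).1
  have hsq : ∑ q ∈ Qset x N0, ((q : ℝ) ^ 2)⁻¹ ≤ η ^ 4 := by
    have hN0 := E.hN0
    calc ∑ q ∈ Qset x N0, ((q : ℝ) ^ 2)⁻¹ ≤ ∑ q ∈ Finset.Ioc N0 ⌊2 * x⌋₊, ((q : ℝ) ^ 2)⁻¹ :=
          Finset.sum_le_sum_of_subset_of_nonneg (Finset.filter_subset _ _) (fun _ _ _ => by positivity)
      _ ≤ (N0 : ℝ)⁻¹ - (⌊2 * x⌋₊ : ℝ)⁻¹ := sum_Ioc_inv_sq_le_sub (by omega) hN1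
      _ ≤ (N0 : ℝ)⁻¹ := by
          have : (0 : ℝ) ≤ (⌊2 * x⌋₊ : ℝ)⁻¹ := by positivity
          linarith
      _ ≤ η ^ 4 := by
          have : (0 : ℝ) < N0 := by exact_mod_cast (by omega : 0 < N0)
          rw [inv_le_iff_one_le_mul₀ this, mul_comm]
          exact E.hN0eta
  calc _ ≤ (M : ℝ) * A * ∑ q ∈ Qset x N0, 2 * (x / d) * ((q : ℝ) ^ 2)⁻¹ := by
        refine mul_le_mul_of_nonneg_left (Finset.sum_le_sum hq) (by positivity)
    _ = (M : ℝ) * A * (2 * (x / d)) * ∑ q ∈ Qset x N0, ((q : ℝ) ^ 2)⁻¹ := by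
        rw [← Finset.mul_sum]; ring
    _ ≤ (M : ℝ) * A * (2 * (x / d)) * η ^ 4 := by gcongr
    _ = _ := by ring
end main

open Finset MeasureTheory
open scoped Classical

section main
variable {M : ℕ} {x η δ A : ℝ} {N0 : ℕ} {P : List (ℕ × ℝ) → ℝ}

theorem P_lip1 (hP : PP M δ A P) (k : ℕ) (l : List (ℕ × ℝ)) (u u' : ℝ) :
    |P ((k, u) :: l) - P ((k, u') :: l)| ≤ A * |u - u'| := by
  refine hP.lip _ _ _ (abs_nonneg _) (List.Forall₂.cons ⟨rfl, le_rfl⟩ ?_)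
  exact List.forall₂_same.2 (fun a _ => ⟨rfl, by simp⟩)

theorem P_lip2 (hP : PP M δ A P) (k j : ℕ) (U : ℝ) (l : List (ℕ × ℝ)) (u u' : ℝ) :
    |P ((k, u) :: (j, U - u) :: l) - P ((k, u') :: (j, U - u') :: l)| ≤ A * |u - u'| := by
  refine hP.lip _ _ _ (abs_nonneg _) (List.Forall₂.cons ⟨rfl, le_rfl⟩ (List.Forall₂.cons ⟨rfl, ?_⟩ ?_))
  · simp only
    rw [show U - u - (U - u') = u' - u by ring, abs_sub_comm]
  · exact List.forall₂_same.2 (fun a _ => ⟨rfl, by simp⟩)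

theorem sum_cls_k (E : Env M x η N0) (hδ : 0 < δ) (hδ1 : δ ≤ 1 / (3 * (M : ℝ) ^ 2)) (hP : PP M δ A P)
    {d k : ℕ} (hd : d ≠ 0) (hk1 : 1 ≤ k) (hk : cs M δ x d + k = M) :
    ∑ q ∈ (Qset x N0).filter (fun q => cls M δ x q = k), St M δ x η P (d * q) =
      WL (lst M δ x d) * ((-1 : ℝ) ^ (k + 1) / k) / Real.log x *
       ∑ q ∈ (Finset.Ioc ⌊x / d⌋₊ ⌊x / d * (1 + η)⌋₊).filter Nat.Prime,
        Real.log q * P ((k, Real.log q / Real.log x) :: lst M δ x d) := by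
  have hx := E.hx
  have hx0 : 0 < x := by linarith
  have hη := E.eta0
  have hL : 0 < Real.log x := by linarith [E.hL]
  have hd0 : (0 : ℝ) < d := by exact_mod_cast Nat.pos_of_ne_zero hd
  have h1 : ∀ q ∈ (Qset x N0).filter (fun q => cls M δ x q = k), St M δ x η P (d * q) =
      if d * q ∈ Iset x η then bt M δ x P (d * q) else 0 := by
    intro q hq
    rw [Finset.mem_filter] at hq
    have hqp : q.Prime := (Finset.mem_filter.1 hq.1).2
    have hdq : d * q ≠ 0 := mul_ne_zero hd hqp.ne_zero
    have hz : ∀ n ∈ Iset x η, n ≠ d * q → (if d * q ∣ n then bt M δ x P n else 0) = 0 := by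
      intro n hn hne
      split_ifs with hdv
      · by_contra hb
        obtain ⟨m, rfl⟩ := hdv
        obtain ⟨hg, hc⟩ := bt_ne hP hb
        have hm : m ≠ 0 := by
          rintro rfl
          rw [mem_I hx0 hη] at hn
          simp at hn; linarith [hn.1]
        rw [cs_mul M δ x hdq hm, cs_mul M δ x hd hqp.ne_zero, cs_prime M δ x hqp, hq.2] at hc
        have := cs_good_pos hm (good_of_mul hdq hm hg) (by omega)
        rw [this] at hne
        simp at hne
      · rfl
    unfold St
    rw [Finset.sum_filter]
    by_cases hI : d * q ∈ Iset x η
    · rw [if_pos hI, Finset.sum_eq_single (d * q) hz (fun h => absurd hI h), if_pos dvd_rfl]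
    · rw [if_neg hI]
      exact Finset.sum_eq_zero (fun n hn => hz n hn (fun h => hI (h ▸ hn)))
  rw [Finset.sum_congr rfl h1, ← Finset.sum_filter, Finset.filter_filter]
  have h2 : ∑ q ∈ (Finset.Ioc ⌊x / d⌋₊ ⌊x / d * (1 + η)⌋₊).filter Nat.Prime,
        Real.log q * P ((k, Real.log q / Real.log x) :: lst M δ x d) =
      ∑ q ∈ (Qset x N0).filter (fun q => cls M δ x q = k ∧ d * q ∈ Iset x η),
        Real.log q * P ((k, Real.log q / Real.log x) :: lst M δ x d) := by
    symm
    refine Finset.sum_subset ?_ ?_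
    · intro q hq
      rw [Finset.mem_filter, mem_I hx0 hη] at hq
      have hqp : q.Prime := (Finset.mem_filter.1 hq.1).2
      rw [Finset.mem_filter, Finset.mem_Ioc, Nat.floor_lt (by positivity), Nat.le_floor_iff (by positivity)]
      obtain ⟨_, _, h3, h4⟩ := hq
      push_cast at h3 h4
      refine ⟨⟨?_, ?_⟩, hqp⟩
      · rw [div_lt_iff₀ hd0]; linarith
      · rw [div_mul_eq_mul_div, le_div_iff₀ hd0]; linarith
    · intro q hq hq'
      rw [Finset.mem_filter, Finset.mem_Ioc, Nat.floor_lt (by positivity), Nat.le_floor_iff (by positivity)] at hq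
      obtain ⟨⟨h3, h4⟩, hqp⟩ := hq
      by_cases hc : cls M δ x q = k
      · exfalso
        apply hq'
        rw [div_lt_iff₀ hd0] at h3
        rw [div_mul_eq_mul_div, le_div_iff₀ hd0] at h4
        have hI : d * q ∈ Iset x η := by
          rw [mem_I hx0 hη]
          push_cast
          constructor <;> linarith
        rw [Finset.mem_filter]
        exact ⟨good_prime_Q E hδ hδ1 hqp (by omega) hI (Dvd.intro_left d rfl), hc, hI⟩
      · rw [hP.out0 _ (k, Real.log q / Real.log x) List.mem_cons_self hk1 (fun hJ => hc
          (cls_eq E.hM hδ hδ1 hx hqp.pos hk1 (by omega) hJ)), mul_zero]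
  rw [h2, Finset.mul_sum]
  refine Finset.sum_congr rfl (fun q hq => ?_)
  rw [Finset.mem_filter] at hq
  have hqp : q.Prime := (Finset.mem_filter.1 hq.1).2
  unfold bt
  rw [WL_perm (lst_mul_prime M δ x hd hqp), hP.perm (lst_mul_prime M δ x hd hqp), hq.2.1]
  simp only [WL, List.map_cons, List.prod_cons, Wt]
  field_simp

/-- main term -/
noncomputable def mainT (M : ℕ) (δ x η : ℝ) (P : List (ℕ × ℝ) → ℝ) (k d : ℕ) : ℝ :=
  WL (lst M δ x d) * (η * (x / d) / Real.log x) * P ((k, Real.log (x / d) / Real.log x) :: lst M δ x d)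

theorem lemK (E : Env M x η N0) (hδ : 0 < δ) (hδ1 : δ ≤ 1 / (3 * (M : ℝ) ^ 2)) (hP : PP M δ A P)
    {d k : ℕ} (hd : d ≠ 0) (hg : Good M δ x d) (hk1 : 1 ≤ k) (hk : cs M δ x d + k = M) :
    |∑ q ∈ Qset x N0, (if cls M δ x q = k then (k : ℝ) * St M δ x η P (d * q) else 0) -
      (-1 : ℝ) ^ (k + 1) * mainT M δ x η P k d| ≤ 7 * A * η ^ 2 * (x / d) := by
  have hx := E.hx
  have hx0 : 0 < x := by linarith
  have hη := E.eta0
  have hL : 0 < Real.log x := by linarith [E.hL]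
  have hd1 : (1 : ℝ) ≤ d := by exact_mod_cast Nat.pos_of_ne_zero hd
  have hk0 : (0 : ℝ) < k := by exact_mod_cast hk1
  have hA := lemA E (fun u => P ((k, u) :: lst M δ x d)) A hP.A0 (fun u => hP.bd _)
    (fun u u' => P_lip1 hP k _ u u') (x / d) (y_ge E hδ hδ1 hd hg (by omega)) (div_le_self hx0.le hd1)
  rw [← Finset.sum_filter, ← Finset.mul_sum, sum_cls_k E hδ hδ1 hP hd hk1 hk]
  set S := ∑ q ∈ (Finset.Ioc ⌊x / d⌋₊ ⌊x / d * (1 + η)⌋₊).filter Nat.Prime,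
        Real.log q * P ((k, Real.log q / Real.log x) :: lst M δ x d)
  have e : (k : ℝ) * (WL (lst M δ x d) * ((-1 : ℝ) ^ (k + 1) / k) / Real.log x * S) -
      (-1 : ℝ) ^ (k + 1) * mainT M δ x η P k d =
      (WL (lst M δ x d) * (-1 : ℝ) ^ (k + 1) / Real.log x) *
        (S - η * (x / d) * P ((k, Real.log (x / d) / Real.log x) :: lst M δ x d)) := by
    unfold mainT
    field_simp
  rw [e, abs_mul]
  have h1 : |WL (lst M δ x d) * (-1 : ℝ) ^ (k + 1) / Real.log x| ≤ 1 := by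
    rw [abs_div, abs_mul, abs_pow, abs_neg, abs_one, one_pow, mul_one, abs_of_pos hL, div_le_one hL]
    exact (WL_bound E.hM hδ hδ1 hx d).trans E.hL
  calc _ ≤ 1 * (7 * A * η ^ 2 * (x / d)) := mul_le_mul h1 hA (abs_nonneg _) zero_le_one
    _ = _ := one_mul _

/-- the inductive claim -/
def Claim (M : ℕ) (δ x η : ℝ) (P : List (ℕ × ℝ) → ℝ) (k : ℕ) (C : ℝ) : Prop :=
  ∀ d : ℕ, d ≠ 0 → Good M δ x d → cs M δ x d + k = M →
    |St M δ x η P d - (if k = 1 then mainT M δ x η P 1 d else 0)| ≤ C * η ^ 2 * (x / d)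

theorem claim_one (E : Env M x η N0) (hδ : 0 < δ) (hδ1 : δ ≤ 1 / (3 * (M : ℝ) ^ 2)) (hP : PP M δ A P) :
    Claim M δ x η P 1 (2 * M * A + 7 * A) := by
  intro d hd hg hk
  have hx0 : 0 < x := by linarith [E.hx]
  have hA := hP.A0
  have h1 := core E hδ hδ1 hP hd hk
  have h2 := lemK E hδ hδ1 hP hd hg le_rfl hk
  have h3 : ∑ q ∈ Qset x N0, (cls M δ x q : ℝ) * St M δ x η P (d * q) =
      ∑ q ∈ Qset x N0, (if cls M δ x q = 1 then ((1 : ℕ) : ℝ) * St M δ x η P (d * q) else 0) := by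
    refine Finset.sum_congr rfl (fun q hq => ?_)
    have hqp : q.Prime := (Finset.mem_filter.1 hq).2
    split_ifs with h
    · rw [h]
    · rcases Nat.eq_zero_or_pos (cls M δ x q) with h0 | h0
      · rw [h0]; simp
      · rw [St_zero E hP (mul_ne_zero hd hqp.ne_zero), mul_zero]
        rw [cs_mul M δ x hd hqp.ne_zero, cs_prime M δ x hqp]
        omega
  rw [h3] at h1
  rw [if_pos rfl]
  have h4 : η ^ 4 ≤ η ^ 2 := pow_le_pow_of_le_one E.eta0.le (by linarith [E.eta1]) (by norm_num)
  have h5 : 2 * M * A * η ^ 4 * (x / d) ≤ 2 * M * A * η ^ 2 * (x / d) := by gcongr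
  have h6 : (-1 : ℝ) ^ (1 + 1) = 1 := by norm_num
  rw [h6, one_mul] at h2
  rw [Nat.cast_one, one_mul] at h1
  rw [Nat.cast_one] at h2
  have := abs_sub_le (St M δ x η P d) (∑ q ∈ Qset x N0, (if cls M δ x q = 1 then (1 : ℝ) * St M δ x η P (d * q) else 0))
    (mainT M δ x η P 1 d)
  linarith
end main

open Finset MeasureTheory
open scoped Classical

section step
variable {M : ℕ} {x η δ A : ℝ} {N0 : ℕ} {P : List (ℕ × ℝ) → ℝ}

theorem step_term (E : Env M x η N0) (hδ : 0 < δ) (hδ1 : δ ≤ 1 / (3 * (M : ℝ) ^ 2)) (hP : PP M δ A P)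
    {k : ℕ} (hk2 : 2 ≤ k) {C : ℝ} (hC : 0 ≤ C) (ih : ∀ j, 1 ≤ j → j < k → Claim M δ x η P j C)
    {d : ℕ} (hd : d ≠ 0) (hg : Good M δ x d) (hk : cs M δ x d + k = M) {q : ℕ} (hqp : q.Prime) :
    |(cls M δ x q : ℝ) * St M δ x η P (d * q) -
      (if cls M δ x q = k then (k : ℝ) * St M δ x η P (d * q) else 0) -
      WL (lst M δ x d) * (-1 : ℝ) ^ k * (η * (x / d) / Real.log x) *
        ((Real.log q / (q * Real.log x)) *
          P ((k - 1, Real.log q / Real.log x) :: (1, Real.log (x / d) / Real.log x - Real.log q / Real.log x) ::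
            lst M δ x d))| ≤ M * C * η ^ 2 * (x / d) * (1 / q) := by
  have hx := E.hx
  have hx0 : 0 < x := by linarith
  have hη := E.eta0
  have hL : 0 < Real.log x := by linarith [E.hL]
  have hd0 : (0 : ℝ) < d := by exact_mod_cast Nat.pos_of_ne_zero hd
  have hq0 : (0 : ℝ) < q := by exact_mod_cast hqp.pos
  have hdq := mul_ne_zero hd hqp.ne_zero
  have hR : 0 ≤ M * C * η ^ 2 * (x / d) * (1 / q) := by positivity
  have hcs : cs M δ x (d * q) = cs M δ x d + cls M δ x q := by
    rw [cs_mul M δ x hd hqp.ne_zero, cs_prime M δ x hqp]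
  have hY : cls M δ x q ≠ k - 1 → P ((k - 1, Real.log q / Real.log x) ::
      (1, Real.log (x / d) / Real.log x - Real.log q / Real.log x) :: lst M δ x d) = 0 := by
    intro h
    refine hP.out0 _ (k - 1, Real.log q / Real.log x) List.mem_cons_self (by simp only; omega) (fun hJ => h ?_)
    exact cls_eq E.hM hδ hδ1 hx hqp.pos (by omega) (by omega) hJ
  rcases Nat.eq_zero_or_pos (cls M δ x q) with h0 | h0
  · rw [hY (by omega), if_neg (by omega), h0]
    simpa using hR
  rcases lt_or_ge k (cls M δ x q) with h1 | h1
  · rw [hY (by omega), if_neg (by omega), St_zero E hP hdq (by omega)]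
    simpa using hR
  rcases eq_or_lt_of_le h1 with h2 | h2
  · rw [hY (by omega), if_pos h2, h2]
    simpa using hR
  have hgq : Good M δ x (d * q) := good_mul_prime hd hqp hg (by omega)
  have hc := ih (k - cls M δ x q) (by omega) (by omega) (d * q) hdq hgq (by omega)
  have hcM : (cls M δ x q : ℝ) ≤ M := by exact_mod_cast (by omega : cls M δ x q ≤ M)
  rw [if_neg (by omega), sub_zero]
  have e : WL (lst M δ x d) * (-1 : ℝ) ^ k * (η * (x / d) / Real.log x) *
        ((Real.log q / (q * Real.log x)) *
          P ((k - 1, Real.log q / Real.log x) :: (1, Real.log (x / d) / Real.log x - Real.log q / Real.log x) ::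
            lst M δ x d)) = (cls M δ x q : ℝ) *
        (if k - cls M δ x q = 1 then mainT M δ x η P 1 (d * q) else 0) := by
    by_cases h3 : cls M δ x q = k - 1
    · rw [if_pos (by omega)]
      unfold mainT
      rw [WL_perm (lst_mul_prime M δ x hd hqp),
        hP.perm ((lst_mul_prime M δ x hd hqp).cons (1, Real.log (x / (d * q : ℕ)) / Real.log x)),
        hP.perm (List.Perm.swap _ _ _), h3]
      have e1 : Real.log (x / (d * q : ℕ)) / Real.log x =
          Real.log (x / d) / Real.log x - Real.log q / Real.log x := by
        push_cast
        rw [← div_div, Real.log_div (by positivity) (by positivity), sub_div]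
      rw [e1]
      have h5 : ((k - 1 : ℕ) : ℝ) ≠ 0 := by
        have : k - 1 ≠ 0 := by omega
        exact_mod_cast this
      have h6 : k - 1 + 1 = k := by omega
      simp only [WL, List.map_cons, List.prod_cons, Wt, h6]
      push_cast [h6]
      field_simp
    · rw [hY h3, if_neg (by omega)]; simp
  rw [e, ← mul_sub, abs_mul, Nat.abs_cast]
  calc _ ≤ (M : ℝ) * (C * η ^ 2 * (x / (d * q : ℕ))) := mul_le_mul hcM hc (abs_nonneg _) (by positivity)
    _ = _ := by push_cast; field_simp

theorem step_int (E : Env M x η N0) (hδ : 0 < δ) (hδ1 : δ ≤ 1 / (3 * (M : ℝ) ^ 2)) (hP : PP M δ A P)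
    {k : ℕ} (hk2 : 2 ≤ k) (hkM : k ≤ M) (U : ℝ) (l : List (ℕ × ℝ)) :
    ∫ u in (Real.log N0 / Real.log x)..(Real.log (⌊2 * x⌋₊ : ℝ) / Real.log x),
      P ((k - 1, u) :: (1, U - u) :: l) = P ((k, U) :: l) := by
  have hL : 0 < Real.log x := by linarith [E.hL]
  have hx0 : 0 < x := by linarith [E.hx]
  rw [hP.split k hk2 U l]
  apply intervalIntegral.integral_eq_integral_of_support_subset
  intro u hu
  have hJ : u ∈ Jset M δ (k - 1) := by
    by_contra h
    exact hu (hP.out0 _ (k - 1, u) List.mem_cons_self (by simp only; omega) h)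
  obtain ⟨h1, h2⟩ := delta_facts E.hM hδ hδ1
  obtain ⟨_, _, _, h4, _⟩ := N1_facts E
  unfold Jset at hJ
  rw [Set.mem_Icc] at hJ
  have hM0 : (0 : ℝ) < M := by exact_mod_cast (by have := E.hM; omega : 0 < M)
  have hc1 : (1 : ℝ) ≤ ((k - 1 : ℕ) : ℝ) := by exact_mod_cast (by omega : 1 ≤ k - 1)
  have hc2 : ((k - 1 : ℕ) : ℝ) ≤ M - 1 := by
    have : ((k - 1 : ℕ) : ℝ) + 1 ≤ M := by exact_mod_cast (by omega : k - 1 + 1 ≤ M)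
    linarith
  have hp : 0 < 2 / (3 * (M : ℝ)) := by positivity
  have hp2 : 0 < 1 / (M : ℝ) := by positivity
  constructor
  · have hN : Real.log N0 < 2 / (3 * (M : ℝ)) * Real.log x := by
      rw [← Real.log_rpow hx0]
      exact Real.log_lt_log (by have := E.hN0; positivity) E.hN0x
    rw [div_lt_iff₀ hL]
    refine hN.trans_le ?_
    gcongr
    nlinarith [hJ.1]
  · rw [le_div_iff₀ hL]
    refine le_trans ?_ h4
    have : u ≤ 1 := by nlinarith [hJ.2]
    nlinarith

theorem claim_step (E : Env M x η N0) (hδ : 0 < δ) (hδ1 : δ ≤ 1 / (3 * (M : ℝ) ^ 2)) (hP : PP M δ A P)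
    {k : ℕ} (hk2 : 2 ≤ k) {C : ℝ} (hC : 0 ≤ C) (ih : ∀ j, 1 ≤ j → j < k → Claim M δ x η P j C) :
    Claim M δ x η P k (2 * M * A + 7 * A + 10 * A + 14 * M ^ 2 * C) := by
  intro d hd hg hk
  have hx0 : 0 < x := by linarith [E.hx]
  have hL : 0 < Real.log x := by linarith [E.hL]
  have hη := E.eta0
  have hd0 : (0 : ℝ) < d := by exact_mod_cast Nat.pos_of_ne_zero hd
  have hA := hP.A0
  have h1 := core E hδ hδ1 hP hd hk
  have h2 := lemK E hδ hδ1 hP hd hg (by omega) hk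
  rw [if_neg (by omega), sub_zero]
  set U := Real.log (x / d) / Real.log x with hU
  have h3 := lemB E (fun u => P ((k - 1, u) :: (1, U - u) :: lst M δ x d)) A hP.A0 (fun u => hP.bd _)
    (fun u u' => P_lip2 hP (k - 1) 1 U _ u u')
  rw [step_int E hδ hδ1 hP hk2 (by omega)] at h3
  set W := WL (lst M δ x d) * (-1 : ℝ) ^ k * (η * (x / d) / Real.log x) with hW
  have hWb : |W| ≤ η * (x / d) := by
    rw [hW, abs_mul, abs_mul, abs_pow, abs_neg, abs_one, one_pow, mul_one, abs_of_nonneg (by positivity : 0 ≤ η * (x / d) / Real.log x)]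
    calc _ ≤ 1 * (η * (x / d) / Real.log x) := by
          gcongr
          exact WL_bound E.hM hδ hδ1 E.hx d
      _ ≤ _ := by rw [one_mul]; exact div_le_self (by positivity) E.hL
  have h4 : |∑ q ∈ Qset x N0, ((cls M δ x q : ℝ) * St M δ x η P (d * q) -
      (if cls M δ x q = k then (k : ℝ) * St M δ x η P (d * q) else 0) -
      W * ((Real.log q / (q * Real.log x)) *
          P ((k - 1, Real.log q / Real.log x) :: (1, U - Real.log q / Real.log x) ::
            lst M δ x d)))| ≤ 14 * M ^ 2 * C * η ^ 2 * (x / d) := by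
    calc _ ≤ ∑ q ∈ Qset x N0, M * C * η ^ 2 * (x / d) * (1 / (q : ℝ)) := by
          refine (Finset.abs_sum_le_sum_abs _ _).trans (Finset.sum_le_sum (fun q hq => ?_))
          exact step_term E hδ hδ1 hP hk2 hC ih hd hg hk (Finset.mem_filter.1 hq).2
      _ = M * C * η ^ 2 * (x / d) * ∑ q ∈ Qset x N0, (1 / (q : ℝ)) := by rw [Finset.mul_sum]
      _ ≤ M * C * η ^ 2 * (x / d) * (14 * M) := by
          gcongr
          exact mertens E
      _ = _ := by ring
  rw [Finset.sum_sub_distrib, Finset.sum_sub_distrib, ← Finset.mul_sum] at h4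
  set S1 := ∑ q ∈ Qset x N0, (cls M δ x q : ℝ) * St M δ x η P (d * q)
  set S2 := ∑ q ∈ Qset x N0, (if cls M δ x q = k then (k : ℝ) * St M δ x η P (d * q) else 0)
  set S3 := ∑ q ∈ Qset x N0, (Real.log q / (q * Real.log x)) *
          P ((k - 1, Real.log q / Real.log x) :: (1, U - Real.log q / Real.log x) ::
            lst M δ x d)
  set m := P ((k, U) :: lst M δ x d) with hm
  have h5 : |W * (S3 - m)| ≤ 10 * A * η ^ 2 * (x / d) := by
    rw [abs_mul]
    calc _ ≤ (η * (x / d)) * (10 * A * η) := mul_le_mul hWb h3 (abs_nonneg _) (by positivity)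
      _ = _ := by ring
  have h6 : (-1 : ℝ) ^ (k + 1) * mainT M δ x η P k d = - (W * m) := by
    unfold mainT
    rw [hW, hm, hU, pow_succ]
    ring
  rw [h6] at h2
  have h7 : η ^ 4 ≤ η ^ 2 := pow_le_pow_of_le_one E.eta0.le (by linarith [E.eta1]) (by norm_num)
  have h8 : 2 * M * A * η ^ 4 * (x / d) ≤ 2 * M * A * η ^ 2 * (x / d) := by gcongr
  have h9 : |(k : ℝ) * St M δ x η P d| ≤ (2 * M * A + 7 * A + 10 * A + 14 * M ^ 2 * C) * η ^ 2 * (x / d) := by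
    rw [mul_sub] at h5
    rw [abs_le] at *
    constructor <;> linarith [h1.1, h1.2, h2.1, h2.2, h4.1, h4.2, h5.1, h5.2]
  rw [abs_mul, Nat.abs_cast] at h9
  have hk1 : (1 : ℝ) ≤ k := by exact_mod_cast (by omega : 1 ≤ k)
  nlinarith [abs_nonneg (St M δ x η P d)]

theorem claim_mono {k : ℕ} {C C' : ℝ} (hx : 0 < x) (h : C ≤ C') (hc : Claim M δ x η P k C) :
    Claim M δ x η P k C' := fun d hd hg hk => (hc d hd hg hk).trans (by gcongr)

/-- constants -/
noncomputable def Cst (M : ℕ) (A : ℝ) : ℕ → ℝ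
  | 0 => 2 * M * A + 7 * A
  | n + 1 => 2 * M * A + 7 * A + 10 * A + (14 * M ^ 2 + 1) * Cst M A n

theorem Cst_nonneg (hA : 0 ≤ A) (n : ℕ) : 0 ≤ Cst M A n := by
  induction n with
  | zero => unfold Cst; positivity
  | succ n ih => unfold Cst; positivity

theorem claim_all (E : Env M x η N0) (hδ : 0 < δ) (hδ1 : δ ≤ 1 / (3 * (M : ℝ) ^ 2)) (hP : PP M δ A P) (n : ℕ) :
    ∀ j, 1 ≤ j → j ≤ n + 1 → Claim M δ x η P j (Cst M A n) := by
  have hx0 : 0 < x := by linarith [E.hx]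
  have hA := hP.A0
  induction n with
  | zero =>
    intro j h1 h2
    obtain rfl : j = 1 := by omega
    exact claim_one E hδ hδ1 hP
  | succ n ih =>
    intro j h1 h2
    have hc := Cst_nonneg (M := M) hA n
    rcases Nat.lt_or_ge j 2 with h | h
    · refine claim_mono hx0 ?_ (ih j h1 (by omega))
      rw [Cst]; 
      have : 0 ≤ 2 * M * A + 7 * A + 10 * A + (14 * M ^ 2) * Cst M A n := by positivity
      linarith
    · refine claim_mono hx0 ?_ (claim_step E hδ hδ1 hP h hc (fun i h3 h4 => ih i h3 (by omega)))
      rw [Cst]; linarith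

end step

open Finset MeasureTheory
open scoped Classical

section bb
variable {M : ℕ} {x η δ B : ℝ} {N0 : ℕ}

theorem econst_eq {r : ℕ} (ρ : Fin r → ℕ) : econst ρ = ∏ j, ((-1 : ℝ) ^ (ρ j + 1) / (ρ j : ℝ)) := by
  unfold econst
  rw [Finset.prod_div_distrib, Finset.prod_pow_eq_pow_sum, Finset.sum_add_distrib]
  simp

theorem econst_abs {r : ℕ} (ρ : Fin r → ℕ) (h : ∀ j, 1 ≤ ρ j) : |econst ρ| ≤ 1 := by
  rw [econst_eq, Finset.abs_prod]
  refine Finset.prod_le_one (fun j _ => abs_nonneg _) (fun j _ => ?_)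
  have : (1 : ℝ) ≤ ρ j := by exact_mod_cast h j
  rw [abs_div, abs_pow, abs_neg, abs_one, one_pow, abs_of_pos (by linarith), div_le_one (by linarith)]
  exact this

theorem WL_econst (n : ℕ) : WL (lst M δ x n) =
    econst (fun j : Fin n.primeFactorsList.length => cls M δ x (n.primeFactorsList.get j)) *
    ∏ j : Fin n.primeFactorsList.length, Real.log (n.primeFactorsList.get j) / Real.log x := by
  rw [econst_eq, ← Finset.prod_mul_distrib]
  unfold WL lst
  rw [List.map_map, ← Fin.prod_univ_fun_getElem]
  rfl

theorem PhiL_lst {f1 : (Fin M → ℝ) → ℝ} (hf : F1Props M δ B f1) (n : ℕ) : PhiL M f1 (lst M δ x n) =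
    Phi M f1 (fun j : Fin n.primeFactorsList.length => cls M δ x (n.primeFactorsList.get j))
     (fun j : Fin n.primeFactorsList.length => Real.log (n.primeFactorsList.get j) / Real.log x) := by
  unfold PhiL
  have hl : (lst M δ x n).length = n.primeFactorsList.length := by unfold lst; simp
  rw [← Phi_reindex hf (finCongr hl)]
  have key : ∀ j, (lst M δ x n).get j = (cls M δ x (n.primeFactorsList.get (finCongr hl j)),
      Real.log (n.primeFactorsList.get (finCongr hl j)) / Real.log x) := by
    intro j
    rw [List.get_eq_getElem]
    simp only [lst, List.getElem_map]
    rfl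
  congr 1
  · funext j; rw [key j]
  · funext j; rw [key j]

theorem good_iff (n : ℕ) : (∀ p ∈ n.primeFactorsList, ∃ i : ℕ, i ∈ Finset.Icc 1 M ∧
      x ^ ((i : ℝ) * (1 / M - δ)) ≤ (p : ℝ) ∧ (p : ℝ) ≤ x ^ ((i : ℝ) * (1 / M + δ))) ↔ Good M δ x n := by
  unfold Good
  refine forall₂_congr (fun p _ => ⟨fun h' => ?_, fun h => ?_⟩)
  · have e : cls M δ x p = h'.choose := by unfold cls; rw [dif_pos h']
    have hs := h'.choose_spec
    rw [← e, Finset.mem_Icc] at hs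
    omega
  · obtain ⟨h1, h2, h3⟩ := cls_spec h
    exact ⟨_, Finset.mem_Icc.2 ⟨h1, h2⟩, h3⟩

theorem bseq_abs (hM : 2 ≤ M) (hδ : 0 < δ) (hδ1 : δ ≤ 1 / (3 * (M : ℝ) ^ 2)) 
    {f1 : (Fin M → ℝ) → ℝ} (hf : F1Props M δ B f1) (n : ℕ) : |bseq M δ x f1 n| ≤ 1 := by
  unfold bseq
  split_ifs with h
  · rw [good_iff] at h
    refine Falpha_le_one hM hδ hδ1 hf _ _ (fun j => ?_) (fun j => ?_)
    · exact Nat.one_le_iff_ne_zero.2 (h _ (List.get_mem _ _))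
    · exact div_nonneg (Real.log_natCast_nonneg _) (Real.log_natCast_nonneg _)
  · simp

theorem b_diff (E : Env M x η N0) (hδ : 0 < δ) (hδ1 : δ ≤ 1 / (3 * (M : ℝ) ^ 2))
    {f1 : (Fin M → ℝ) → ℝ} (hf : F1Props M δ B f1) (hB : 0 ≤ B) {n : ℕ} (hn : n ∈ Iset x η) :
    |bseq M δ x f1 n - bt M δ x (PhiL M f1) n| ≤ (M + 1) * 2 ^ M * Acon M B * η := by
  have hM := E.hM
  have hx := E.hx
  have hx0 : 0 < x := by linarith
  have hη := E.eta0
  have hη1 := E.eta1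
  have hL1 := E.hL
  have hL : 0 < Real.log x := by linarith [E.hL]
  have hA := (Acon_ge hM hB).2
  have hM2 : (2 : ℝ) ≤ M := by exact_mod_cast hM
  have hδ2 : 2 * δ ≤ 1 := by
    have : 1 / (3 * (M : ℝ) ^ 2) ≤ 1 / 12 := by gcongr; nlinarith
    linarith
  have hRR : 0 ≤ (M + 1) * 2 ^ M * Acon M B * η := by positivity
  rw [mem_I hx0 hη] at hn
  have hn0 : n ≠ 0 := by rintro rfl; simp at hn; linarith [hn.1]
  have hnp : (0 : ℝ) < n := by exact_mod_cast Nat.pos_of_ne_zero hn0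
  have hLn : Real.log x ≤ Real.log n := Real.log_le_log hx0 hn.1.le
  have hLn2 : Real.log n ≤ Real.log x + η := by
    calc Real.log n ≤ Real.log (x * (1 + η)) := Real.log_le_log hnp hn.2
      _ = Real.log x + Real.log (1 + η) := Real.log_mul hx0.ne' (by positivity)
      _ ≤ _ := by linarith [Real.log_le_sub_one_of_pos (by linarith : 0 < 1 + η)]
  unfold bseq bt
  rw [WL_econst, PhiL_lst hf]
  split_ifs with h
  · rw [good_iff] at h
    rw [Falpha_eq hM hδ1 hf]
    have hρ : ∀ j : Fin n.primeFactorsList.length, 1 ≤ cls M δ x (n.primeFactorsList.get j) :=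
      fun j => Nat.one_le_iff_ne_zero.2 (h _ (List.get_mem _ _))
    have hv0 : ∀ j : Fin n.primeFactorsList.length, 0 ≤ Real.log (n.primeFactorsList.get j) ∧
        Real.log (n.primeFactorsList.get j) ≤ Real.log n := by
      intro j
      refine ⟨Real.log_natCast_nonneg _, Real.log_le_log ?_ ?_⟩
      · exact_mod_cast (Nat.prime_of_mem_primeFactorsList (List.get_mem _ _)).pos
      · exact_mod_cast Nat.le_of_dvd (Nat.pos_of_ne_zero hn0) (Nat.dvd_of_mem_primeFactorsList (List.get_mem _ _))
    generalize hr : (fun j : Fin n.primeFactorsList.length => cls M δ x (n.primeFactorsList.get j)) = ρ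
    have hρ' : ∀ j, 1 ≤ ρ j := by rw [← hr]; exact hρ
    by_cases hs : ∑ j, ρ j = M
    swap
    · rw [Phi_eq_zero_of_sum _ _ hs, Phi_eq_zero_of_sum _ _ hs]; simpa using hRR
    have hcard : n.primeFactorsList.length ≤ M := by
      rw [← hs]
      calc n.primeFactorsList.length = ∑ j : Fin n.primeFactorsList.length, 1 := by simp
        _ ≤ _ := Finset.sum_le_sum (fun j _ => hρ' j)
    have hab : ∀ j : Fin n.primeFactorsList.length, |Real.log (n.primeFactorsList.get j) / Real.log n -
        Real.log (n.primeFactorsList.get j) / Real.log x| ≤ η := by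
      intro j
      obtain ⟨h1, h2⟩ := hv0 j
      have hLn0 : 0 < Real.log n := by linarith
      have e : Real.log (n.primeFactorsList.get j) / Real.log n - Real.log (n.primeFactorsList.get j) / Real.log x
        = -((Real.log (n.primeFactorsList.get j) / Real.log n) * ((Real.log n - Real.log x) / Real.log x)) := by
        field_simp; ring
      rw [e, abs_neg, abs_of_nonneg (mul_nonneg (div_nonneg h1 hLn0.le) (div_nonneg (by linarith) hL.le))]
      calc _ ≤ 1 * η := by
            refine mul_le_mul ((div_le_one hLn0).2 h2) ?_ (div_nonneg (by linarith) hL.le) zero_le_one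
            rw [div_le_iff₀ hL]; nlinarith
        _ = η := one_mul _
    have ha : ∀ j : Fin n.primeFactorsList.length, |Real.log (n.primeFactorsList.get j) / Real.log n| ≤ 2 := by
      intro j
      obtain ⟨h1, h2⟩ := hv0 j
      have hLn0 : 0 < Real.log n := by linarith
      rw [abs_of_nonneg (div_nonneg h1 hLn0.le), div_le_iff₀ hLn0]; linarith
    have hb : ∀ j : Fin n.primeFactorsList.length, |Real.log (n.primeFactorsList.get j) / Real.log x| ≤ 2 := by
      intro j
      obtain ⟨h1, h2⟩ := hv0 j
      rw [abs_of_nonneg (div_nonneg h1 hL.le), div_le_iff₀ hL]; linarith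
    obtain ⟨q1, q2, q3⟩ := prod_diff_le Finset.univ _ _ 2 η (by norm_num) hη.le (fun j _ => ha j) (fun j _ => hb j)
      (fun j _ => hab j)
    have hl := Phi_lip hM hδ hδ2 hf hB ρ _ _ η hη.le hab
    have hbd := Phi_bound hM hδ hδ2 hf hB ρ (fun j => Real.log (n.primeFactorsList.get j) / Real.log x)
    have he := econst_abs ρ hρ'
    rw [Finset.card_univ, Fintype.card_fin] at q1 q2
    have hp : (2 : ℝ) ^ n.primeFactorsList.length ≤ 2 ^ M := pow_le_pow_right₀ (by norm_num) hcard
    have hc' : (n.primeFactorsList.length : ℝ) ≤ M := by exact_mod_cast hcard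
    have q1' := q1.trans (show _ ≤ (M : ℝ) * 2 ^ M * η by gcongr)
    have q2' := q2.trans hp
    set a := ∏ j : Fin n.primeFactorsList.length, Real.log (n.primeFactorsList.get j) / Real.log n
    set b := ∏ j : Fin n.primeFactorsList.length, Real.log (n.primeFactorsList.get j) / Real.log x
    set F := Phi M f1 ρ (fun j => Real.log (n.primeFactorsList.get j) / Real.log n)
    set G := Phi M f1 ρ (fun j => Real.log (n.primeFactorsList.get j) / Real.log x)
    have e : econst ρ * a * F - econst ρ * b * G = econst ρ * (a * (F - G) + (a - b) * G) := by ring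
    rw [e, abs_mul]
    calc _ ≤ 1 * (2 ^ M * (Acon M B * η) + (M * 2 ^ M * η) * Acon M B) := by
          refine mul_le_mul he ?_ (abs_nonneg _) zero_le_one
          refine (abs_add_le _ _).trans ?_
          rw [abs_mul, abs_mul]
          gcongr
      _ = _ := by ring
  · have : WL (lst M δ x n) = 0 := by
      by_contra h'
      exact h ((good_iff n).2 (WL_good h'))
    rw [← WL_econst, this]
    simpa using hRR
end bb

open Finset MeasureTheory
open scoped Classical

theorem s_exists (M : ℕ) (c1 C0 : ℝ) (hc1 : 0 < c1) : ∃ s0 : ℝ, 1 ≤ s0 ∧ ∀ s, s0 ≤ s →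
    6 * (M : ℝ) ≤ s ∧ 4 * (M : ℝ) * (4 * c1 + 1) ≤ s ∧ Real.exp (-c1 * s) ≤ 1 / 2 ∧
    |C0| * Real.exp (-(4 * c1) * s) ≤ 1 / 2 ∧ s ^ 2 * Real.exp (-c1 * s) ≤ 1 ∧
    8 * (s ^ 2 * Real.exp (-s)) ≤ 1 := by
  have t1 : Filter.Tendsto (fun s : ℝ => c1 * s) Filter.atTop Filter.atTop :=
    Filter.tendsto_id.const_mul_atTop hc1
  have t4 : Filter.Tendsto (fun s : ℝ => 4 * c1 * s) Filter.atTop Filter.atTop :=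
    Filter.tendsto_id.const_mul_atTop (by positivity)
  have e1 : Filter.Tendsto (fun s : ℝ => Real.exp (-(c1 * s))) Filter.atTop (nhds 0) :=
    Real.tendsto_exp_neg_atTop_nhds_zero.comp t1
  have e2 : Filter.Tendsto (fun s : ℝ => |C0| * Real.exp (-(4 * c1 * s))) Filter.atTop (nhds (|C0| * 0)) :=
    (Real.tendsto_exp_neg_atTop_nhds_zero.comp t4).const_mul _
  rw [mul_zero] at e2
  have e3 : Filter.Tendsto (fun s : ℝ => (c1 * s) ^ 2 * Real.exp (-(c1 * s))) Filter.atTop (nhds 0) :=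
    (Real.tendsto_pow_mul_exp_neg_atTop_nhds_zero 2).comp t1
  have e4 := Real.tendsto_pow_mul_exp_neg_atTop_nhds_zero 2
  have ev : ∀ᶠ s : ℝ in Filter.atTop, 6 * (M : ℝ) ≤ s ∧ 4 * (M : ℝ) * (4 * c1 + 1) ≤ s ∧
      Real.exp (-c1 * s) ≤ 1 / 2 ∧
    |C0| * Real.exp (-(4 * c1) * s) ≤ 1 / 2 ∧ s ^ 2 * Real.exp (-c1 * s) ≤ 1 ∧
    8 * (s ^ 2 * Real.exp (-s)) ≤ 1 := by
    filter_upwards [Filter.eventually_ge_atTop (6 * (M : ℝ)), Filter.eventually_ge_atTop (4 * (M : ℝ) * (4 * c1 + 1)),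
      e1.eventually_le_const (show (0 : ℝ) < 1 / 2 by norm_num),
      e2.eventually_le_const (show (0 : ℝ) < 1 / 2 by norm_num),
      e3.eventually_le_const (show (0 : ℝ) < c1 ^ 2 by positivity),
      e4.eventually_le_const (show (0 : ℝ) < 1 / 8 by norm_num)] with s h1 h2 h3 h4 h5 h6
    refine ⟨h1, h2, ?_, ?_, ?_, by linarith⟩
    · rwa [neg_mul]
    · rwa [neg_mul]
    · rw [neg_mul]
      have : c1 ^ 2 * (s ^ 2 * Real.exp (-(c1 * s))) ≤ c1 ^ 2 * 1 := by linarith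
      exact le_of_mul_le_mul_left this (by positivity)
  obtain ⟨s0, h⟩ := Filter.eventually_atTop.1 ev
  exact ⟨max 1 s0, le_max_left _ _, fun s hs => h s ((le_max_right _ _).trans hs)⟩

theorem env_exists (c0 : ℝ) (hc0 : 0 < c0)
    (hPNT : ∃ C0 : ℝ, ∀ x : ℝ, 2 ≤ x →
      |(∑ n ∈ Finset.Icc 1 ⌊x⌋₊, ArithmeticFunction.vonMangoldt n) - x|
        ≤ C0 * x * Real.exp (-c0 * Real.sqrt (Real.log x)))
    (M : ℕ) (hM : 2 ≤ M) (c1 : ℝ) (hc1 : c1 = c0 * ((2 * M : ℕ) : ℝ) ^ (-(M : ℝ))) :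
    ∃ x₁ : ℝ, ∀ x : ℝ, x₁ ≤ x →
      Env M x (Real.exp (-c1 * Real.sqrt (Real.log x))) ⌈x ^ (1 / (2 * (M : ℝ)))⌉₊ := by
  obtain ⟨C0, hC⟩ := hPNT
  have hM2 : (2 : ℝ) ≤ M := by exact_mod_cast hM
  have hM0 : (0 : ℝ) < M := by linarith
  have hc1p : 0 < c1 := by rw [hc1]; positivity
  have hcc : 8 * c1 ≤ c0 / Real.sqrt (2 * M) := by
    have hs : 2 ≤ Real.sqrt (2 * M) := Real.le_sqrt_of_sq_le (by linarith)
    have hs2 : Real.sqrt (2 * M) ^ 2 = 2 * M := Real.sq_sqrt (by positivity)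
    have h1 : 8 * Real.sqrt (2 * M) ≤ (2 * M : ℝ) ^ M := by
      calc 8 * Real.sqrt (2 * M) ≤ (2 * M : ℝ) ^ 2 := by
            have h3 : 8 ≤ Real.sqrt (2 * M) ^ 3 := by nlinarith [sq_nonneg (Real.sqrt (2 * M) - 2)]
            calc 8 * Real.sqrt (2 * M) ≤ Real.sqrt (2 * M) ^ 3 * Real.sqrt (2 * M) := by gcongr
              _ = (Real.sqrt (2 * M) ^ 2) ^ 2 := by ring
              _ = _ := by rw [hs2]
        _ ≤ _ := pow_le_pow_right₀ (by linarith) hM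
    rw [hc1, Real.rpow_neg (by positivity), Real.rpow_natCast, le_div_iff₀ (by linarith)]
    push_cast
    have h2 : 0 < (2 * M : ℝ) ^ M := by positivity
    calc 8 * (c0 * ((2 * (M : ℝ)) ^ M)⁻¹) * Real.sqrt (2 * M) =
          c0 * (((2 * (M : ℝ)) ^ M)⁻¹ * (8 * Real.sqrt (2 * M))) := by ring
      _ ≤ c0 * (((2 * (M : ℝ)) ^ M)⁻¹ * (2 * M : ℝ) ^ M) := by gcongr
      _ = c0 := by rw [inv_mul_cancel₀ h2.ne', mul_one]
  obtain ⟨s0, hs01, hs0⟩ := s_exists M c1 C0 hc1p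
  refine ⟨Real.exp (s0 ^ 2), fun x hx => ?_⟩
  have hx0 : 0 < x := (Real.exp_pos _).trans_le hx
  have hL0 : s0 ^ 2 ≤ Real.log x := (Real.le_log_iff_exp_le hx0).2 hx
  have hss : s0 ≤ Real.sqrt (Real.log x) := Real.le_sqrt_of_sq_le hL0
  have hLs : Real.sqrt (Real.log x) ^ 2 = Real.log x := Real.sq_sqrt (by nlinarith)
  obtain ⟨g1, g2, g3, g4, g5, g6⟩ := hs0 _ hss
  have hL1 : 1 ≤ Real.log x := by nlinarith
  set s := Real.sqrt (Real.log x) with hs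
  set η := Real.exp (-c1 * s) with hη
  have hs1 : 1 ≤ s := hs01.trans hss
  have hη0 : 0 < η := Real.exp_pos _
  have hx1 : 1 < x := by
    have := Real.log_le_sub_one_of_pos hx0
    linarith
  have hη4 : η ^ 4 = Real.exp (-(4 * c1) * s) := by
    rw [hη, ← Real.exp_nat_mul]; congr 1; push_cast; ring
  set X := x ^ (1 / (2 * (M : ℝ))) with hX
  have hX0 : 0 < X := Real.rpow_pos_of_pos hx0 _
  have hXlog : Real.log X = s ^ 2 / (2 * M) := by rw [hX, Real.log_rpow hx0, hLs]; ring
  have hXe : X = Real.exp (s ^ 2 / (2 * M)) := by rw [← hXlog, Real.exp_log hX0]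
  have h6M : 1 ≤ s ^ 2 / (6 * M) := by
    rw [le_div_iff₀ (by positivity)]; nlinarith
  have hX4 : 4 ≤ X := by
    rw [hXe]
    have e : s ^ 2 / (2 * M) = 3 * (s ^ 2 / (6 * M)) := by field_simp; norm_num
    have := Real.add_one_le_exp (s ^ 2 / (2 * (M : ℝ)))
    linarith
  have hXN : X ≤ (⌈X⌉₊ : ℝ) := Nat.le_ceil _
  -- exponent bound
  have hexp : 4 * c1 * s + s ≤ s ^ 2 / (4 * M) := by
    rw [le_div_iff₀ (by positivity)]; nlinarith
  refine ⟨hM, hx1, hL1, hη0, g3, ?_, ?_, ?_, ?_, ?_, ?_⟩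
  · rw [← hLs]; exact g5
  · have : (4 : ℝ) ≤ (⌈X⌉₊ : ℝ) := hX4.trans hXN
    have : 4 ≤ ⌈X⌉₊ := by exact_mod_cast this
    omega
  · calc (1 : ℝ) = Real.exp 0 := Real.exp_zero.symm
      _ ≤ Real.exp (s ^ 2 / (2 * M) + -(4 * c1) * s) := by
          apply Real.exp_le_exp.2
          have : s ^ 2 / (2 * M) = 2 * (s ^ 2 / (4 * M)) := by field_simp; norm_num
          nlinarith
      _ = X * η ^ 4 := by rw [Real.exp_add, hXe, hη4]
      _ ≤ _ := by gcongr
  · calc (⌈X⌉₊ : ℝ) < X + 1 := Nat.ceil_lt_add_one hX0.le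
      _ ≤ X * 2 := by linarith
      _ ≤ X * Real.exp (s ^ 2 / (6 * M)) := by
          gcongr
          linarith [Real.add_one_le_exp (s ^ 2 / (6 * (M : ℝ)))]
      _ = x ^ (2 / (3 * (M : ℝ))) := by
          rw [hXe, ← Real.exp_add, Real.rpow_def_of_pos hx0, ← hLs]
          congr 1; field_simp; norm_num
  · calc Real.log x / (2 * M) = Real.log X := by rw [hXlog, hLs]
      _ ≤ _ := Real.log_le_log hX0 hXN
  · intro t ht1 ht2
    have htX : X ≤ t := hXN.trans ht1
    have ht0 : 0 < t := by linarith
    have h1 := hC t (by linarith)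
    have hpsi : (∑ n ∈ Finset.Icc 1 ⌊t⌋₊, ArithmeticFunction.vonMangoldt n) = Chebyshev.psi t := by
      unfold Chebyshev.psi; rfl
    rw [hpsi] at h1
    have hlt : s ^ 2 / (2 * M) ≤ Real.log t := by rw [← hXlog]; exact Real.log_le_log hX0 htX
    have hst : s / Real.sqrt (2 * M) ≤ Real.sqrt (Real.log t) := by
      apply Real.le_sqrt_of_sq_le
      rw [div_pow, Real.sq_sqrt (show (0 : ℝ) ≤ 2 * M by positivity)]; exact hlt
    have h2 : |Chebyshev.psi t - t| ≤ η ^ 4 * t / 2 := by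
      refine h1.trans ?_
      have : Real.exp (-c0 * Real.sqrt (Real.log t)) ≤ Real.exp (-(4 * c1) * s) * Real.exp (-(4 * c1) * s) := by
        rw [← Real.exp_add]
        apply Real.exp_le_exp.2
        have : 8 * c1 * s ≤ c0 * Real.sqrt (Real.log t) := by
          calc 8 * c1 * s ≤ c0 / Real.sqrt (2 * M) * s := by gcongr
            _ = c0 * (s / Real.sqrt (2 * M)) := by ring
            _ ≤ _ := by gcongr
        linarith
      calc _ ≤ |C0| * t * (Real.exp (-(4 * c1) * s) * Real.exp (-(4 * c1) * s)) := by
            gcongr; exact le_abs_self _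
        _ = (|C0| * Real.exp (-(4 * c1) * s)) * (t * Real.exp (-(4 * c1) * s)) := by ring
        _ ≤ 1 / 2 * (t * Real.exp (-(4 * c1) * s)) := by gcongr
        _ = _ := by rw [hη4]; ring
    have h3 : |Chebyshev.psi t - Chebyshev.theta t| ≤ η ^ 4 * t / 2 := by
      refine (Chebyshev.abs_psi_sub_theta_le_sqrt_mul_log (by linarith)).trans ?_
      have hq : Real.sqrt t ^ 2 = t := Real.sq_sqrt ht0.le
      have hq0 : 0 < Real.sqrt t := Real.sqrt_pos.2 ht0
      have hqe : Real.exp (s ^ 2 / (4 * M)) ≤ Real.sqrt t := by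
        apply Real.le_sqrt_of_sq_le
        rw [← Real.exp_nat_mul]
        refine le_trans (le_of_eq ?_) htX
        rw [hXe]; congr 1; push_cast; field_simp; norm_num
      have hlt2 : Real.log t ≤ 2 * s ^ 2 := by
        calc Real.log t ≤ Real.log (2 * x) := Real.log_le_log ht0 ht2
          _ = Real.log 2 + Real.log x := Real.log_mul (by norm_num) hx0.ne'
          _ ≤ _ := by rw [hLs]; linarith [Real.log_le_sub_one_of_pos (show (0 : ℝ) < 2 by norm_num)]
      have h5 : 4 * Real.log t ≤ η ^ 4 * Real.sqrt t := by
        calc 4 * Real.log t ≤ 8 * s ^ 2 := by linarith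
          _ = 8 * (s ^ 2 * Real.exp (-s)) * Real.exp s := by
              rw [Real.exp_neg]; field_simp
          _ ≤ 1 * Real.exp s := by gcongr
          _ ≤ Real.exp (-(4 * c1) * s + s ^ 2 / (4 * M)) := by
              rw [one_mul]; apply Real.exp_le_exp.2; linarith
          _ = η ^ 4 * Real.exp (s ^ 2 / (4 * M)) := by rw [Real.exp_add, hη4]
          _ ≤ _ := by gcongr
      calc 2 * Real.sqrt t * Real.log t = Real.sqrt t * (4 * Real.log t) / 2 := by ring
        _ ≤ Real.sqrt t * (η ^ 4 * Real.sqrt t) / 2 := by gcongr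
        _ = η ^ 4 * Real.sqrt t ^ 2 / 2 := by ring
        _ = _ := by rw [hq]
    have := abs_sub_le (Chebyshev.theta t) (Chebyshev.psi t) t
    rw [abs_sub_comm (Chebyshev.theta t) (Chebyshev.psi t)] at this
    linarith

open Finset MeasureTheory
open scoped Classical

theorem card_dvd_abs {a b d : ℕ} (hab : a ≤ b) (hd : 0 < d) :
    |(((Finset.Ioc a b).filter (fun n => d ∣ n)).card : ℝ) - ((Finset.Ioc a b).card : ℝ) / d| ≤ 1 := by
  have hd' : (0 : ℝ) < d := by exact_mod_cast hd
  have e : (((Finset.Ioc a b).filter (fun n => d ∣ n)).card : ℝ) = ((b / d : ℕ) : ℝ) - ((a / d : ℕ) : ℝ) := by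
    have h1 := Nat.Ioc_filter_dvd_card_eq_div b d
    have h2 := Nat.Ioc_filter_dvd_card_eq_div a d
    have h3 : (Finset.Ioc 0 b).filter (fun n => d ∣ n) =
        (Finset.Ioc 0 a).filter (fun n => d ∣ n) ∪ (Finset.Ioc a b).filter (fun n => d ∣ n) := by
      rw [← Finset.filter_union, Finset.Ioc_union_Ioc_eq_Ioc (Nat.zero_le _) hab]
    have h4 : Disjoint ((Finset.Ioc 0 a).filter (fun n => d ∣ n)) ((Finset.Ioc a b).filter (fun n => d ∣ n)) := by
      apply Finset.disjoint_filter_filter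
      exact Finset.Ioc_disjoint_Ioc_of_le le_rfl
    rw [h3, Finset.card_union_of_disjoint h4, h2] at h1
    rw [← h1]; push_cast; ring
  rw [e, Nat.card_Ioc, Nat.cast_sub hab, sub_div, ← Nat.floor_div_eq_div (K := ℝ), ← Nat.floor_div_eq_div (K := ℝ)]
  have i1 := Nat.floor_le (show (0 : ℝ) ≤ (b : ℝ) / d by positivity)
  have i2 := Nat.lt_floor_add_one ((b : ℝ) / d)
  have i3 := Nat.floor_le (show (0 : ℝ) ≤ (a : ℝ) / d by positivity)
  have i4 := Nat.lt_floor_add_one ((a : ℝ) / d)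
  rw [abs_le]
  constructor <;> linarith

theorem final_bound {M : ℕ} {x η δ ϖ B : ℝ} {N0 : ℕ} (E : Env M x η N0) (hδ : 0 < δ)
    (hδ1 : δ ≤ 1 / (3 * (M : ℝ) ^ 2)) (hϖ1 : (M : ℝ) * δ + 1 / M < ϖ) (hB : 0 ≤ B)
    {f1 : (Fin M → ℝ) → ℝ} (hf : F1Props M δ B f1) {d : ℕ} (hd : 1 ≤ d) (hdx : (d : ℝ) ≤ x ^ (1 - ϖ)) :
    |(∑ n ∈ (Iset x η).filter (fun n => d ∣ n), (1 + bseq M δ x f1 n)) - ((Iset x η).card : ℝ) / d|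
      ≤ (2 + 2 * ((M + 1) * 2 ^ M * Acon M B) + 2 * Cst M (Acon M B) M) * (((Iset x η).card : ℝ) / d) * η := by
  have hM := E.hM
  have hx := E.hx
  have hx0 : 0 < x := by linarith
  have hη := E.eta0
  have hη1 := E.eta1
  have hL : 0 < Real.log x := by linarith [E.hL]
  have hM2 : (2 : ℝ) ≤ M := by exact_mod_cast hM
  have hA := (Acon_ge hM hB).2
  have hδ2 : 2 * δ ≤ 1 := by
    have : 1 / (3 * (M : ℝ) ^ 2) ≤ 1 / 12 := by gcongr; nlinarith
    linarith
  have hP := PhiL_PP hM hδ hδ2 hf hB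
  have hd0 : d ≠ 0 := by omega
  have hd1 : (1 : ℝ) ≤ d := by exact_mod_cast hd
  have hdp : (0 : ℝ) < d := by linarith
  have hC := Cst_nonneg (M := M) hP.A0 M
  -- size of x / d
  have hy : (N0 : ℝ) ≤ x / d := by
    refine E.hN0x.le.trans ?_
    rw [le_div_iff₀ hdp]
    calc x ^ (2 / (3 * (M : ℝ))) * d ≤ x ^ (2 / (3 * (M : ℝ))) * x ^ (1 - ϖ) := by gcongr
      _ = x ^ (2 / (3 * (M : ℝ)) + (1 - ϖ)) := (Real.rpow_add hx0 _ _).symm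
      _ ≤ x ^ (1 : ℝ) := by
          apply Real.rpow_le_rpow_of_exponent_le hx.le
          have h1 : 2 / (3 * (M : ℝ)) ≤ 1 / M := by
            rw [div_le_div_iff₀ (by positivity) (by positivity)]; linarith
          have h2 : 0 < M * δ := by positivity
          linarith
      _ = x := Real.rpow_one x
  have hy4 : 1 ≤ x / d * η ^ 4 := E.hN0eta.trans (by gcongr)
  have hy0 : 0 < x / d := by positivity
  have hy3 : 8 ≤ x / d * η := by
    have h3 : η ^ 3 ≤ 1 / 8 := by
      calc η ^ 3 ≤ (1 / 2) ^ 3 := by gcongr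
        _ = 1 / 8 := by norm_num
    have h0 : 0 < x / d * η := by positivity
    nlinarith
  -- cardinality
  have hab : ⌊x⌋₊ ≤ ⌊x * (1 + η)⌋₊ := Nat.floor_le_floor (by nlinarith)
  have hK : x * η / 2 ≤ ((Iset x η).card : ℝ) := by
    unfold Iset
    rw [Nat.card_Ioc, Nat.cast_sub hab]
    have i1 := Nat.floor_le hx0.le
    have i2 := Nat.lt_floor_add_one (x * (1 + η))
    have i3 : 8 ≤ x * η := by
      refine hy3.trans ?_
      gcongr
      exact div_le_self hx0.le hd1
    linarith
  have hKd : x / d * η ≤ 2 * (((Iset x η).card : ℝ) / d) := by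
    rw [div_mul_eq_mul_div, ← mul_div_assoc]
    exact div_le_div_of_nonneg_right (by linarith) hdp.le
  set κ := ((Iset x η).card : ℝ) / d with hκ
  have hκ0 : 0 ≤ κ := by positivity
  have hcard : |(((Iset x η).filter (fun n => d ∣ n)).card : ℝ) - κ| ≤ 1 := card_dvd_abs hab hd
  have hone : 1 ≤ 2 * η * κ := by
    calc 1 ≤ x / d * η ^ 4 := hy4
      _ = η ^ 3 * (x / d * η) := by ring
      _ ≤ η * (2 * κ) := by
          have : η ^ 3 ≤ η := by
            calc η ^ 3 ≤ η ^ 1 := pow_le_pow_of_le_one hη.le (by linarith) (by norm_num)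
              _ = η := pow_one _
          gcongr
      _ = _ := by ring
  have hcard2 : (((Iset x η).filter (fun n => d ∣ n)).card : ℝ) ≤ 2 * κ := by
    have := (abs_le.1 hcard).2
    nlinarith
  -- the main sum
  have hSt : |St M δ x η (PhiL M f1) d| ≤ Cst M (Acon M B) M * η ^ 2 * (x / d) := by
    have hR : 0 ≤ Cst M (Acon M B) M * η ^ 2 * (x / d) := by positivity
    by_cases hg : Good M δ x d
    swap
    · rw [St_bad E hP hd0 hg, abs_zero]; exact hR
    rcases lt_or_ge M (cs M δ x d) with h | h
    · rw [St_zero E hP hd0 h, abs_zero]; exact hR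
    rcases lt_or_ge (M - cs M δ x d) 2 with h2 | h2
    · exfalso
      have h3 := (good_log hx hd0 hg).1
      have h4 : Real.log d ≤ (1 - ϖ) * Real.log x := by
        rw [← Real.log_rpow hx0]; exact Real.log_le_log hdp hdx
      have h5 : (cs M δ x d : ℝ) * (1 / M - δ) ≤ 1 - ϖ := le_of_mul_le_mul_right (h3.trans h4) hL
      have h6 : (M : ℝ) ≤ cs M δ x d + 1 := by exact_mod_cast (by omega : M ≤ cs M δ x d + 1)
      have h7 := (delta_facts hM hδ hδ1).1
      have h8 : 0 < 1 / (M : ℝ) - δ := lt_of_lt_of_le (by positivity) h7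
      have h9 : ((M : ℝ) - 1) * (1 / M - δ) ≤ 1 - ϖ := by nlinarith
      have h10 : ((M : ℝ) - 1) * (1 / M - δ) = 1 - 1 / M - M * δ + δ := by field_simp; ring
      linarith
    · have := claim_all E hδ hδ1 hP M (M - cs M δ x d) (by omega) (by omega) d hd0 hg (by omega)
      rw [if_neg (by omega), sub_zero] at this
      exact this
  have hsum : |∑ n ∈ (Iset x η).filter (fun n => d ∣ n), (bseq M δ x f1 n - bt M δ x (PhiL M f1) n)| ≤
      2 * κ * ((M + 1) * 2 ^ M * Acon M B * η) := by
    calc _ ≤ ∑ n ∈ (Iset x η).filter (fun n => d ∣ n), ((M + 1) * 2 ^ M * Acon M B * η) := by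
          refine (Finset.abs_sum_le_sum_abs _ _).trans (Finset.sum_le_sum (fun n hn => ?_))
          exact b_diff E hδ hδ1 hf hB (Finset.mem_filter.1 hn).1
      _ = (((Iset x η).filter (fun n => d ∣ n)).card : ℝ) * ((M + 1) * 2 ^ M * Acon M B * η) := by
          rw [Finset.sum_const, nsmul_eq_mul]
      _ ≤ _ := by gcongr
  have e : (∑ n ∈ (Iset x η).filter (fun n => d ∣ n), (1 + bseq M δ x f1 n)) - κ =
      ((((Iset x η).filter (fun n => d ∣ n)).card : ℝ) - κ) +
      ∑ n ∈ (Iset x η).filter (fun n => d ∣ n), (bseq M δ x f1 n - bt M δ x (PhiL M f1) n) +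
      St M δ x η (PhiL M f1) d := by
    unfold St
    rw [Finset.sum_add_distrib, Finset.sum_sub_distrib, Finset.sum_const, nsmul_eq_mul, mul_one]
    ring
  rw [e]
  have hSt2 : Cst M (Acon M B) M * η ^ 2 * (x / d) ≤ 2 * Cst M (Acon M B) M * κ * η := by
    calc Cst M (Acon M B) M * η ^ 2 * (x / d) = Cst M (Acon M B) M * η * (x / d * η) := by ring
      _ ≤ Cst M (Acon M B) M * η * (2 * κ) := by gcongr
      _ = _ := by ring
  refine (abs_add_le _ _).trans ((add_le_add (abs_add_le _ _) le_rfl).trans ?_)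
  linarith

/-- In the construction of Section 3 of the paper (with `a_n = 1 + b_n`),
one has `0 ≤ a_n ≤ 2` for every `n ∈ I`, and there is a constant `C` such that for every
`1 ≤ d ≤ x^{1−ϖ}`, `|∑_{n ∈ I, d ∣ n} a_n − K/d| ≤ C (K/d) e^{−c_1 √(log x)}`. -/
theorem bombieri_sieve_stmt15 (c0 : ℝ) (hc0 : 0 < c0)
    (hPNT : ∃ C0 : ℝ, ∀ x : ℝ, 2 ≤ x →
      |(∑ n ∈ Finset.Icc 1 ⌊x⌋₊, ArithmeticFunction.vonMangoldt n) - x|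
        ≤ C0 * x * Real.exp (-c0 * Real.sqrt (Real.log x)))
    (ν : ℝ) (hν : 1 / 2 < ν) (hν1 : ν < 1)
    (M : ℕ) (hM : 2 ≤ M) (δ ϖ : ℝ) (hδ0 : 0 < δ)
    (hδ1 : δ ≤ 1 / (3 * (M : ℝ) ^ 2)) (hδ2 : δ ≤ ((2 * M : ℕ) : ℝ) ^ (-(M : ℝ)))
    (hϖ1 : (M : ℝ) * δ + 1 / M < ϖ) (hϖ2 : ϖ < 1 - ν)
    (c1 : ℝ) (hc1 : c1 = c0 * ((2 * M : ℕ) : ℝ) ^ (-(M : ℝ))) :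
    ∃ B₀ : ℝ, ∀ B : ℝ, B₀ ≤ B → ∃ C x₁ : ℝ,
      ∀ f1 : (Fin M → ℝ) → ℝ, F1Props M δ B f1 →
      ∀ x : ℝ, x₁ ≤ x →
        (∀ n ∈ Ifin c1 x, 0 ≤ 1 + bseq M δ x f1 n ∧ 1 + bseq M δ x f1 n ≤ 2) ∧
        (∀ d : ℕ, 1 ≤ d → (d : ℝ) ≤ x ^ (1 - ϖ) →
          |(∑ n ∈ (Ifin c1 x).filter (fun n => d ∣ n), (1 + bseq M δ x f1 n))
              - ((Ifin c1 x).card : ℝ) / d|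
            ≤ C * (((Ifin c1 x).card : ℝ) / d) * Real.exp (-c1 * Real.sqrt (Real.log x))) := by
  obtain ⟨x₁, hx₁⟩ := env_exists c0 hc0 hPNT M hM c1 hc1
  refine ⟨0, fun B hB => ⟨2 + 2 * ((M + 1) * 2 ^ M * Acon M B) + 2 * Cst M (Acon M B) M, x₁,
    fun f1 hf x hx => ⟨fun n _ => ?_, fun d hd hdx => ?_⟩⟩⟩
  · have := abs_le.1 (bseq_abs (x := x) hM hδ0 hδ1 hf n)
    constructor <;> linarith
  · exact final_bound (hx₁ x hx) hδ0 hδ1 hϖ1 hB hf hd hdx
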